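/- arXiv:math/0108212 — 2 statements merged into one kernel-verified Lean document; each statement's English description precedes it below -/
import Mathlib

section
/- Let F ⊂ ℝⁿ be a compact convex set of volume 1, let P be a non-constant polynomial on ℝⁿ of degree at most d, and let M(P) be the unique positive number with Vol{x ∈ F : |P(x)| ≥ M(P)} = 1/e. Then for every q with 0 < q ≤ 1/d, (∫_F |P(x)|^q dx)^{1/q} ≤ 12^d · M(P). -/
open MeasureTheory
open scoped ENNReal

/-- A compact set of reals of measure more than `k * δ` contains `k + 1` points with
consecutive gaps at least `δ`. -/
theorem exists_spaced_points {δ : ℝ} (hδ : 0 < δ) (k : ℕ) (E : Set ℝ) (hE : IsCompact E)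
    (hvol : ENNReal.ofReal (k * δ) < volume E) :
    ∃ x : ℕ → ℝ, (∀ i ≤ k, x i ∈ E) ∧ ∀ i < k, x i + δ ≤ x (i + 1) := by
  induction k generalizing E with
  | zero =>
    have hne : E.Nonempty := nonempty_of_measure_ne_zero (ne_bot_of_gt hvol)
    obtain ⟨a, ha⟩ := hne
    exact ⟨fun _ => a, fun _ _ => ha, fun i hi => absurd hi (Nat.not_lt_zero i)⟩
  | succ k ih =>
    have hne : E.Nonempty := nonempty_of_measure_ne_zero (ne_bot_of_gt hvol)
    set a := sInf E with ha
    have haE : a ∈ E := hE.sInf_mem hne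
    have hle : volume E ≤ volume (E ∩ Set.Ici (a + δ)) + ENNReal.ofReal δ := by
      have hsub : E ⊆ (E ∩ Set.Ici (a + δ)) ∪ Set.Ico a (a + δ) := by
        intro y hy
        rcases le_or_gt (a + δ) y with h | h
        · exact Or.inl ⟨hy, h⟩
        · exact Or.inr ⟨csInf_le hE.bddBelow hy, h⟩
      refine (measure_mono hsub).trans ((measure_union_le _ _).trans ?_)
      rw [Real.volume_Ico, add_sub_cancel_left]
    have hvol' : ENNReal.ofReal (k * δ) < volume (E ∩ Set.Ici (a + δ)) := by
      by_contra! hcon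
      refine absurd hvol (not_lt.mpr (hle.trans ((add_le_add_left hcon _).trans ?_)))
      rw [← ENNReal.ofReal_add (by positivity) hδ.le]
      apply ENNReal.ofReal_le_ofReal
      push_cast
      linarith
    obtain ⟨x, hx, hgap⟩ := ih _ (hE.inter_right isClosed_Ici) hvol'
    refine ⟨fun i => Nat.casesOn i a x, ?_, ?_⟩
    · rintro (_ | i) hi
      · exact haE
      · exact (hx i (by omega)).1
    · rintro (_ | i) hi
      · exact (hx 0 (by omega)).2
      · exact hgap i (by omega)

theorem prod_erase_abs_sub_eq_factorial {i d : ℕ} (hid : i ≤ d) :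
    ∏ j ∈ (Finset.range (d + 1)).erase i, |(i : ℝ) - j| =
      (Nat.factorial i : ℝ) * Nat.factorial (d - i) := by
  induction d, hid using Nat.le_induction with
  | base =>
    have h1 : (Finset.range (i + 1)).erase i = Finset.range i := by
      ext j; simp only [Finset.mem_erase, Finset.mem_range]; omega
    rw [h1, Nat.sub_self, Nat.factorial_zero, Nat.cast_one, mul_one,
      ← Finset.prod_range_add_one_eq_factorial, ← Finset.prod_range_reflect, Nat.cast_prod]
    refine Finset.prod_congr rfl fun j hj => ?_
    have hj' := Finset.mem_range.mp hj
    rw [← Nat.cast_sub (by omega), abs_of_nonneg (Nat.cast_nonneg _)]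
    congr 1; omega
  | succ d hid ih =>
    have h1 : (Finset.range (d + 1 + 1)).erase i =
        insert (d + 1) ((Finset.range (d + 1)).erase i) := by
      ext j; simp only [Finset.mem_erase, Finset.mem_range, Finset.mem_insert]; omega
    rw [h1, Finset.prod_insert (by simp), ih, show d + 1 - i = (d - i) + 1 by omega,
      Nat.factorial_succ]
    have h2 : |(i : ℝ) - ((d + 1 : ℕ) : ℝ)| = ((d - i + 1 : ℕ) : ℝ) := by
      rw [abs_sub_comm, ← Nat.cast_sub (by omega), abs_of_nonneg (by positivity)]
      congr 1; omega
    rw [h2]; push_cast; ring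

theorem abs_eval_zero_le_of_spaced_points {p : Polynomial ℝ} {d : ℕ} (hp : p.natDegree ≤ d)
    {δ M : ℝ} (hδ : 0 < δ) (x : ℕ → ℝ) (hx : ∀ i ≤ d, x i ∈ Set.Icc (0 : ℝ) 1)
    (hgap : ∀ i < d, x i + δ ≤ x (i + 1)) (hM : ∀ i ≤ d, |p.eval (x i)| ≤ M) :
    |p.eval 0| ≤ M * ((2 / δ) ^ d / d.factorial) := by
  have hM0 : 0 ≤ M := (abs_nonneg _).trans (hM 0 (Nat.zero_le _))
  have hmono : ∀ i j, i ≤ j → j ≤ d → δ * ((j : ℝ) - i) ≤ x j - x i := by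
    intro i j hij
    induction j, hij using Nat.le_induction with
    | base => intro _; simp
    | succ j hij ih =>
      intro hj
      have h1 := ih (by omega)
      have h2 := hgap j (by omega)
      push_cast
      linarith
  have hsep : ∀ i ≤ d, ∀ j ≤ d, δ * |(i : ℝ) - j| ≤ |x i - x j| := by
    intro i hi j hj
    rcases le_total i j with h | h
    · rw [abs_sub_comm, abs_sub_comm (x i), abs_of_nonneg (sub_nonneg.mpr (Nat.cast_le.mpr h))]
      exact (hmono i j h hj).trans (le_abs_self _)
    · rw [abs_of_nonneg (sub_nonneg.mpr (Nat.cast_le.mpr h))]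
      exact (hmono j i h hi).trans (le_abs_self _)
  have hinj : Set.InjOn x (Finset.range (d + 1) : Finset ℕ) := by
    intro i hi j hj hij
    have hi' := Finset.mem_range.mp (Finset.mem_coe.mp hi)
    have hj' := Finset.mem_range.mp (Finset.mem_coe.mp hj)
    have := hsep i (by omega) j (by omega)
    rw [hij, sub_self, abs_zero] at this
    have h0 : |(i : ℝ) - j| = 0 := by
      have h1 := abs_nonneg ((i : ℝ) - j)
      nlinarith
    exact_mod_cast sub_eq_zero.mp (abs_eq_zero.mp h0)
  have hdeg : p.degree < (Finset.range (d + 1)).card := by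
    rw [Finset.card_range]
    exact (Polynomial.degree_le_of_natDegree_le hp).trans_lt (by exact_mod_cast Nat.lt_succ_self d)
  have hbasis : ∀ i ∈ Finset.range (d + 1),
      |(Lagrange.basis (Finset.range (d + 1)) x i).eval 0| ≤
        (1 / δ) ^ d / d.factorial * (d.choose i) := by
    intro i hi
    have hi' : i ≤ d := by have := Finset.mem_range.mp hi; omega
    rw [Lagrange.basis, Polynomial.eval_prod, Finset.abs_prod]
    calc ∏ j ∈ (Finset.range (d + 1)).erase i, |(Lagrange.basisDivisor (x i) (x j)).eval 0|
        ≤ ∏ j ∈ (Finset.range (d + 1)).erase i, ((1 / δ) * |(i : ℝ) - j|⁻¹) := by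
          refine Finset.prod_le_prod (fun _ _ => abs_nonneg _) fun j hj => ?_
          obtain ⟨hji, hj⟩ := Finset.mem_erase.mp hj
          have hj' : j ≤ d := by have := Finset.mem_range.mp hj; omega
          have hpos : 0 < |(i : ℝ) - j| :=
            abs_pos.mpr (sub_ne_zero.mpr (by exact_mod_cast hji.symm))
          have hxj := hx j hj'
          simp only [Lagrange.basisDivisor, Polynomial.eval_mul, Polynomial.eval_C,
            Polynomial.eval_sub, Polynomial.eval_X, zero_sub, abs_mul, abs_neg, abs_inv]
          rw [abs_of_nonneg hxj.1, one_div, ← mul_inv]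
          calc |x i - x j|⁻¹ * x j ≤ |x i - x j|⁻¹ * 1 :=
                mul_le_mul_of_nonneg_left hxj.2 (by positivity)
            _ ≤ (δ * |(i : ℝ) - j|)⁻¹ := by
                rw [mul_one]
                exact inv_anti₀ (by positivity) (hsep i hi' j hj')
      _ = (1 / δ) ^ d / d.factorial * (d.choose i) := by
          rw [Finset.prod_mul_distrib, Finset.prod_const, Finset.card_erase_of_mem hi,
            Finset.card_range, Nat.add_sub_cancel, Finset.prod_inv_distrib,
            prod_erase_abs_sub_eq_factorial hi', Nat.cast_choose ℝ hi']
          have h1 : (d.factorial : ℝ) ≠ 0 := by positivity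
          field_simp
  have hsum : (∑ i ∈ Finset.range (d + 1), (d.choose i : ℝ)) = 2 ^ d := by
    exact_mod_cast Nat.sum_range_choose d
  rw [Lagrange.eq_interpolate hinj hdeg, Lagrange.interpolate_apply, Polynomial.eval_finsetSum]
  calc |∑ i ∈ Finset.range (d + 1), (Polynomial.C (p.eval (x i)) *
          Lagrange.basis (Finset.range (d + 1)) x i).eval 0|
      ≤ ∑ i ∈ Finset.range (d + 1), M * ((1 / δ) ^ d / d.factorial * (d.choose i)) := by
        refine (Finset.abs_sum_le_sum_abs _ _).trans (Finset.sum_le_sum fun i hi => ?_)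
        rw [Polynomial.eval_mul, Polynomial.eval_C, abs_mul]
        have hi' : i ≤ d := by have := Finset.mem_range.mp hi; omega
        exact mul_le_mul (hM i hi') (hbasis i hi) (abs_nonneg _) hM0
    _ = M * ((2 / δ) ^ d / d.factorial) := by
        rw [← Finset.mul_sum, ← Finset.mul_sum, hsum]
        simp only [div_pow, one_pow]
        ring

/-- A Remez-type inequality on the unit interval, with constant `2 * e`. -/
theorem volume_abs_eval_lt_le {p : Polynomial ℝ} {d : ℕ} (hd : d ≠ 0) (hp : p.natDegree ≤ d)
    {M s : ℝ} (hM : 0 < M) (hs : 0 < s) (h0 : s ^ d * M ≤ |p.eval 0|) :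
    volume {t ∈ Set.Icc (0 : ℝ) 1 | |p.eval t| < M} ≤ ENNReal.ofReal (2 * Real.exp 1 / s) := by
  by_contra! hcon
  have hd0 : (0 : ℝ) < d := by exact_mod_cast Nat.pos_of_ne_zero hd
  set E : Set ℝ := Set.Icc (0 : ℝ) 1 ∩ {t | |p.eval t| ≤ M} with hE
  have hEc : IsCompact E :=
    isCompact_Icc.inter_right (isClosed_le (by fun_prop) continuous_const)
  have hEvol : ENNReal.ofReal (2 * Real.exp 1 / s) < volume E :=
    hcon.trans_le (measure_mono fun t ht => ⟨ht.1, ht.2.le⟩)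
  obtain ⟨r, hr0, hr1, hr2⟩ := ENNReal.lt_iff_exists_real_btwn.mp hEvol
  have hr1' : 2 * Real.exp 1 / s < r := by
    by_contra! hc
    exact absurd hr1 (not_lt.mpr (ENNReal.ofReal_le_ofReal hc))
  have hrpos : 0 < r := lt_of_le_of_lt (by positivity) hr1'
  have hδ : 0 < r / d := by positivity
  obtain ⟨x, hx, hgap⟩ := exists_spaced_points hδ d E hEc
    (by rwa [mul_div_cancel₀ _ hd0.ne'])
  have h1 := abs_eval_zero_le_of_spaced_points hp hδ x (fun i hi => (hx i hi).1) hgap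
    (fun i hi => (hx i hi).2)
  have h2 : (2 / (r / d)) ^ d / d.factorial ≤ (2 * Real.exp 1 / r) ^ d := by
    have h3 := Real.pow_div_factorial_le_exp d hd0.le d
    rw [← Real.exp_one_pow] at h3
    calc (2 / (r / d)) ^ d / d.factorial = (2 / r) ^ d * ((d : ℝ) ^ d / d.factorial) := by
          rw [show 2 / (r / d) = 2 / r * d by field_simp, mul_pow]; ring
      _ ≤ (2 / r) ^ d * Real.exp 1 ^ d := by gcongr
      _ = _ := by rw [← mul_pow]; congr 1; ring
  have h4 : 2 * Real.exp 1 / r < s := by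
    rw [div_lt_iff₀ hs] at hr1'
    rw [div_lt_iff₀ hrpos]; linarith
  have h5 : (2 * Real.exp 1 / r) ^ d < s ^ d := pow_lt_pow_left₀ h4 (by positivity) hd
  have h6 : |p.eval 0| < M * s ^ d :=
    h1.trans_lt (mul_lt_mul_of_pos_left (h2.trans_lt h5) hM)
  linarith

theorem continuous_cdf_of_noAtoms (μ : Measure ℝ) [IsProbabilityMeasure μ]
    [NullSingletonClass μ] :
    Continuous (ProbabilityTheory.cdf μ) := by
  refine continuous_iff_continuousAt.mpr fun a => ?_
  rw [(ProbabilityTheory.monotone_cdf μ).continuousAt_iff_leftLim_eq_rightLim,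
    StieltjesFunction.rightLim_eq]
  have h := (ProbabilityTheory.cdf μ).measure_singleton a
  rw [ProbabilityTheory.measure_cdf, measure_singleton, eq_comm, ENNReal.ofReal_eq_zero] at h
  exact le_antisymm ((ProbabilityTheory.monotone_cdf μ).leftLim_le le_rfl) (by linarith)

/-- The quantile function of an atomless probability measure is a strictly increasing right
inverse of the distribution function, and transports the uniform measure to the given one. -/
theorem exists_quantile (μ : Measure ℝ) [IsProbabilityMeasure μ] [NullSingletonClass μ] :
    ∃ X : ℝ → ℝ, StrictMonoOn X (Set.Ioo 0 1) ∧
      (∀ u ∈ Set.Ioo (0 : ℝ) 1, ProbabilityTheory.cdf μ (X u) = u) ∧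
      Measure.map X (volume.restrict (Set.Ioo 0 1)) = μ := by
  set Φ := ProbabilityTheory.cdf μ with hΦ
  have hΦm : Monotone Φ := ProbabilityTheory.monotone_cdf μ
  have hΦc : Continuous Φ := continuous_cdf_of_noAtoms μ
  set X : ℝ → ℝ := fun u => sInf {x | u ≤ Φ x} with hX
  have hne : ∀ u ∈ Set.Ioo (0 : ℝ) 1, {x | u ≤ Φ x}.Nonempty := fun u hu =>
    ((ProbabilityTheory.tendsto_cdf_atTop μ).eventually (eventually_ge_nhds hu.2)).exists
  have hbdd : ∀ u ∈ Set.Ioo (0 : ℝ) 1, BddBelow {x | u ≤ Φ x} := by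
    intro u hu
    obtain ⟨y, hy⟩ :=
      ((ProbabilityTheory.tendsto_cdf_atBot μ).eventually (eventually_lt_nhds hu.1)).exists
    refine ⟨y, fun x hx => ?_⟩
    by_contra! hxy
    exact absurd ((le_trans hx (hΦm hxy.le)).trans_lt hy) (lt_irrefl _)
  have hgal : ∀ u ∈ Set.Ioo (0 : ℝ) 1, ∀ x, X u ≤ x ↔ u ≤ Φ x := by
    intro u hu x
    constructor
    · intro h
      have hmem : X u ∈ {x | u ≤ Φ x} :=
        (isClosed_le continuous_const hΦc).csInf_mem (hne u hu) (hbdd u hu)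
      exact le_trans hmem (hΦm h)
    · exact fun h => csInf_le (hbdd u hu) h
  have hinv : ∀ u ∈ Set.Ioo (0 : ℝ) 1, Φ (X u) = u := by
    intro u hu
    refine le_antisymm ?_ ((hgal u hu _).mp le_rfl)
    refine le_of_tendsto (hΦc.continuousAt.tendsto.mono_left
      (nhdsWithin_le_nhds (s := Set.Iio (X u)))) ?_
    filter_upwards [self_mem_nhdsWithin] with y hy
    by_contra! hc
    exact absurd ((hgal u hu y).mpr hc.le) (not_le.mpr hy)
  have hmono : StrictMonoOn X (Set.Ioo 0 1) := by
    intro u hu v hv huv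
    by_contra! hc
    have := hΦm hc
    rw [hinv u hu, hinv v hv] at this
    linarith
  refine ⟨X, hmono, hinv, ?_⟩
  have hXm : AEMeasurable X (volume.restrict (Set.Ioo 0 1)) :=
    aemeasurable_restrict_of_monotoneOn measurableSet_Ioo hmono.monotoneOn
  have : IsFiniteMeasure (Measure.map X (volume.restrict (Set.Ioo (0 : ℝ) 1))) := by
    infer_instance
  refine Measure.ext_of_Iic _ _ fun x => ?_
  rw [Measure.map_apply_of_aemeasurable hXm measurableSet_Iic, ← ProbabilityTheory.ofReal_cdf μ x,
    Measure.restrict_apply' measurableSet_Ioo]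
  have h1 : X ⁻¹' Set.Iic x ∩ Set.Ioo 0 1 = Set.Iic (Φ x) ∩ Set.Ioo 0 1 := by
    ext u
    exact and_congr_left fun hu => hgal u hu x
  have hle : Φ x ≤ 1 := ProbabilityTheory.cdf_le_one μ x
  rw [h1]
  refine le_antisymm ?_ ?_
  · calc volume (Set.Iic (Φ x) ∩ Set.Ioo 0 1) ≤ volume (Set.Ioc 0 (Φ x)) :=
          measure_mono fun u hu => ⟨hu.2.1, hu.1⟩
      _ = _ := by rw [Real.volume_Ioc, sub_zero]
  · calc ENNReal.ofReal (Φ x) = volume (Set.Ioo 0 (Φ x)) := by rw [Real.volume_Ioo, sub_zero]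
      _ ≤ volume (Set.Iic (Φ x) ∩ Set.Ioo 0 1) :=
          measure_mono fun u hu => ⟨hu.2.le, hu.1, hu.2.trans_le hle⟩

/-- A monotone parametrization of a density on the line by the unit interval. -/
theorem exists_quantile_of_density {f : ℝ → ℝ≥0∞} (hf : Measurable f)
    (h0 : ∫⁻ x, f x ≠ 0) (htop : ∫⁻ x, f x ≠ ∞) :
    ∃ (X : ℝ → ℝ) (S : Set ℝ), Measurable X ∧ MeasurableSet S ∧
      S ∈ ae (volume.restrict (Set.Ioo (0 : ℝ) 1)) ∧
      StrictMonoOn X S ∧ ∀ u ∈ S, f (X u) ≠ 0 ∧ f (X u) ≠ ∞ ∧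
        HasDerivWithinAt X ((∫⁻ x, f x) / f (X u)).toReal S u := by
  set F := ∫⁻ x, f x with hF
  set μ : Measure ℝ := volume.withDensity (fun x => f x / F) with hμ
  have hfm : Measurable fun x => f x / F := hf.div_const F
  have : IsProbabilityMeasure μ := by
    constructor
    rw [hμ, withDensity_apply _ MeasurableSet.univ, Measure.restrict_univ]
    simp only [div_eq_mul_inv]
    rw [lintegral_mul_const _ hf, ← hF, ENNReal.mul_inv_cancel h0 htop]
  have hac : μ ≪ volume := withDensity_absolutelyContinuous _ _
  have : NullSingletonClass μ := ⟨fun x => hac (measure_singleton x)⟩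
  obtain ⟨X, hmono, hinv, hmap⟩ := exists_quantile μ
  have hXm : AEMeasurable X (volume.restrict (Set.Ioo 0 1)) :=
    aemeasurable_restrict_of_monotoneOn measurableSet_Ioo hmono.monotoneOn
  have hder : ∀ᵐ x ∂μ, HasDerivAt (ProbabilityTheory.cdf μ) (f x / F).toReal x := by
    refine hac.ae_le ?_
    have h1 := (ProbabilityTheory.cdf μ).ae_hasDerivAt
    rw [ProbabilityTheory.measure_cdf] at h1
    filter_upwards [h1, Measure.rnDeriv_withDensity volume hfm] with x hx1 hx2
    rwa [hx2] at hx1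
  rw [← hmap] at hder
  have hderX := ae_of_ae_map hXm hder
  rw [hmap] at hderX
  have hdiff := hmono.monotoneOn.ae_differentiableWithinAt measurableSet_Ioo
  have hgood : ∀ᵐ u ∂volume.restrict (Set.Ioo (0 : ℝ) 1), u ∈ Set.Ioo (0 : ℝ) 1 ∧
      hXm.mk X u = X u ∧ f (X u) ≠ 0 ∧ f (X u) ≠ ∞ ∧ HasDerivAt X (F / f (X u)).toReal u := by
    filter_upwards [hXm.ae_eq_mk, hderX, hdiff, ae_restrict_mem measurableSet_Ioo]
      with u hu0 hu1 hu2 hu3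
    have hnhds : Set.Ioo (0 : ℝ) 1 ∈ nhds u := isOpen_Ioo.mem_nhds hu3
    have hd := (hu2.differentiableAt hnhds).hasDerivAt
    have hcomp := hu1.comp u hd
    have hid : HasDerivAt (ProbabilityTheory.cdf μ ∘ X) 1 u := by
      refine (hasDerivAt_id u).congr_of_eventuallyEq ?_
      filter_upwards [hnhds] with v hv using hinv v hv
    have heq := hcomp.unique hid
    have hfin : f (X u) / F ≠ ∞ ∧ f (X u) / F ≠ 0 := by
      constructor <;> intro h <;> rw [h] at heq <;> simp at heq
    have hne0 : f (X u) ≠ 0 := fun h => hfin.2 (by rw [h, ENNReal.zero_div])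
    have hneT : f (X u) ≠ ∞ := fun h => hfin.1 (by rw [h, ENNReal.top_div_of_ne_top htop])
    refine ⟨hu3, hu0.symm, hne0, hneT, ?_⟩
    suffices hval : (F / f (X u)).toReal = deriv X u by rwa [hval]
    rw [ENNReal.toReal_div] at heq ⊢
    have hF0 := ENNReal.toReal_ne_zero.mpr ⟨h0, htop⟩
    have hf0 := ENNReal.toReal_ne_zero.mpr ⟨hne0, hneT⟩
    field_simp at heq ⊢
    linarith
  obtain ⟨N, hsub, hNm, hN0⟩ := exists_measurable_superset_of_null (mem_ae_iff.mp hgood)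
  have hS : ∀ u ∈ Nᶜ, u ∈ Set.Ioo (0 : ℝ) 1 ∧ hXm.mk X u = X u ∧ f (X u) ≠ 0 ∧ f (X u) ≠ ∞ ∧
      HasDerivAt X (F / f (X u)).toReal u := fun u hu => by
    by_contra hc
    exact hu (hsub hc)
  refine ⟨hXm.mk X, Nᶜ, hXm.measurable_mk, hNm.compl, compl_mem_ae_iff.mpr hN0, ?_, ?_⟩
  · intro u hu v hv huv
    rw [(hS u hu).2.1, (hS v hv).2.1]
    exact hmono (hS u hu).1 (hS v hv).1 huv
  · intro u hu
    obtain ⟨-, h1, h2, h3, h4⟩ := hS u hu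
    rw [h1]
    exact ⟨h2, h3, h4.hasDerivWithinAt.congr (fun v hv => (hS v hv).2.1) h1⟩

/-- An averaged form of the Prékopa–Leindler inequality: a lower bound for the `ν`-average of the
rescaled values of `ψ t` at `(1 - t) • x + t • y`, valid for all `x` and `y`, is inherited by the
integrals of `ψ t`, `f` and `g`. -/
def AveragedPrekopaLeindler (ν : Measure ℝ) {E : Type*} [AddCommGroup E] [Module ℝ E]
    [MeasurableSpace E] (μ : Measure E) : Prop :=
  ∀ (f g : E → ℝ≥0∞) (ψ : ℝ → E → ℝ≥0∞) (c : ℝ≥0∞), Measurable f → Measurable g →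
    Measurable (Function.uncurry ψ) →
    ∫⁻ x, f x ∂μ ≠ 0 → ∫⁻ x, f x ∂μ ≠ ∞ → ∫⁻ x, g x ∂μ ≠ 0 → ∫⁻ x, g x ∂μ ≠ ∞ →
    (∀ x y, f x ≠ 0 → f x ≠ ∞ → g y ≠ 0 → g y ≠ ∞ →
      c ≤ ∫⁻ t, ψ t ((1 - t) • x + t • y) * (f x ^ (t - 1) * g y ^ (-t)) ∂ν) →
    c ≤ ∫⁻ t, (∫⁻ z, ψ t z ∂μ) * ((∫⁻ x, f x ∂μ) ^ (t - 1) * (∫⁻ x, g x ∂μ) ^ (-t)) ∂ν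

theorem ENNReal.rpow_mul_rpow_le_ofReal_weighted {A B : ℝ≥0∞} (hA : A ≠ ∞) (hB : B ≠ ∞) {t : ℝ}
    (ht0 : 0 ≤ t) (ht1 : t ≤ 1) :
    A ^ (1 - t) * B ^ t ≤ ENNReal.ofReal ((1 - t) * A.toReal + t * B.toReal) := by
  have h := Real.geom_mean_le_arith_mean2_weighted (sub_nonneg.mpr ht1) ht0
    (ENNReal.toReal_nonneg (a := A)) (ENNReal.toReal_nonneg (a := B)) (by ring)
  calc A ^ (1 - t) * B ^ t
      = ENNReal.ofReal (A.toReal ^ (1 - t) * B.toReal ^ t) := by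
        rw [ENNReal.ofReal_mul (by positivity), ENNReal.toReal_rpow, ENNReal.toReal_rpow,
          ENNReal.ofReal_toReal (ENNReal.rpow_ne_top_of_nonneg (sub_nonneg.mpr ht1) hA),
          ENNReal.ofReal_toReal (ENNReal.rpow_ne_top_of_nonneg ht0 hB)]
    _ ≤ _ := ENNReal.ofReal_le_ofReal h

theorem ENNReal.div_rpow_mul_rpow_neg {A a : ℝ≥0∞} (hA0 : A ≠ 0) (hA : A ≠ ∞) (ha : a ≠ ∞)
    (s : ℝ) : (A / a) ^ s * A ^ (-s) = a ^ (-s) := by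
  rw [div_eq_mul_inv, ENNReal.mul_rpow_of_ne_zero hA0 (ENNReal.inv_ne_zero.mpr ha), mul_right_comm,
    ← ENNReal.rpow_add _ _ hA0 hA, add_neg_cancel, ENNReal.rpow_zero, one_mul, ENNReal.inv_rpow,
    ENNReal.rpow_neg]

theorem averagedPrekopaLeindler_real (ν : Measure ℝ) [SFinite ν]
    (hν : ∀ᵐ t ∂ν, t ∈ Set.Icc (0 : ℝ) 1) :
    AveragedPrekopaLeindler ν (volume : Measure ℝ) := by
  intro f g ψ c hf hg hψ hF0 hF hG0 hG hyp
  obtain ⟨X, S₁, hXm, hS₁, hS₁ae, hXmono, hX⟩ := exists_quantile_of_density hf hF0 hF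
  obtain ⟨Y, S₂, hYm, hS₂, hS₂ae, hYmono, hY⟩ := exists_quantile_of_density hg hG0 hG
  set F := ∫⁻ x, f x
  set G := ∫⁻ x, g x
  set S := S₁ ∩ S₂ ∩ Set.Ioo 0 1 with hSdef
  have hS : MeasurableSet S := (hS₁.inter hS₂).inter measurableSet_Ioo
  have hSvol : volume S = 1 := by
    rw [hSdef, ← Measure.restrict_apply' measurableSet_Ioo,
      measure_congr (Filter.eventuallyEq_univ.mpr (Filter.inter_mem hS₁ae hS₂ae))]
    simp
  have hS1 : ∀ u ∈ S, u ∈ S₁ := fun u hu => hu.1.1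
  have hS2 : ∀ u ∈ S, u ∈ S₂ := fun u hu => hu.1.2
  have hchange : ∀ t ∈ Set.Icc (0 : ℝ) 1,
      ∫⁻ u in S, ψ t ((1 - t) • X u + t • Y u) * (f (X u) ^ (t - 1) * g (Y u) ^ (-t)) ≤
        (∫⁻ z, ψ t z) * (F ^ (t - 1) * G ^ (-t)) := by
    intro t ht
    have hder : ∀ u ∈ S, HasDerivWithinAt (fun u => (1 - t) • X u + t • Y u)
        ((1 - t) * (F / f (X u)).toReal + t * (G / g (Y u)).toReal) S u := by
      intro u hu
      exact (((hX u (hS1 u hu)).2.2.mono hS1).const_smul (1 - t)).add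
        (((hY u (hS2 u hu)).2.2.mono hS2).const_smul t)
    have hinj : Set.InjOn (fun u => (1 - t) • X u + t • Y u) S := by
      refine StrictMonoOn.injOn fun u hu v hv huv => ?_
      have h1 := hXmono (hS1 u hu) (hS1 v hv) huv
      have h2 := hYmono (hS2 u hu) (hS2 v hv) huv
      simp only [smul_eq_mul]
      rcases ht.1.eq_or_lt with h | h
      · simpa [← h] using h1
      · nlinarith [mul_lt_mul_of_pos_left h2 h,
          mul_le_mul_of_nonneg_left h1.le (sub_nonneg.mpr ht.2)]
    have hcov := lintegral_image_eq_lintegral_abs_deriv_mul hS hder hinj (ψ t)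
    calc ∫⁻ u in S, ψ t ((1 - t) • X u + t • Y u) * (f (X u) ^ (t - 1) * g (Y u) ^ (-t))
        ≤ ∫⁻ u in S, (ENNReal.ofReal
            |(1 - t) * (F / f (X u)).toReal + t * (G / g (Y u)).toReal| *
              ψ t ((1 - t) • X u + t • Y u)) * (F ^ (t - 1) * G ^ (-t)) := by
          refine setLIntegral_mono' hS fun u hu => ?_
          obtain ⟨hf0, hft, -⟩ := hX u (hS1 u hu)
          obtain ⟨hg0, hgt, -⟩ := hY u (hS2 u hu)
          have hamgm := ENNReal.rpow_mul_rpow_le_ofReal_weighted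
            (ENNReal.div_ne_top hF hf0) (ENNReal.div_ne_top hG hg0) ht.1 ht.2
          have e1 := ENNReal.div_rpow_mul_rpow_neg hF0 hF hft (1 - t)
          have e2 := ENNReal.div_rpow_mul_rpow_neg hG0 hG hgt t
          rw [neg_sub] at e1
          rw [← e1, ← e2]
          calc ψ t ((1 - t) • X u + t • Y u) *
                ((F / f (X u)) ^ (1 - t) * F ^ (t - 1) * ((G / g (Y u)) ^ t * G ^ (-t)))
              = ((F / f (X u)) ^ (1 - t) * (G / g (Y u)) ^ t *
                  ψ t ((1 - t) • X u + t • Y u)) * (F ^ (t - 1) * G ^ (-t)) := by ring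
            _ ≤ _ := by
                gcongr
                exact hamgm.trans (ENNReal.ofReal_le_ofReal (le_abs_self _))
      _ = (∫⁻ z in (fun u => (1 - t) • X u + t • Y u) '' S, ψ t z) *
            (F ^ (t - 1) * G ^ (-t)) := by
          rw [lintegral_mul_const'' _ , hcov]
          have h1 : Measurable fun u => ψ t ((1 - t) • X u + t • Y u) :=
            (hψ.of_uncurry_left (x := t)).comp
              ((hXm.const_smul (1 - t)).add (hYm.const_smul t))
          have h2 : Measurable fun u => ENNReal.ofReal
            |(1 - t) * (F / f (X u)).toReal + t * (G / g (Y u)).toReal| := by fun_prop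
          exact (h2.mul h1).aemeasurable
      _ ≤ (∫⁻ z, ψ t z) * (F ^ (t - 1) * G ^ (-t)) := by
          gcongr
          exact Measure.restrict_le_self
  calc c = ∫⁻ _ in S, c := by rw [setLIntegral_const, hSvol, mul_one]
    _ ≤ ∫⁻ u in S, ∫⁻ t, ψ t ((1 - t) • X u + t • Y u) *
          (f (X u) ^ (t - 1) * g (Y u) ^ (-t)) ∂ν := by
        refine setLIntegral_mono' hS fun u hu => ?_
        obtain ⟨hf0, hft, -⟩ := hX u (hS1 u hu)
        obtain ⟨hg0, hgt, -⟩ := hY u (hS2 u hu)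
        exact hyp _ _ hf0 hft hg0 hgt
    _ = ∫⁻ t, (∫⁻ u in S, ψ t ((1 - t) • X u + t • Y u) *
          (f (X u) ^ (t - 1) * g (Y u) ^ (-t))) ∂ν := by
        refine lintegral_lintegral_swap (Measurable.aemeasurable ?_)
        have h1 : Measurable fun p : ℝ × ℝ => ψ p.2 ((1 - p.2) • X p.1 + p.2 • Y p.1) :=
          hψ.comp (measurable_snd.prodMk (by fun_prop))
        have h2 : Measurable fun p : ℝ × ℝ => f (X p.1) ^ (p.2 - 1) * g (Y p.1) ^ (-p.2) := by
          fun_prop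
        exact h1.mul h2
    _ ≤ _ := by
        refine lintegral_mono_ae ?_
        filter_upwards [hν] with t ht using hchange t ht

theorem averagedPrekopaLeindler_prod {ν : Measure ℝ} [SFinite ν]
    (hν : ∀ᵐ t ∂ν, t ∈ Set.Icc (0 : ℝ) 1) {E : Type*} [AddCommGroup E] [Module ℝ E]
    [MeasurableSpace E] {μ : Measure E} [SFinite μ] (h : AveragedPrekopaLeindler ν μ) :
    AveragedPrekopaLeindler ν ((volume : Measure ℝ).prod μ) := by
  intro f g ψ c hf hg hψ hF0 hF hG0 hG hyp
  have hψ3 : Measurable fun p : (ℝ × ℝ) × E => ψ p.1.1 (p.1.2, p.2) :=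
    hψ.comp (measurable_fst.fst.prodMk (measurable_fst.snd.prodMk measurable_snd))
  have hψi : ∀ t, ∫⁻ z, ψ t z ∂((volume : Measure ℝ).prod μ) = ∫⁻ a, ∫⁻ b, ψ t (a, b) ∂μ :=
    fun t => lintegral_prod _ (hψ.of_uncurry_left (x := t)).aemeasurable
  rw [lintegral_prod _ hf.aemeasurable] at hF0 hF ⊢
  rw [lintegral_prod _ hg.aemeasurable] at hG0 hG ⊢
  simp only [hψi]
  refine averagedPrekopaLeindler_real ν hν (fun a => ∫⁻ b, f (a, b) ∂μ)
    (fun a => ∫⁻ b, g (a, b) ∂μ) (fun t a => ∫⁻ b, ψ t (a, b) ∂μ) c hf.lintegral_prod_right'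
    hg.lintegral_prod_right' hψ3.lintegral_prod_right' hF0 hF hG0 hG ?_
  intro x y hfx0 hfx hgy0 hgy
  refine h (fun b => f (x, b)) (fun b => g (y, b)) (fun t b => ψ t ((1 - t) • x + t • y, b)) c
    (hf.comp measurable_prodMk_left) (hg.comp measurable_prodMk_left) ?_ hfx0 hfx hgy0 hgy ?_
  · exact hψ.comp (measurable_fst.prodMk (Measurable.prodMk (by fun_prop) measurable_snd))
  · intro x' y' h1 h2 h3 h4
    exact hyp (x, x') (y, y') h1 h2 h3 h4

theorem AveragedPrekopaLeindler.of_measurePreserving {ν : Measure ℝ} {E E' : Type*}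
    [AddCommGroup E] [Module ℝ E] [MeasurableSpace E] [AddCommGroup E'] [Module ℝ E']
    [MeasurableSpace E'] {μ : Measure E} {μ' : Measure E'} (h : AveragedPrekopaLeindler ν μ)
    (e : E →ₗ[ℝ] E') (he : MeasurePreserving e μ μ') : AveragedPrekopaLeindler ν μ' := by
  intro f g ψ c hf hg hψ hF0 hF hG0 hG hyp
  have hψi : ∀ t, ∫⁻ z, ψ t z ∂μ' = ∫⁻ a, ψ t (e a) ∂μ :=
    fun t => (he.lintegral_comp (hψ.of_uncurry_left (x := t))).symm
  rw [← he.lintegral_comp hf] at hF0 hF ⊢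
  rw [← he.lintegral_comp hg] at hG0 hG ⊢
  simp only [hψi]
  refine h (fun a => f (e a)) (fun a => g (e a)) (fun t a => ψ t (e a)) c
    (hf.comp he.measurable) (hg.comp he.measurable)
    (hψ.comp (measurable_fst.prodMk (he.measurable.comp measurable_snd))) hF0 hF hG0 hG ?_
  intro x y h1 h2 h3 h4
  simpa only [map_add, map_smul] using hyp (e x) (e y) h1 h2 h3 h4

theorem averagedPrekopaLeindler_pi {ν : Measure ℝ} [SFinite ν]
    (hν : ∀ᵐ t ∂ν, t ∈ Set.Icc (0 : ℝ) 1) (n : ℕ) :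
    AveragedPrekopaLeindler ν (volume : Measure (Fin n → ℝ)) := by
  induction n with
  | zero =>
    intro f g ψ c hf hg hψ hF0 hF hG0 hG hyp
    simp only [volume_pi, Measure.pi_of_empty _ (0 : Fin 0 → ℝ), lintegral_dirac] at *
    have h := hyp 0 0 hF0 hF hG0 hG
    simpa only [smul_zero, add_zero] using h
  | succ n ih =>
    have hp := averagedPrekopaLeindler_prod hν ih
    refine hp.of_measurePreserving (Fin.consLinearEquiv ℝ (fun _ : Fin (n + 1) => ℝ)).toLinearMap ?_
    have heq : ⇑(Fin.consLinearEquiv ℝ (fun _ : Fin (n + 1) => ℝ)).toLinearMap =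
        ⇑(MeasurableEquiv.piFinSuccAbove (fun _ : Fin (n + 1) => ℝ) 0).symm :=
      funext fun p => (Fin.insertNth_zero' p.1 p.2).symm
    rw [heq]
    exact (volume_preserving_piFinSuccAbove (fun _ : Fin (n + 1) => ℝ) 0).symm

theorem averagedPrekopaLeindler_euclideanSpace {ν : Measure ℝ} [SFinite ν]
    (hν : ∀ᵐ t ∂ν, t ∈ Set.Icc (0 : ℝ) 1) (n : ℕ) :
    AveragedPrekopaLeindler ν (volume : Measure (EuclideanSpace ℝ (Fin n))) :=
  (averagedPrekopaLeindler_pi hν n).of_measurePreserving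
    (WithLp.linearEquiv 2 ℝ (Fin n → ℝ)).symm.toLinearMap (PiLp.volume_preserving_toLp (Fin n))

/-- If almost every point of each segment from `A` to `F`, up to length proportion `ε`, lies in
a set `B` of measure `1 / e`, then the measure `exp (-α)` of `A` is small. -/
theorem inv_le_of_segments_mostly_mem {n : ℕ} {A B F : Set (EuclideanSpace ℝ (Fin n))}
    (hA : MeasurableSet A) (hB : MeasurableSet B) (hF : MeasurableSet F) (hFvol : volume F = 1)
    (hBvol : volume B = ENNReal.ofReal (Real.exp (-1))) {α ε : ℝ} (hα : 1 ≤ α) (hε : 0 ≤ ε)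
    (hAvol : volume A = ENNReal.ofReal (Real.exp (-α)))
    (hseg : ∀ x ∈ A, ∀ y ∈ F,
      volume {t ∈ Set.Icc (0 : ℝ) 1 | (1 - t) • x + t • y ∉ B} ≤ ENNReal.ofReal ε) :
    Real.exp (-1) / α ≤ ε := by
  have hα0 : 0 < α := by linarith
  have hα1 : α⁻¹ ≤ 1 := inv_le_one_of_one_le₀ hα
  have hαi : 0 < α⁻¹ := inv_pos.mpr hα0
  set J : Set ℝ := Set.Icc (1 - α⁻¹) 1 with hJ
  have hJsub : ∀ t ∈ J, t ∈ Set.Icc (0 : ℝ) 1 := fun t ht => ⟨by linarith [ht.1], ht.2⟩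
  have hν : ∀ᵐ t ∂volume.restrict J, t ∈ Set.Icc (0 : ℝ) 1 := by
    filter_upwards [ae_restrict_mem measurableSet_Icc] with t ht using hJsub t ht
  have hiA : ∫⁻ x, A.indicator (1 : EuclideanSpace ℝ (Fin n) → ℝ≥0∞) x =
      ENNReal.ofReal (Real.exp (-α)) := by rw [lintegral_indicator_one hA, hAvol]
  have hiF : ∫⁻ x, F.indicator (1 : EuclideanSpace ℝ (Fin n) → ℝ≥0∞) x = 1 := by
    rw [lintegral_indicator_one hF, hFvol]
  have hiB : ∫⁻ x, B.indicator (1 : EuclideanSpace ℝ (Fin n) → ℝ≥0∞) x =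
      ENNReal.ofReal (Real.exp (-1)) := by rw [lintegral_indicator_one hB, hBvol]
  have key := averagedPrekopaLeindler_euclideanSpace hν n (A.indicator 1) (F.indicator 1)
    (fun _ => B.indicator 1) (ENNReal.ofReal (α⁻¹ - ε)) (measurable_one.indicator hA)
    (measurable_one.indicator hF) ((measurable_one.indicator hB).comp measurable_snd)
    (by rw [hiA]; simp [Real.exp_pos]) (by rw [hiA]; exact ENNReal.ofReal_ne_top)
    (by rw [hiF]; exact one_ne_zero) (by rw [hiF]; exact ENNReal.one_ne_top) ?_
  · rw [hiA, hiF, hiB] at key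
    have hderiv : ∀ t : ℝ, HasDerivAt (fun t => -Real.exp (-1 + α * (1 - t)) / α)
        (Real.exp (-1 + α * (1 - t))) t := by
      intro t
      have h1 : HasDerivAt (fun t : ℝ => -1 + α * (1 - t)) (-α) t := by
        have := (((hasDerivAt_id t).const_sub 1).const_mul α).const_add (-1)
        simpa using this
      have h2 := (h1.exp.neg).div_const α
      have h3 : -(Real.exp (-1 + α * (1 - t)) * -α) / α = Real.exp (-1 + α * (1 - t)) := by
        rw [mul_neg, neg_neg, mul_div_cancel_right₀ _ hα0.ne']
      rw [h3] at h2
      exact h2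
    have hcont : Continuous fun t : ℝ => Real.exp (-1 + α * (1 - t)) := by fun_prop
    have hintegral : ∫ t in J, Real.exp (-1 + α * (1 - t)) = (1 - Real.exp (-1)) / α := by
      rw [hJ, integral_Icc_eq_integral_Ioc,
        ← intervalIntegral.integral_of_le (by linarith),
        intervalIntegral.integral_eq_sub_of_hasDerivAt (fun t _ => hderiv t)
          (hcont.intervalIntegrable _ _)]
      have h1 : -1 + α * (1 - (1 - α⁻¹)) = 0 := by field_simp; ring
      rw [h1, Real.exp_zero]
      simp only [sub_self, mul_zero, add_zero]
      ring
    have hrhs : ∫⁻ t in J, ENNReal.ofReal (Real.exp (-1)) *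
        (ENNReal.ofReal (Real.exp (-α)) ^ (t - 1) * 1 ^ (-t)) =
          ENNReal.ofReal ((1 - Real.exp (-1)) / α) := by
      rw [← hintegral, ofReal_integral_eq_lintegral_ofReal hcont.integrableOn_Icc
        (Filter.Eventually.of_forall fun t => (Real.exp_pos _).le)]
      refine lintegral_congr fun t => ?_
      rw [ENNReal.one_rpow, mul_one, ENNReal.ofReal_rpow_of_pos (Real.exp_pos _),
        ← ENNReal.ofReal_mul (Real.exp_pos _).le, ← Real.exp_mul, ← Real.exp_add]
      congr 2
      ring
    rw [hrhs] at key
    have he : Real.exp (-1) ≤ 1 := Real.exp_le_one_iff.mpr (by norm_num)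
    have h3 := (ENNReal.ofReal_le_ofReal_iff (div_nonneg (sub_nonneg.mpr he) hα0.le)).mp key
    rw [sub_div, one_div] at h3
    linarith
  · intro x y hx _ hy _
    have hxA : x ∈ A := Set.mem_of_indicator_ne_zero hx
    have hyF : y ∈ F := Set.mem_of_indicator_ne_zero hy
    simp only [Set.indicator_of_mem hxA, Set.indicator_of_mem hyF, Pi.one_apply,
      ENNReal.one_rpow, mul_one]
    have hmeas : MeasurableSet {t : ℝ | (1 - t) • x + t • y ∈ B} :=
      (Continuous.measurable (by fun_prop : Continuous fun t : ℝ => (1 - t) • x + t • y)) hB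
    have hind : ∀ t : ℝ, B.indicator (1 : EuclideanSpace ℝ (Fin n) → ℝ≥0∞)
        ((1 - t) • x + t • y) = {t : ℝ | (1 - t) • x + t • y ∈ B}.indicator 1 t := fun t => rfl
    simp only [hind]
    rw [lintegral_indicator_one hmeas, Measure.restrict_apply hmeas, ENNReal.ofReal_sub _ hε,
      tsub_le_iff_right]
    calc ENNReal.ofReal α⁻¹ = volume J := by rw [hJ, Real.volume_Icc]; congr 1; ring
      _ ≤ volume (({t : ℝ | (1 - t) • x + t • y ∈ B} ∩ J) ∪
            {t ∈ Set.Icc (0 : ℝ) 1 | (1 - t) • x + t • y ∉ B}) := by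
          refine measure_mono fun t ht => ?_
          by_cases h : (1 - t) • x + t • y ∈ B
          · exact Or.inl ⟨h, ht⟩
          · exact Or.inr ⟨hJsub t ht, h⟩
      _ ≤ _ := (measure_union_le _ _).trans (add_le_add_right (hseg x hxA y hyF) _)

theorem continuous_eval_euclideanSpace {n : ℕ} (P : MvPolynomial (Fin n) ℝ) :
    Continuous fun x : EuclideanSpace ℝ (Fin n) => MvPolynomial.eval (fun i => x i) P :=
  (MvPolynomial.continuous_eval P).comp (by fun_prop)

/-- The restriction of a multivariate polynomial to a line. -/
theorem exists_polynomial_eval_segment {n d : ℕ} {P : MvPolynomial (Fin n) ℝ}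
    (hPd : P.totalDegree ≤ d) (x y : EuclideanSpace ℝ (Fin n)) :
    ∃ p : Polynomial ℝ, p.natDegree ≤ d ∧
      ∀ t : ℝ, p.eval t = MvPolynomial.eval (fun i => ((1 - t) • x + t • y) i) P := by
  refine ⟨MvPolynomial.aeval
    (fun i => Polynomial.C (y i - x i) * Polynomial.X + Polynomial.C (x i)) P, ?_, fun t => ?_⟩
  · have h := MvPolynomial.aeval_natDegree_le P hPd
      (fun i => Polynomial.C (y i - x i) * Polynomial.X + Polynomial.C (x i)) (n := 1)
      (fun i => Polynomial.natDegree_linear_le)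
    rwa [mul_one] at h
  · rw [← Polynomial.coe_evalRingHom, MvPolynomial.map_aeval, MvPolynomial.coe_eval₂Hom,
      MvPolynomial.eval, MvPolynomial.coe_eval₂Hom]
    congr 1
    · ext r; simp
    · funext i
      simp
      ring

/-- Exponential decay of the distribution function of a polynomial on a convex body. -/
theorem volume_superlevel_le_exp {n d : ℕ} (hd : d ≠ 0) {P : MvPolynomial (Fin n) ℝ}
    (hPd : P.totalDegree ≤ d) {F : Set (EuclideanSpace ℝ (Fin n))} (hFcomp : IsCompact F)
    (hFconv : Convex ℝ F) (hFvol : volume F = 1) {M : ℝ} (hM : 0 < M)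
    (hMdef : volume {x ∈ F | M ≤ |MvPolynomial.eval (fun i => x i) P|} =
      ENNReal.ofReal (Real.exp (-1))) {s : ℝ} (hs : 1 ≤ s) :
    volume {x ∈ F | s ^ d * M ≤ |MvPolynomial.eval (fun i => x i) P|} ≤
      ENNReal.ofReal (Real.exp (-(s / (2 * Real.exp 1 ^ 2)))) := by
  have hmeas : ∀ c : ℝ, MeasurableSet {x ∈ F | c ≤ |MvPolynomial.eval (fun i => x i) P|} :=
    fun c => hFcomp.measurableSet.inter
      (isClosed_le continuous_const (continuous_eval_euclideanSpace P).abs).measurableSet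
  set A := {x ∈ F | s ^ d * M ≤ |MvPolynomial.eval (fun i => x i) P|} with hA
  set B := {x ∈ F | M ≤ |MvPolynomial.eval (fun i => x i) P|} with hB
  have hs0 : 0 < s := by linarith
  have hAB : volume A ≤ volume B := by
    refine measure_mono fun x hx => ⟨hx.1, le_trans ?_ hx.2⟩
    exact le_mul_of_one_le_left hM.le (one_le_pow₀ hs)
  have hAtop : volume A ≠ ∞ := ne_top_of_le_ne_top (by rw [hMdef]; exact ENNReal.ofReal_ne_top) hAB
  rcases eq_or_ne (volume A) 0 with h0 | h0
  · rw [h0]; exact zero_le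
  have hapos : 0 < (volume A).toReal := ENNReal.toReal_pos h0 hAtop
  set α := -Real.log (volume A).toReal with hα
  have hexp : Real.exp (-α) = (volume A).toReal := by rw [hα, neg_neg, Real.exp_log hapos]
  have hAvol : volume A = ENNReal.ofReal (Real.exp (-α)) := by
    rw [hexp, ENNReal.ofReal_toReal hAtop]
  have hα1 : 1 ≤ α := by
    rw [hMdef, hAvol, ENNReal.ofReal_le_ofReal_iff (Real.exp_pos _).le, Real.exp_le_exp] at hAB
    linarith
  have hkey := inv_le_of_segments_mostly_mem (hmeas _) (hmeas _) hFcomp.measurableSet hFvol hMdef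
    hα1 (ε := 2 * Real.exp 1 / s) (by positivity) hAvol ?_
  · rw [hAvol]
    refine ENNReal.ofReal_le_ofReal (Real.exp_le_exp.mpr (neg_le_neg ?_))
    rw [Real.exp_neg, div_le_div_iff₀ (by linarith) hs0] at hkey
    rw [div_le_iff₀ (by positivity)]
    have he := Real.exp_pos 1
    calc s = Real.exp 1 * ((Real.exp 1)⁻¹ * s) := by field_simp
      _ ≤ Real.exp 1 * (2 * Real.exp 1 * α) := by gcongr
      _ = _ := by ring
  · intro x hx y hy
    obtain ⟨p, hp, hpe⟩ := exists_polynomial_eval_segment hPd x y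
    refine (measure_mono ?_).trans (volume_abs_eval_lt_le hd hp hM hs0 ?_)
    · rintro t ⟨ht, hnot⟩
      refine ⟨ht, ?_⟩
      have hz : (1 - t) • x + t • y ∈ F :=
        hFconv hx.1 hy (sub_nonneg.mpr ht.2) ht.1 (by ring)
      by_contra! hc
      exact hnot ⟨hz, by rwa [hpe] at hc⟩
    · rw [hpe]
      simpa using hx.2

theorem lintegral_Ioi_le_twelve {h : ℝ → ℝ≥0∞} (h1 : ∀ s, 0 < s → h s ≤ 1)
    (h2 : ∀ s, 1 ≤ s → h s ≤ ENNReal.ofReal (Real.exp (-1)))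
    (h3 : ∀ s, 1 ≤ s → h s ≤ ENNReal.ofReal (Real.exp (-(s / (2 * Real.exp 1 ^ 2))))) :
    ∫⁻ s in Set.Ioi 0, h s ≤ ENNReal.ofReal 12 := by
  set L := 2 * Real.exp 1 ^ 2 with hL
  have he := Real.exp_one_gt_d9
  have he' := Real.exp_one_lt_d9
  have hL1 : 1 ≤ L := by rw [hL]; nlinarith
  have hL0 : 0 < L := by linarith
  have htail : ∫ s in Set.Ioi L, Real.exp (-(s / L)) = L * Real.exp (-1) := by
    have h4 := integral_exp_mul_Ioi (a := -L⁻¹) (by simpa using hL0) L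
    have h5 : ∀ s : ℝ, -(s / L) = -L⁻¹ * s := fun s => by ring
    simp only [h5]
    rw [h4, neg_mul, inv_mul_cancel₀ hL0.ne']
    field_simp
  have htaili : IntegrableOn (fun s => Real.exp (-(s / L))) (Set.Ioi L) := by
    have h4 := integrableOn_exp_mul_Ioi (a := -L⁻¹) (by simpa using hL0) L
    refine h4.congr_fun (fun s _ => ?_) measurableSet_Ioi
    simp only
    congr 1
    ring
  have hsplit : Set.Ioi (0 : ℝ) = (Set.Ioc 0 1 ∪ Set.Ioc 1 L) ∪ Set.Ioi L := by
    rw [Set.Ioc_union_Ioc_eq_Ioc zero_le_one hL1, Set.Ioc_union_Ioi_eq_Ioi hL0.le]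
  have hb1 : ∫⁻ s in Set.Ioc 0 1, h s ≤ ENNReal.ofReal 1 := by
    calc ∫⁻ s in Set.Ioc 0 1, h s ≤ ∫⁻ _ in Set.Ioc (0 : ℝ) 1, 1 :=
          setLIntegral_mono' measurableSet_Ioc fun s hs => h1 s hs.1
      _ = _ := by simp
  have hb2 : ∫⁻ s in Set.Ioc 1 L, h s ≤ ENNReal.ofReal (Real.exp (-1) * (L - 1)) := by
    calc ∫⁻ s in Set.Ioc 1 L, h s ≤ ∫⁻ _ in Set.Ioc 1 L, ENNReal.ofReal (Real.exp (-1)) :=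
          setLIntegral_mono' measurableSet_Ioc fun s hs => h2 s hs.1.le
      _ = _ := by rw [setLIntegral_const, Real.volume_Ioc, ENNReal.ofReal_mul (Real.exp_pos _).le]
  have hb3 : ∫⁻ s in Set.Ioi L, h s ≤ ENNReal.ofReal (L * Real.exp (-1)) := by
    calc ∫⁻ s in Set.Ioi L, h s ≤ ∫⁻ s in Set.Ioi L, ENNReal.ofReal (Real.exp (-(s / L))) :=
          setLIntegral_mono' measurableSet_Ioi fun s hs => h3 s (hL1.trans (le_of_lt hs))
      _ = _ := by
        rw [← htail, ofReal_integral_eq_lintegral_ofReal htaili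
          (Filter.Eventually.of_forall fun s => (Real.exp_pos _).le)]
  rw [hsplit]
  refine (lintegral_union_le _ _ _).trans ((add_le_add ((lintegral_union_le _ _ _).trans
    (add_le_add hb1 hb2)) hb3).trans ?_)
  have hexp : 0 < Real.exp (-1) := Real.exp_pos _
  rw [← ENNReal.ofReal_add (by norm_num) (by nlinarith), ← ENNReal.ofReal_add (by nlinarith)
    (by positivity)]
  refine ENNReal.ofReal_le_ofReal ?_
  have hinv : Real.exp (-1) * Real.exp 1 = 1 := by rw [← Real.exp_add]; simp
  have h6 : Real.exp (-1) * L = 2 * Real.exp 1 := by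
    rw [hL]
    calc _ = (Real.exp (-1) * Real.exp 1) * (2 * Real.exp 1) := by ring
      _ = _ := by rw [hinv, one_mul]
  nlinarith

/-- `L^q` estimate for small `q`: `‖P‖_{L^q(F)} ≤ 12^d M(P)` for every `0 < q ≤ 1/d`. -/
theorem Lq_estimate_small_q {n : ℕ} (d : ℕ) (P : MvPolynomial (Fin n) ℝ)
    (hPd : P.totalDegree ≤ d) (hPnc : ∀ c : ℝ, P ≠ MvPolynomial.C c)
    (F : Set (EuclideanSpace ℝ (Fin n))) (hFcomp : IsCompact F) (hFconv : Convex ℝ F)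
    (hFvol : volume F = 1)
    (M : ℝ) (hM : 0 < M)
    (hMdef : volume {x ∈ F | M ≤ |MvPolynomial.eval (fun i => x i) P|} =
      ENNReal.ofReal (Real.exp (-1)))
    (q : ℝ) (hq0 : 0 < q) (hq : q ≤ 1 / (d : ℝ)) :
    (∫ x in F, |MvPolynomial.eval (fun i => x i) P| ^ q) ^ (1 / q) ≤
      12 ^ d * M := by
  have hd : d ≠ 0 := by
    rintro rfl
    exact hPnc _ (MvPolynomial.totalDegree_eq_zero_iff_eq_C.mp (Nat.le_zero.mp hPd))
  have hd0 : (0 : ℝ) < d := by exact_mod_cast Nat.pos_of_ne_zero hd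
  have hPc := continuous_eval_euclideanSpace P
  set r : EuclideanSpace ℝ (Fin n) → ℝ :=
    fun x => (|MvPolynomial.eval (fun i => x i) P| / M) ^ ((d : ℝ)⁻¹) with hr
  have hr0 : ∀ x, 0 ≤ r x := fun x => by positivity
  have hrd : ∀ x, r x ^ d = |MvPolynomial.eval (fun i => x i) P| / M := fun x =>
    Real.rpow_inv_natCast_pow (by positivity) hd
  have hrc : Continuous r := (hPc.abs.div_const M).rpow_const fun x => Or.inr (by positivity)
  have hri : IntegrableOn r F := hrc.continuousOn.integrableOn_compact hFcomp
  have hrint : ∫ x in F, r x ≤ 12 := by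
    rw [← ENNReal.ofReal_le_ofReal_iff (by norm_num), ofReal_integral_eq_lintegral_ofReal hri
      (Filter.Eventually.of_forall hr0), lintegral_eq_lintegral_meas_le _
      (Filter.Eventually.of_forall hr0) hrc.measurable.aemeasurable]
    have hlevel : ∀ s : ℝ, 0 < s → (volume.restrict F) {x | s ≤ r x} ≤
        volume {x ∈ F | s ^ d * M ≤ |MvPolynomial.eval (fun i => x i) P|} := by
      intro s hs
      rw [Measure.restrict_apply' hFcomp.measurableSet]
      refine measure_mono fun x hx => ⟨hx.2, ?_⟩
      rw [← le_div_iff₀ hM, ← hrd]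
      exact pow_le_pow_left₀ hs.le hx.1 d
    refine lintegral_Ioi_le_twelve (fun s hs => ?_) (fun s hs => ?_) (fun s hs => ?_)
    · exact (hlevel s hs).trans ((measure_mono fun x hx => hx.1).trans hFvol.le)
    · have hsub : {x ∈ F | s ^ d * M ≤ |MvPolynomial.eval (fun i => x i) P|} ⊆
          {x ∈ F | M ≤ |MvPolynomial.eval (fun i => x i) P|} := fun x hx =>
        ⟨hx.1, (le_mul_of_one_le_left hM.le (one_le_pow₀ hs)).trans hx.2⟩
      exact (hlevel s (by linarith)).trans ((measure_mono hsub).trans hMdef.le)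
    · exact (hlevel s (by linarith)).trans
        (volume_superlevel_le_exp hd hPd hFcomp hFconv hFvol hM hMdef hs)
  set θ := q * d with hθ
  have hθ0 : 0 < θ := mul_pos hq0 hd0
  have hθ1 : θ ≤ 1 := by rwa [le_div_iff₀ hd0] at hq
  have hbound : ∀ x, |MvPolynomial.eval (fun i => x i) P| ^ q ≤
      M ^ q * 12 ^ θ * ((1 - θ) + θ / 12 * r x) := by
    intro x
    have h1 : |MvPolynomial.eval (fun i => x i) P| = M * r x ^ d := by
      rw [hrd, mul_div_cancel₀ _ hM.ne']
    have h2 : (r x ^ d) ^ q = r x ^ θ := by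
      rw [← Real.rpow_natCast, ← Real.rpow_mul (hr0 x), hθ, mul_comm]
    have h3 := Real.geom_mean_le_arith_mean2_weighted (sub_nonneg.mpr hθ1) hθ0.le zero_le_one
      (div_nonneg (hr0 x) (by norm_num : (0 : ℝ) ≤ 12)) (by ring)
    rw [Real.one_rpow, one_mul, Real.div_rpow (hr0 x) (by norm_num), mul_one,
      div_le_iff₀ (by positivity)] at h3
    rw [h1, Real.mul_rpow hM.le (pow_nonneg (hr0 x) d), h2, mul_assoc]
    refine mul_le_mul_of_nonneg_left (h3.trans_eq ?_) (by positivity)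
    ring
  have hFfin : IsFiniteMeasure (volume.restrict F) :=
    ⟨by rw [Measure.restrict_apply_univ, hFvol]; exact ENNReal.one_lt_top⟩
  have hintegral : ∫ x in F, |MvPolynomial.eval (fun i => x i) P| ^ q ≤ M ^ q * 12 ^ θ := by
    calc ∫ x in F, |MvPolynomial.eval (fun i => x i) P| ^ q
        ≤ ∫ x in F, M ^ q * 12 ^ θ * ((1 - θ) + θ / 12 * r x) := by
          refine integral_mono ?_ ?_ hbound
          · exact (hPc.abs.rpow_const fun x => Or.inr hq0.le).continuousOn.integrableOn_compact
              hFcomp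
          · exact (((integrable_const _).add (hri.const_mul _)).const_mul _)
      _ = M ^ q * 12 ^ θ * ((1 - θ) + θ / 12 * ∫ x in F, r x) := by
          rw [integral_const_mul, integral_add (integrable_const _) (hri.const_mul _),
            integral_const_mul, setIntegral_const, Measure.real, hFvol]
          simp
      _ ≤ M ^ q * 12 ^ θ * 1 := by
          refine mul_le_mul_of_nonneg_left ?_ (by positivity)
          have h4 : θ / 12 * ∫ x in F, r x ≤ θ / 12 * 12 :=
            mul_le_mul_of_nonneg_left hrint (by positivity)
          linarith
      _ = _ := mul_one _
  calc (∫ x in F, |MvPolynomial.eval (fun i => x i) P| ^ q) ^ (1 / q)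
      ≤ (M ^ q * 12 ^ θ) ^ (1 / q) :=
        Real.rpow_le_rpow (integral_nonneg fun x => by positivity) hintegral (by positivity)
    _ = 12 ^ d * M := by
        rw [Real.mul_rpow (by positivity) (by positivity), ← Real.rpow_mul hM.le,
          ← Real.rpow_mul (by norm_num), mul_one_div_cancel hq0.ne', Real.rpow_one, hθ,
          show q * d * (1 / q) = (d : ℝ) by field_simp, Real.rpow_natCast, mul_comm]
end

section
/- Let F ⊂ ℝⁿ be a compact convex set of volume 1, let P be a non-constant polynomial on ℝⁿ of degree at most d, and let M(P) be the unique positive number with Vol{x ∈ F : |P(x)| ≥ M(P)} = 1/e. Then for every q with 0 < q < 1/d, the negative moment satisfies ∫_F |P(x)|^{−q} dx ≤ (4^d / M(P))^q · 1/(1−qd); equivalently, (∫_F |P(x)|^{−q} dx)^{−1/q} ≥ 4^{−d} (1−qd)^{1/q} M(P). -/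
open MeasureTheory

section Remez

open Polynomial Polynomial.Chebyshev in
lemma sum_inv_abs_prod_node_sub (d : ℕ) :
    ∑ i ∈ Finset.range (d + 1),
      |∏ j ∈ (Finset.range (d + 1)).erase i, (node d i - node d j)|⁻¹ = 2 ^ (d - 1) := by
  have hdeg : (T ℝ d).degree < (Finset.range (d + 1)).card := by
    rw [Finset.card_range, degree_T]
    norm_cast
    simp
  have h := Lagrange.coeff_eq_sum (strictAntiOn_node d).injOn hdeg
  have h2 : (T ℝ d).coeff d = 2 ^ (d - 1) := by
    trans (T ℝ d).leadingCoeff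
    · simp [leadingCoeff]
    · simp
  simp only [Finset.card_range, Nat.add_sub_cancel] at h
  rw [← h2, h]
  refine Finset.sum_congr rfl fun i hi => ?_
  have hi' : i ≤ d := Nat.lt_succ_iff.mp (Finset.mem_range.mp hi)
  rw [eval_T_real_node (Finset.mem_Iic.mpr hi')]
  have hpos := zero_lt_prod_node_sub_node hi'
  set π := ∏ j ∈ (Finset.range (d + 1)).erase i, (node d i - node d j)
  have : |π| = (-1) ^ i * π := by
    rw [← abs_of_pos hpos, abs_mul, abs_neg_one_pow, one_mul]
  rw [this, mul_inv, div_eq_mul_inv]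
  congr 1
  rcases neg_one_pow_eq_or ℝ i with h | h <;> simp [h]

lemma abs_volume_inter_Iic_sub_le {K : Set ℝ} (hK : volume K ≠ ⊤) (y z : ℝ) :
    |volume.real (K ∩ Set.Iic y) - volume.real (K ∩ Set.Iic z)| ≤ |y - z| := by
  wlog h : z ≤ y generalizing y z
  · rw [abs_sub_comm, abs_sub_comm y z]
    exact this z y (le_of_not_ge h)
  have hfin : ∀ w, volume (K ∩ Set.Iic w) ≠ ⊤ := fun w =>
    ne_top_of_le_ne_top hK (measure_mono Set.inter_subset_left)
  have h1 : volume.real (K ∩ Set.Iic z) ≤ volume.real (K ∩ Set.Iic y) :=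
    measureReal_mono (Set.inter_subset_inter_right _ (Set.Iic_subset_Iic.mpr h)) (hfin y)
  have h2 : volume.real (K ∩ Set.Iic y) ≤ volume.real (K ∩ Set.Iic z) + volume.real (Set.Ioc z y) := by
    refine (measureReal_mono ?_ ?_).trans (measureReal_union_le _ _)
    · rintro x ⟨hx, hxy⟩
      by_cases hxz : x ≤ z
      · exact Or.inl ⟨hx, hxz⟩
      · exact Or.inr ⟨not_le.mp hxz, hxy⟩
    · exact measure_union_ne_top (hfin z) (by simp)
  rw [Real.volume_real_Ioc_of_le h] at h2
  rw [abs_of_nonneg (by linarith), abs_of_nonneg (by linarith)]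
  linarith

lemma continuous_volume_inter_Iic {K : Set ℝ} (hK : volume K ≠ ⊤) :
    Continuous fun y => volume.real (K ∩ Set.Iic y) := by
  have : LipschitzWith 1 fun y => volume.real (K ∩ Set.Iic y) :=
    LipschitzWith.of_dist_le_mul fun y z => by
      simpa [Real.dist_eq] using abs_volume_inter_Iic_sub_le hK y z
  exact this.continuous

lemma exists_mem_volume_inter_Iic_eq {K : Set ℝ} (hK : IsCompact K) (hne : K.Nonempty) {t : ℝ}
    (h0 : 0 ≤ t) (ht : t ≤ volume.real K) : ∃ y ∈ K, volume.real (K ∩ Set.Iic y) = t := by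
  have hinf := hK.isLeast_sInf hne
  have hsup := hK.isGreatest_sSup hne
  have hle : sInf K ≤ sSup K := hinf.2 hsup.1
  have hz : volume.real (K ∩ Set.Iic (sInf K)) = 0 := by
    have : K ∩ Set.Iic (sInf K) ⊆ {sInf K} := fun x hx => le_antisymm hx.2 (hinf.2 hx.1)
    rw [measureReal_def, measure_mono_null this (by simp)]
    rfl
  have ht' : K ∩ Set.Iic (sSup K) = K := Set.inter_eq_left.mpr fun x hx => hsup.2 hx
  obtain ⟨y₁, hy₁, hy₁t⟩ := intermediate_value_Icc hle
    (continuous_volume_inter_Iic hK.measure_lt_top.ne).continuousOn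
    (show t ∈ Set.Icc _ _ from ⟨by rw [hz]; exact h0, by rw [ht']; exact ht⟩)
  have hc : IsCompact (K ∩ Set.Iic y₁) := hK.inter_right isClosed_Iic
  have hg := hc.isGreatest_sSup ⟨sInf K, hinf.1, hy₁.1⟩
  refine ⟨sSup (K ∩ Set.Iic y₁), hg.1.1, ?_⟩
  rw [← hy₁t]
  congr 1
  ext x
  exact ⟨fun hx => ⟨hx.1, Set.mem_Iic.mpr (le_trans (Set.mem_Iic.mp hx.2) hg.1.2)⟩, fun hx => ⟨hx.1, hg.2 hx⟩⟩

/-- A form of the Remez inequality, with constant `4`. -/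
lemma remez_inequality {d : ℕ} (hd : d ≠ 0) {p : Polynomial ℝ} (hp : p.natDegree ≤ d) {x y s : ℝ}
    (hs : 0 ≤ s) {a : ℝ} (ha : a ∈ Set.Icc x y) :
    |p.eval a| * volume.real {t ∈ Set.Icc x y | |p.eval t| ≤ s} ^ d ≤ (4 * (y - x)) ^ d * s := by
  set K := {t ∈ Set.Icc x y | |p.eval t| ≤ s} with hKdef
  have hKc : IsCompact K := by
    have : K = Set.Icc x y ∩ {t | |p.eval t| ≤ s} := rfl
    rw [this]
    exact isCompact_Icc.inter_right (isClosed_le (by fun_prop) (by fun_prop))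
  have hxy : 0 ≤ y - x := by linarith [ha.1, ha.2]
  set β := volume.real K with hβ
  rcases (measureReal_nonneg : 0 ≤ volume.real K).eq_or_lt with h0 | hpos
  · rw [hβ, ← h0, zero_pow hd, mul_zero]
    positivity
  have hne : K.Nonempty := by
    by_contra h
    rw [Set.not_nonempty_iff_eq_empty] at h
    simp [h] at hpos
  have hex : ∀ i : ℕ, ∃ z ∈ K, volume.real (K ∩ Set.Iic z)
      = β / 2 * (1 + Polynomial.Chebyshev.node d i) := by
    intro i
    have := Polynomial.Chebyshev.node_mem_Icc (n := d) (i := i)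
    apply exists_mem_volume_inter_Iic_eq hKc hne
    · have := this.1
      apply mul_nonneg (by positivity); linarith
    · have := this.2
      rw [← hβ]; nlinarith
  choose z hzK hz using hex
  have hdist : ∀ i j, β / 2 * |Polynomial.Chebyshev.node d i - Polynomial.Chebyshev.node d j|
      ≤ |z i - z j| := by
    intro i j
    have h := abs_volume_inter_Iic_sub_le hKc.measure_lt_top.ne (z i) (z j)
    rw [hz, hz, ← mul_sub, abs_mul, abs_of_pos (by positivity : 0 < β / 2)] at h
    rwa [add_sub_add_left_eq_sub] at h
  have hinjn := (Polynomial.Chebyshev.strictAntiOn_node d).injOn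
  have hinj : Set.InjOn z (Finset.range (d + 1)) := by
    intro i hi j hj hij
    apply hinjn hi hj
    have := hdist i j
    rw [hij, sub_self, abs_zero] at this
    have h3 : |Polynomial.Chebyshev.node d i - Polynomial.Chebyshev.node d j| ≤ 0 := by
      by_contra! hc
      nlinarith [mul_pos (half_pos hpos) hc]
    exact sub_eq_zero.mp (abs_nonpos_iff.mp h3)
  have hdeg : p.degree < (Finset.range (d + 1)).card := by
    rw [Finset.card_range]
    refine (Polynomial.degree_le_of_natDegree_le hp).trans_lt ?_
    norm_cast; simp
  have hint := Lagrange.eq_interpolate hinj hdeg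
  have hterm : ∀ i ∈ Finset.range (d + 1),
      |p.eval (z i) * (Lagrange.basis (Finset.range (d + 1)) z i).eval a| ≤
      s * ((y - x) ^ d * ((β / 2) ^ d)⁻¹ * |∏ j ∈ (Finset.range (d + 1)).erase i,
        (Polynomial.Chebyshev.node d i - Polynomial.Chebyshev.node d j)|⁻¹) := by
    intro i hi
    rw [abs_mul]
    refine mul_le_mul (hzK i).2 ?_ (abs_nonneg _) hs
    have hcard : ((Finset.range (d + 1)).erase i).card = d := by
      rw [Finset.card_erase_of_mem hi, Finset.card_range, Nat.add_sub_cancel]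
    have e1 : (y - x) ^ d = ∏ j ∈ (Finset.range (d + 1)).erase i, (y - x) := by
      rw [Finset.prod_const, hcard]
    have e2 : (β / 2) ^ d = ∏ j ∈ (Finset.range (d + 1)).erase i, (β / 2) := by
      rw [Finset.prod_const, hcard]
    rw [e1, e2, Finset.abs_prod, ← Finset.prod_inv_distrib, ← Finset.prod_inv_distrib,
      ← Finset.prod_mul_distrib, ← Finset.prod_mul_distrib, Lagrange.basis,
      Polynomial.eval_prod, Finset.abs_prod]
    refine Finset.prod_le_prod (fun _ _ => abs_nonneg _) fun j hj => ?_
    have hji : j ≠ i := (Finset.mem_erase.mp hj).1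
    have hn : 0 < |Polynomial.Chebyshev.node d i - Polynomial.Chebyshev.node d j| := by
      rw [abs_pos, sub_ne_zero]
      exact fun h => hji (hinjn (Finset.mem_coe.mpr hi)
        (Finset.mem_coe.mpr (Finset.mem_of_mem_erase hj)) h).symm
    simp only [Lagrange.basisDivisor, Polynomial.eval_mul, Polynomial.eval_C, Polynomial.eval_sub,
      Polynomial.eval_X, abs_mul, abs_inv]
    have h4 : |a - z j| ≤ y - x := by
      have := (hzK j).1
      rw [abs_le]
      constructor <;> linarith [ha.1, ha.2, this.1, this.2]
    calc |z i - z j|⁻¹ * |a - z j| ≤ (β / 2 * |Polynomial.Chebyshev.node d i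
          - Polynomial.Chebyshev.node d j|)⁻¹ * (y - x) := by
          gcongr
          exact hdist i j
      _ = _ := by rw [mul_inv]; ring
  have heval : p.eval a = ∑ i ∈ Finset.range (d + 1),
      p.eval (z i) * (Lagrange.basis (Finset.range (d + 1)) z i).eval a := by
    conv_lhs => rw [hint]
    rw [Lagrange.interpolate_apply, Polynomial.eval_finsetSum]
    simp
  have hmain : |p.eval a| ≤ s * ((y - x) ^ d * ((β / 2) ^ d)⁻¹ * 2 ^ (d - 1)) := by
    rw [heval]
    refine (Finset.abs_sum_le_sum_abs _ _).trans ((Finset.sum_le_sum hterm).trans ?_)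
    rw [← Finset.mul_sum, ← Finset.mul_sum, sum_inv_abs_prod_node_sub]
  calc |p.eval a| * β ^ d ≤ s * ((y - x) ^ d * ((β / 2) ^ d)⁻¹ * 2 ^ (d - 1)) * β ^ d := by gcongr
    _ = s * (y - x) ^ d * (2 ^ d * 2 ^ (d - 1)) := by
      have : β ^ d ≠ 0 := by positivity
      rw [div_pow]; field_simp
    _ ≤ s * (y - x) ^ d * (2 ^ d * 2 ^ d) := by
      gcongr
      · norm_num
      · omega
    _ = _ := by rw [← mul_pow, mul_pow 4]; norm_num only; ring

end Remez

lemma setIntegral_le_mul_of_volume_superlevel_le {f : ℝ → ℝ} (hf : Continuous f) (hf0 : ∀ x, 0 ≤ f x)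
    (hfc : HasCompactSupport f) {B G : Set ℝ} {L : ℝ} (hL : 0 ≤ L)
    (h : ∀ t, 0 < t → volume.real (B ∩ {x | t ≤ f x}) ≤ L * volume.real (G ∩ {x | t ≤ f x})) :
    ∫ x in B, f x ≤ L * ∫ x in G, f x := by
  have hint : Integrable f := hf.integrable_of_hasCompactSupport hfc
  have hmeas : ∀ t, MeasurableSet {x | t ≤ f x} := fun t => (isClosed_le (by fun_prop) hf).measurableSet
  have hfin : ∀ S : Set ℝ, ∀ t, 0 < t → volume (S ∩ {x | t ≤ f x}) ≠ ⊤ := by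
    intro S t ht
    refine ne_top_of_le_ne_top hfc.isCompact.measure_lt_top.ne (measure_mono ?_)
    rintro x ⟨-, hx⟩
    exact subset_tsupport f (Function.mem_support.mpr (ht.trans_le hx).ne')
  rw [integral_eq_lintegral_of_nonneg_ae (.of_forall hf0) hf.aestronglyMeasurable,
    integral_eq_lintegral_of_nonneg_ae (.of_forall hf0) hf.aestronglyMeasurable,
    ← ENNReal.toReal_ofReal hL, ← ENNReal.toReal_mul]
  refine ENNReal.toReal_mono ?_ ?_
  · refine ENNReal.mul_ne_top ENNReal.ofReal_ne_top ?_
    exact ((hasFiniteIntegral_iff_ofReal (.of_forall hf0)).mp hint.integrableOn.2).ne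
  · rw [lintegral_eq_lintegral_meas_le _ (.of_forall hf0) hf.aemeasurable,
      lintegral_eq_lintegral_meas_le _ (.of_forall hf0) hf.aemeasurable,
      ← lintegral_const_mul' _ _ ENNReal.ofReal_ne_top]
    refine setLIntegral_mono' measurableSet_Ioi fun t ht => ?_
    rw [Measure.restrict_apply (hmeas t), Measure.restrict_apply (hmeas t), Set.inter_comm,
      Set.inter_comm _ G, ← ENNReal.ofReal_toReal (hfin B t ht), ← ENNReal.ofReal_toReal (hfin G t ht),
      ← ENNReal.ofReal_mul hL]
    exact ENNReal.ofReal_le_ofReal (h t ht)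

lemma volume_inter_Icc_le_of_forall_mem {A B : Set ℝ} (hA : IsClosed A) (hB : IsClosed B)
    (hAB : Disjoint A B) {L : ℝ} (hL : 0 ≤ L)
    (hrem : ∀ x y, x ≤ y → x ∈ A → volume.real (B ∩ Set.Icc x y) ≤ L * (y - x))
    {a b : ℝ} (ha : a ∈ A) (hab : a ≤ b) :
    volume.real (B ∩ Set.Icc a b) ≤ L * volume.real (Aᶜ ∩ Set.Icc a b) := by
  have hfin : ∀ S : Set ℝ, volume (S ∩ Set.Icc a b) ≠ ⊤ := fun S =>
    ne_top_of_le_ne_top (by simp) (measure_mono (Set.inter_subset_right (t := Set.Icc a b)))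
  have hfin' : ∀ (S : Set ℝ) y, volume (S ∩ Set.Icc a b ∩ Set.Iic y) ≠ ⊤ := fun S y =>
    ne_top_of_le_ne_top (hfin S) (measure_mono Set.inter_subset_left)
  set s : Set ℝ := {x | volume.real (B ∩ Set.Icc a b ∩ Set.Iic x) ≤
    L * volume.real (Aᶜ ∩ Set.Icc a b ∩ Set.Iic x)} with hs
  have hcl : IsClosed s := isClosed_le (continuous_volume_inter_Iic (hfin B))
    ((continuous_volume_inter_Iic (hfin Aᶜ)).const_mul L)
  have key : Set.Icc a b ⊆ s := by
    refine IsClosed.Icc_subset_of_forall_mem_nhdsGT_of_Icc_subset (hcl.inter isClosed_Icc) ?_ ?_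
    · have : B ∩ Set.Icc a b ∩ Set.Iic a ⊆ {a} := fun x hx => le_antisymm hx.2 hx.1.2.1
      have h0 : volume.real (B ∩ Set.Icc a b ∩ Set.Iic a) = 0 := by
        rw [measureReal_def, measure_mono_null this (by simp)]; rfl
      rw [hs, Set.mem_ofPred_eq, h0]
      positivity
    · intro t ht hts
      have htm : t ∈ s := hts ⟨ht.1, le_rfl⟩
      by_cases htA : t ∈ A
      · have htB : Bᶜ ∈ nhds t := hB.isOpen_compl.mem_nhds (Set.disjoint_left.mp hAB htA)
        obtain ⟨ε, hε, hball⟩ := Metric.mem_nhds_iff.mp htB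
        refine Filter.mem_of_superset (Ioo_mem_nhdsGT (show t < t + ε by linarith)) ?_
        intro x hx
        have e : B ∩ Set.Icc a b ∩ Set.Iic x ⊆ B ∩ Set.Icc a b ∩ Set.Iic t := by
          rintro y ⟨⟨hyB, hy⟩, hyx⟩
          refine ⟨⟨hyB, hy⟩, ?_⟩
          by_contra hyt
          refine hball ?_ hyB
          rw [Metric.mem_ball, Real.dist_eq, abs_of_pos (by simpa using hyt)]
          linarith [hx.2, Set.mem_Iic.mp hyx]
        calc volume.real (B ∩ Set.Icc a b ∩ Set.Iic x)
            ≤ volume.real (B ∩ Set.Icc a b ∩ Set.Iic t) := measureReal_mono e (hfin' _ _)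
          _ ≤ L * volume.real (Aᶜ ∩ Set.Icc a b ∩ Set.Iic t) := htm
          _ ≤ L * volume.real (Aᶜ ∩ Set.Icc a b ∩ Set.Iic x) := by
            gcongr
            · exact hfin' _ _
            · exact hx.1.le
      · have hc : IsCompact (A ∩ Set.Icc a t) := isCompact_Icc.inter_left hA
        have hg := hc.isGreatest_sSup ⟨a, ha, le_rfl, ht.1⟩
        set u := sSup (A ∩ Set.Icc a t)
        have hus : u ∈ s := hts hg.1.2
        obtain ⟨ε, hε, hball⟩ := Metric.mem_nhds_iff.mp (hA.isOpen_compl.mem_nhds htA)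
        refine Filter.mem_of_superset (Ioo_mem_nhdsGT (show t < min (t + ε) b from
          lt_min (by linarith) ht.2)) ?_
        intro x hx
        have hxε := hx.2.trans_le (min_le_left _ _)
        have hxb := hx.2.trans_le (min_le_right _ _)
        have hux : u ≤ x := hg.1.2.2.trans hx.1.le
        have h1 : volume.real (B ∩ Set.Icc a b ∩ Set.Iic x) ≤
            volume.real (B ∩ Set.Icc a b ∩ Set.Iic u) + volume.real (B ∩ Set.Icc u x) := by
          refine (measureReal_mono ?_ ?_).trans (measureReal_union_le _ _)
          · rintro y ⟨⟨hyB, hy⟩, hyx⟩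
            by_cases hyu : y ≤ u
            · exact Or.inl ⟨⟨hyB, hy⟩, hyu⟩
            · exact Or.inr ⟨hyB, (not_le.mp hyu).le, hyx⟩
          · exact measure_union_ne_top (hfin' _ _)
              (ne_top_of_le_ne_top (by simp) (measure_mono (Set.inter_subset_right (t := Set.Icc u x))))
        have h2 : volume.real (Aᶜ ∩ Set.Icc a b ∩ Set.Iic u) + (x - u) ≤
            volume.real (Aᶜ ∩ Set.Icc a b ∩ Set.Iic x) := by
          rw [← Real.volume_real_Ioc_of_le hux, ← measureReal_union ?_ measurableSet_Ioc (hfin' _ _)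
            (by simp)]
          · refine measureReal_mono ?_ (hfin' _ _)
            rintro y (⟨hy, hyu⟩ | hy)
            · exact ⟨hy, Set.mem_Iic.mpr (le_trans hyu hux)⟩
            · refine ⟨⟨fun hyA => ?_, hg.1.2.1.trans hy.1.le, hy.2.trans hxb.le⟩, hy.2⟩
              by_cases hyt : y ≤ t
              · exact absurd (hg.2 ⟨hyA, hg.1.2.1.trans hy.1.le, hyt⟩) (not_le.mpr hy.1)
              · refine hball ?_ hyA
                push Not at hyt
                rw [Metric.mem_ball, Real.dist_eq, abs_of_pos (by linarith)]
                linarith [hy.2]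
          · rw [Set.disjoint_left]
            rintro y ⟨-, hy⟩ hy2
            exact absurd hy2.1 (not_lt.mpr hy)
        have h3 := hrem u x hux hg.1.1
        have h4 : volume.real (B ∩ Set.Icc a b ∩ Set.Iic u) ≤
          L * volume.real (Aᶜ ∩ Set.Icc a b ∩ Set.Iic u) := hus
        have h5 := mul_le_mul_of_nonneg_left h2 hL
        rw [hs, Set.mem_ofPred_eq]
        linarith
  have := key ⟨hab, le_rfl⟩
  have e : ∀ S : Set ℝ, S ∩ Set.Icc a b ∩ Set.Iic b = S ∩ Set.Icc a b := fun S =>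
    Set.inter_eq_left.mpr fun x hx => hx.2.2
  rwa [hs, Set.mem_ofPred_eq, e, e] at this

lemma min_le_of_midpoint {φ : ℝ → ℝ} (hφ : Continuous φ) (hφ0 : ∀ x, 0 ≤ φ x)
    (hmid : ∀ x y, φ x * φ y ≤ φ (midpoint ℝ x y) ^ 2) {x y w : ℝ} (hxy : x ≤ y) (hyw : y ≤ w) :
    min (φ x) (φ w) ≤ φ y := by
  by_contra! hlt
  set s := min (φ x) (φ w)
  have hs : 0 < s := (hφ0 y).trans_lt hlt
  have hS : IsClosed {z | s ≤ φ z} := isClosed_le continuous_const hφ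
  have h1 := (isCompact_Icc.inter_left hS : IsCompact ({z | s ≤ φ z} ∩ Set.Icc x y)).isGreatest_sSup
    ⟨x, show s ≤ φ x from min_le_left _ _, le_rfl, hxy⟩
  have h2 := (isCompact_Icc.inter_left hS : IsCompact ({z | s ≤ φ z} ∩ Set.Icc y w)).isLeast_sInf
    ⟨w, show s ≤ φ w from min_le_right _ _, hyw, le_rfl⟩
  set x' := sSup ({z | s ≤ φ z} ∩ Set.Icc x y)
  set w' := sInf ({z | s ≤ φ z} ∩ Set.Icc y w)
  have hx' : x' < y := lt_of_le_of_ne h1.1.2.2 fun h => absurd (h ▸ h1.1.1 : s ≤ φ y) (not_le.mpr hlt)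
  have hw' : y < w' := lt_of_le_of_ne h2.1.2.1 fun h => absurd (h ▸ h2.1.1 : s ≤ φ y) (not_le.mpr hlt)
  have hm : midpoint ℝ x' w' = (x' + w') / 2 := by
    rw [midpoint_eq_smul_add, smul_eq_mul, invOf_eq_inv]; ring
  have hmS : s ≤ φ (midpoint ℝ x' w') := by
    have := hmid x' w'
    refine le_of_sq_le_sq ?_ (hφ0 _)
    calc s ^ 2 = s * s := sq s
      _ ≤ φ x' * φ w' := mul_le_mul h1.1.1 h2.1.1 hs.le (hφ0 _)
      _ ≤ _ := this
  rw [hm] at hmS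
  rcases le_total ((x' + w') / 2) y with h | h
  · have := h1.2 ⟨(hmS : s ≤ φ _), by linarith [h1.1.2.1], h⟩
    linarith
  · have := h2.2 ⟨(hmS : s ≤ φ _), h, by linarith [h2.1.2.2]⟩
    linarith

lemma mul_le_mul_of_add_eq {ρ : ℝ → ℝ} (hρ : Continuous ρ) (hρ0 : ∀ x, 0 ≤ ρ x)
    (hmid : ∀ x y, ρ x * ρ y ≤ ρ (midpoint ℝ x y) ^ 2) {x y z w : ℝ} (hxy : x ≤ y) (hyw : y ≤ w)
    (h : y + z = x + w) : ρ x * ρ w ≤ ρ y * ρ z := by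
  have key := min_le_of_midpoint (φ := fun t => ρ t * ρ (x + w - t)) (by fun_prop)
    (fun t => mul_nonneg (hρ0 _) (hρ0 _)) (fun a b => ?_) hxy hyw
  · have e1 : x + w - x = w := by ring
    have e2 : x + w - w = x := by ring
    have e3 : x + w - y = z := by linarith
    simp only [e1, e2, e3, mul_comm (ρ w), min_self] at key
    exact key
  · have e : x + w - midpoint ℝ a b = midpoint ℝ (x + w - a) (x + w - b) := by
      simp only [midpoint_eq_smul_add, smul_eq_mul, invOf_eq_inv]; ring
    have h1 := hmid a b
    have h2 := hmid (x + w - a) (x + w - b)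
    simp only [e]
    calc ρ a * ρ (x + w - a) * (ρ b * ρ (x + w - b))
        = (ρ a * ρ b) * (ρ (x + w - a) * ρ (x + w - b)) := by ring
      _ ≤ _ := mul_le_mul h1 h2 (mul_nonneg (hρ0 _) (hρ0 _)) (sq_nonneg _)
      _ = _ := by ring

lemma exp_mul_integral_Ici_le {ρ : ℝ → ℝ} (hρ : Continuous ρ) (hρ0 : ∀ x, 0 ≤ ρ x)
    (hρc : HasCompactSupport ρ)
    (hmid : ∀ x y, ρ x * ρ y ≤ ρ (midpoint ℝ x y) ^ 2) {m a : ℝ} (hma : m ≤ a)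
    {c : ℝ} (hc : c = ∫ x in Set.Ici m, ρ x) (hcpos : 0 < c) :
    Real.exp (ρ m / c * (a - m)) * ∫ x in Set.Ici a, ρ x ≤ c := by
  have hint : Integrable ρ := hρ.integrable_of_hasCompactSupport hρc
  set R : ℝ → ℝ := fun y => ∫ x in Set.Ici y, ρ x
  have hR : ∀ y, R y = (∫ x, ρ x) - ∫ x in Set.Iic y, ρ x := by
    intro y
    have := setIntegral_compl (μ := volume) (measurableSet_Iic (a := y)) hint
    rw [← this, Set.compl_Iic]
    exact integral_Ici_eq_integral_Ioi
  have hderiv : ∀ y, HasDerivAt R (-ρ y) y := by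
    intro y
    have h1 : HasDerivAt (fun y => ∫ x in Set.Iic y, ρ x) (ρ y) y := by
      have h2 : ∀ z, ∫ x in Set.Iic z, ρ x = (∫ x in Set.Iic y, ρ x) + ∫ x in y..z, ρ x := by
        intro z
        rw [← intervalIntegral.integral_Iic_sub_Iic hint.integrableOn hint.integrableOn]
        ring
      rw [funext h2]
      exact (intervalIntegral.integral_hasDerivAt_right (hρ.intervalIntegrable _ _)
        hρ.stronglyMeasurable.stronglyMeasurableAtFilter hρ.continuousAt).const_add _
    have := h1.const_sub (∫ x, ρ x)
    rwa [← funext hR] at this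
  have hhaz : ∀ y, m ≤ y → ρ m * R y ≤ ρ y * c := by
    intro y hy
    have hshift : ∀ z, R z = ∫ t in Set.Ici (0:ℝ), ρ (z + t) := by
      intro z
      have := (measurePreserving_add_left (volume : Measure ℝ) z).setIntegral_preimage_emb
        (measurableEmbedding_addLeft z) ρ (Set.Ici z)
      rw [show R z = ∫ x in Set.Ici z, ρ x from rfl, ← this]
      simp
    have hints : ∀ z, Integrable (fun t => ρ (z + t)) := fun z => hint.comp_add_left z
    rw [hc, show (∫ x in Set.Ici m, ρ x) = R m from rfl, hshift y, hshift m,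
      ← integral_const_mul, ← integral_const_mul]
    refine setIntegral_mono_on ((hints y).const_mul _).integrableOn
      ((hints m).const_mul _).integrableOn measurableSet_Ici fun t ht => ?_
    have ht' : 0 ≤ t := ht
    exact mul_le_mul_of_add_eq hρ hρ0 hmid hy (by linarith) (by ring)
  have hant : AntitoneOn (fun y => Real.exp (ρ m / c * (y - m)) * R y) (Set.Ici m) := by
    have hd : ∀ y, HasDerivAt (fun y => Real.exp (ρ m / c * (y - m)) * R y)
        (Real.exp (ρ m / c * (y - m)) * (ρ m / c * 1) * R y +
          Real.exp (ρ m / c * (y - m)) * (-ρ y)) y := fun y =>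
      (((((hasDerivAt_id y).sub_const m).const_mul (ρ m / c))).exp).mul (hderiv y)
    refine antitoneOn_of_deriv_nonpos (convex_Ici m)
      (fun y _ => (hd y).continuousAt.continuousWithinAt)
      (fun y _ => (hd y).differentiableAt.differentiableWithinAt) fun y hy => ?_
    rw [interior_Ici, Set.mem_Ioi] at hy
    rw [(hd y).deriv]
    have h1 : ρ m / c * R y ≤ ρ y := by
      rw [div_mul_eq_mul_div, div_le_iff₀ hcpos]; exact hhaz y hy.le
    nlinarith [Real.exp_pos (ρ m / c * (y - m))]
  have := hant (Set.mem_Ici.mpr le_rfl) (Set.mem_Ici.mpr hma) hma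
  simpa [R, ← hc] using this

lemma integral_le_of_mode_le {ρ : ℝ → ℝ} (hρ : Continuous ρ) (hρ0 : ∀ x, 0 ≤ ρ x)
    (hρc : HasCompactSupport ρ)
    (hmid : ∀ x y, ρ x * ρ y ≤ ρ (midpoint ℝ x y) ^ 2) (hρ1 : ∫ x, ρ x = 1)
    {A B : Set ℝ} (hA : IsClosed A) (hB : IsClosed B)
    (hAB : Disjoint A B) {L : ℝ} (hL : 0 ≤ L)
    (hrem : ∀ x y, x ≤ y → (x ∈ A ∨ y ∈ A) → volume.real (B ∩ Set.Icc x y) ≤ L * (y - x))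
    {m : ℝ} (hm : ∀ x, ρ x ≤ ρ m) (hcpos : 0 < ∫ x in Set.Ici m, ρ x)
    (hα : Real.exp (-1) * (∫ x in Set.Ici m, ρ x) ≤ ∫ x in A ∩ Set.Ici m, ρ x) :
    ∫ x in B, ρ x ≤ L := by
  have hint : Integrable ρ := hρ.integrable_of_hasCompactSupport hρc
  set c := ∫ x in Set.Ici m, ρ x with hc
  set α := ∫ x in A ∩ Set.Ici m, ρ x with hαdef
  have hmono : ∀ x y, x ≤ y → y ≤ m → ρ x ≤ ρ y := fun x y hxy hym => by
    simpa [hm x] using min_le_of_midpoint hρ hρ0 hmid hxy hym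
  have hanti : ∀ x y, m ≤ x → x ≤ y → ρ y ≤ ρ x := fun x y hmx hxy => by
    simpa [hm y] using min_le_of_midpoint hρ hρ0 hmid hmx hxy
  have hαpos : 0 < α := (mul_pos (Real.exp_pos _) hcpos).trans_le hα
  have hne : (A ∩ Set.Ici m).Nonempty := by
    rw [Set.nonempty_iff_ne_empty]
    intro h
    rw [hαdef, h] at hαpos
    simp at hαpos
  have hbdd : BddBelow (A ∩ Set.Ici m) := ⟨m, fun x hx => hx.2⟩
  have ham : sInf (A ∩ Set.Ici m) ∈ A ∩ Set.Ici m := (hA.inter isClosed_Ici).csInf_mem hne hbdd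
  have haleast : ∀ x ∈ A ∩ Set.Ici m, sInf (A ∩ Set.Ici m) ≤ x := fun x hx => csInf_le hbdd hx
  set a := sInf (A ∩ Set.Ici m)
  obtain ⟨haA, hma⟩ := ham
  rw [Set.mem_Ici] at hma
  have hAI : A ∩ Set.Ici a = A ∩ Set.Ici m := by
    ext x
    exact ⟨fun h => ⟨h.1, hma.trans h.2⟩, fun h => ⟨h.1, haleast x h⟩⟩
  set r := ∫ x in Set.Ici a, ρ x with hr
  have hhaz := exp_mul_integral_Ici_le hρ hρ0 hρc hmid hma hc hcpos
  rw [← hr] at hhaz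
  have hnn : 0 ≤ᵐ[volume] ρ := .of_forall hρ0
  have hαr : α ≤ r := by
    rw [hαdef, ← hAI]
    exact setIntegral_mono_set hint.integrableOn (ae_restrict_of_ae hnn)
      (Set.inter_subset_right (s := A)).eventuallyLE
  -- the part to the right of `a`
  have hright : ∫ x in B ∩ Set.Ici a, ρ x ≤ L * (r - α) := by
    have e : ∫ x in Aᶜ ∩ Set.Ici a, ρ x = r - α := by
      have := integral_inter_add_sdiff (μ := volume) (s := Set.Ici a) hA.measurableSet hint.integrableOn
      rw [hr, ← this, hαdef, ← hAI, Set.inter_comm A, add_sub_cancel_left, Set.inter_comm Aᶜ]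
      rfl
    rw [← e]
    refine setIntegral_le_mul_of_volume_superlevel_le hρ hρ0 hρc hL fun t ht => ?_
    rw [Set.inter_assoc, Set.inter_assoc]
    have hS : IsCompact (Set.Ici a ∩ {x | t ≤ ρ x}) := by
      refine hρc.isCompact.of_isClosed_subset (isClosed_Ici.inter (isClosed_le continuous_const hρ)) ?_
      rintro x ⟨-, hx⟩
      exact subset_tsupport ρ (Function.mem_support.mpr (ht.trans_le hx).ne')
    rcases (Set.Ici a ∩ {x | t ≤ ρ x}).eq_empty_or_nonempty with h0 | h0
    · simp [h0]
    have hb := hS.isGreatest_sSup h0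
    set b := sSup (Set.Ici a ∩ {x | t ≤ ρ x})
    have eS : Set.Ici a ∩ {x | t ≤ ρ x} = Set.Icc a b := by
      ext x
      refine ⟨fun hx => ⟨hx.1, hb.2 hx⟩, fun hx => ⟨hx.1, ?_⟩⟩
      exact le_trans (show t ≤ ρ b from hb.1.2) (hanti x b (hma.trans hx.1) hx.2)
    rw [eS]
    exact volume_inter_Icc_le_of_forall_mem hA hB hAB hL (fun x y hxy hx => hrem x y hxy (.inl hx))
      haA hb.1.1
  -- the part to the left of `a`
  have hleft : ∫ x in B ∩ Set.Iic a, ρ x ≤ L * (1 - c + ρ m * (a - m)) := by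
    set f : ℝ → ℝ := fun x => min (ρ (min x m)) (max 0 (ρ m - (x - a))) with hf
    have hfa : ∀ x ≤ a, f x = ρ (min x m) := fun x hx => by
      refine min_eq_left ((hm _).trans (le_max_of_le_right ?_)); linarith
    have hfcont : Continuous f := by fun_prop
    have hf0 : ∀ x, 0 ≤ f x := fun x => le_min (hρ0 _) (le_max_left _ _)
    have hfc : HasCompactSupport f := by
      obtain ⟨K, hK⟩ := hρc.isCompact.isBounded.subset_closedBall 0
      refine HasCompactSupport.intro (isCompact_Icc (a := min (-K) m) (b := a + ρ m)) fun x hx => ?_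
      rw [Set.mem_Icc, not_and_or, not_le, not_le, lt_min_iff] at hx
      rcases hx with ⟨h1, h2⟩ | h1
      · have : ρ (min x m) = 0 := by
          rw [min_eq_left h2.le]
          by_contra h3
          have := hK (subset_tsupport ρ h3)
          rw [Metric.mem_closedBall, Real.dist_eq, sub_zero] at this
          linarith [neg_abs_le x]
        simp [hf, this]
      · have : max 0 (ρ m - (x - a)) = 0 := max_eq_left (by linarith)
        simp [hf, this, hρ0]
    have h1 : ∫ x in B ∩ Set.Iic a, ρ x ≤ ∫ x in B ∩ Set.Iic a, f x := by
      refine setIntegral_mono_on hint.integrableOn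
        (hfcont.integrable_of_hasCompactSupport hfc).integrableOn
        (hB.measurableSet.inter measurableSet_Iic) fun x hx => ?_
      rw [hfa x hx.2]
      rcases le_total x m with h | h
      · rw [min_eq_left h]
      · rw [min_eq_right h]; exact hm x
    have h2 : ∫ x in B ∩ Set.Iic a, f x ≤ L * ∫ x in Set.Iic a, f x := by
      refine setIntegral_le_mul_of_volume_superlevel_le hfcont hf0 hfc hL fun t ht => ?_
      rw [Set.inter_assoc]
      have hS : IsCompact (Set.Iic a ∩ {x | t ≤ f x}) := by
        refine hfc.isCompact.of_isClosed_subset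
          (isClosed_Iic.inter (isClosed_le continuous_const hfcont)) ?_
        rintro x ⟨-, hx⟩
        exact subset_tsupport f (Function.mem_support.mpr (ht.trans_le hx).ne')
      rcases (Set.Iic a ∩ {x | t ≤ f x}).eq_empty_or_nonempty with h0 | h0
      · simp [h0]
      have hb := hS.isLeast_sInf h0
      set b := sInf (Set.Iic a ∩ {x | t ≤ f x})
      have eS : Set.Iic a ∩ {x | t ≤ f x} = Set.Icc b a := by
        ext x
        refine ⟨fun hx => ⟨hb.2 hx, hx.1⟩, fun hx => ⟨hx.2, ?_⟩⟩
        have h3 : t ≤ f b := hb.1.2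
        rw [hfa b hb.1.1] at h3
        show t ≤ f x
        rw [hfa x hx.2]
        exact h3.trans (hmono _ _ (min_le_min_right m hx.1) (min_le_right _ _))
      rw [eS, Real.volume_real_Icc_of_le hb.1.1]
      exact hrem b a hb.1.1 (.inr haA)
    have h3 : ∫ x in Set.Iic a, f x = 1 - c + ρ m * (a - m) := by
      have e1 : ∫ x in Set.Iic a, f x = (∫ x in Set.Iic m, f x) + ∫ x in Set.Ioc m a, f x := by
        rw [← setIntegral_union (Set.Iic_disjoint_Ioc le_rfl) measurableSet_Ioc
          (hfcont.integrable_of_hasCompactSupport hfc).integrableOn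
          (hfcont.integrable_of_hasCompactSupport hfc).integrableOn, Set.Iic_union_Ioc_eq_Iic hma]
      have e2 : ∫ x in Set.Iic m, f x = ∫ x in Set.Iic m, ρ x := by
        refine setIntegral_congr_fun measurableSet_Iic fun x hx => ?_
        have hx' : x ≤ m := hx
        show f x = ρ x
        rw [hfa x (hx'.trans hma), min_eq_left hx']
      have e3 : ∫ x in Set.Ioc m a, f x = ∫ x in Set.Ioc m a, ρ m := by
        refine setIntegral_congr_fun measurableSet_Ioc fun x hx => ?_
        show f x = ρ m
        rw [hfa x hx.2, min_eq_right hx.1.le]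
      have e4 : (∫ x in Set.Iic m, ρ x) + c = 1 := by
        rw [hc, integral_Ici_eq_integral_Ioi, intervalIntegral.integral_Iic_add_Ioi hint.integrableOn
          hint.integrableOn, hρ1]
      rw [e1, e2, e3, setIntegral_const, Real.volume_real_Ioc_of_le hma, smul_eq_mul]
      linarith
    rw [h3] at h2
    exact h1.trans h2
  have hsplit : ∫ x in B, ρ x ≤ (∫ x in B ∩ Set.Iic a, ρ x) + ∫ x in B ∩ Set.Ici a, ρ x := by
    have h1 := integral_inter_add_sdiff (μ := volume) (s := B) (measurableSet_Iic (a := a)) hint.integrableOn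
    rw [← h1]
    gcongr 1
    · refine setIntegral_mono_set hint.integrableOn (ae_restrict_of_ae hnn)
        (LE.le.eventuallyLE fun x hx => ⟨hx.1, Set.mem_Ici.mpr (not_le.mp fun h => hx.2 h).le⟩)
  have hfinal : 1 - c + ρ m * (a - m) + (r - α) ≤ 1 := by
    set y := ρ m / c * (a - m) with hy
    have hy0 : 0 ≤ y := mul_nonneg (div_nonneg (hρ0 m) hcpos.le) (by linarith)
    have hcy : ρ m * (a - m) = c * y := by rw [hy]; field_simp
    have hr1 : Real.exp (-1) * c ≤ r := hα.trans hαr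
    have hy1 : y ≤ 1 := by
      have h1 : Real.exp y * (Real.exp (-1) * c) ≤ c :=
        (mul_le_mul_of_nonneg_left hr1 (Real.exp_pos y).le).trans hhaz
      have h2 : Real.exp (y - 1) * c ≤ 1 * c := by
        rw [sub_eq_add_neg, Real.exp_add, one_mul]; linarith
      have h3 := le_of_mul_le_mul_right h2 hcpos
      rw [Real.exp_le_one_iff] at h3
      linarith
    have hr2 : r ≤ c * Real.exp (-y) := by
      rw [Real.exp_neg, ← div_eq_mul_inv, le_div_iff₀ (Real.exp_pos y)]; linarith
    have hconv : Real.exp (-y) ≤ (1 - y) + y * Real.exp (-1) := by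
      have := convexOn_exp.2 (Set.mem_univ (0:ℝ)) (Set.mem_univ (-1:ℝ)) (show 0 ≤ 1 - y by linarith)
        hy0 (by ring)
      simpa using this
    rw [hcy]
    have h4 : y * Real.exp (-1) ≤ 1 * Real.exp (-1) := by gcongr
    nlinarith
  calc _ ≤ _ := hsplit
    _ ≤ L * (1 - c + ρ m * (a - m)) + L * (r - α) := add_le_add hleft hright
    _ = L * (1 - c + ρ m * (a - m) + (r - α)) := by ring
    _ ≤ L * 1 := by gcongr
    _ = L := mul_one L

lemma integral_le_of_logConcave {ρ : ℝ → ℝ} (hρ : Continuous ρ) (hρ0 : ∀ x, 0 ≤ ρ x)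
    (hρc : HasCompactSupport ρ)
    (hmid : ∀ x y, ρ x * ρ y ≤ ρ (midpoint ℝ x y) ^ 2) (hρ1 : ∫ x, ρ x = 1)
    {A B : Set ℝ} (hA : IsClosed A) (hB : IsClosed B)
    (hAB : Disjoint A B) {L : ℝ} (hL : 0 ≤ L)
    (hrem : ∀ x y, x ≤ y → (x ∈ A ∨ y ∈ A) → volume.real (B ∩ Set.Icc x y) ≤ L * (y - x))
    (hα : Real.exp (-1) ≤ ∫ x in A, ρ x) :
    ∫ x in B, ρ x ≤ L := by
  have hint : Integrable ρ := hρ.integrable_of_hasCompactSupport hρc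
  obtain ⟨m, hm⟩ : ∃ m, ∀ x, ρ x ≤ ρ m := hρ.exists_forall_ge_of_hasCompactSupport hρc
  have hnn : 0 ≤ᵐ[volume] ρ := .of_forall hρ0
  have hρm : 0 < ρ m := by
    by_contra! h
    have : ρ = 0 := funext fun x => le_antisymm ((hm x).trans h) (hρ0 x)
    simp [this] at hρ1
  have hpos : ∀ I : Set ℝ, (∀ ε > 0, (I ∩ Set.Ioo (m - ε) (m + ε) ∩ interior I).Nonempty) →
      0 < ∫ x in I, ρ x := by
    intro I hI
    obtain ⟨ε, hε, hball⟩ := Metric.mem_nhds_iff.mp (hρ.continuousAt.eventually (lt_mem_nhds hρm))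
    obtain ⟨z, ⟨hzI, hz⟩, hzi⟩ := hI ε hε
    rw [setIntegral_pos_iff_support_of_nonneg_ae (ae_restrict_of_ae hnn) hint.integrableOn]
    have ho : IsOpen (Function.support ρ ∩ interior I) :=
      (isOpen_ne_fun hρ continuous_const).inter isOpen_interior
    refine (ho.measure_pos volume ⟨z, ?_, hzi⟩).trans_le (measure_mono ?_)
    · refine (show 0 < ρ z from hball ?_).ne'
      rw [Metric.mem_ball, Real.dist_eq, abs_lt]
      constructor <;> linarith [hz.1, hz.2]
    · exact Set.inter_subset_inter_right _ interior_subset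
  have hcR : 0 < ∫ x in Set.Ici m, ρ x := hpos _ fun ε hε =>
    ⟨m + ε / 2, ⟨Set.mem_Ici.mpr (by linarith), by linarith, by linarith⟩, by simp [hε]⟩
  have hcL : 0 < ∫ x in Set.Iic m, ρ x := hpos _ fun ε hε =>
    ⟨m - ε / 2, ⟨Set.mem_Iic.mpr (by linarith), by linarith, by linarith⟩, by simp [hε]⟩
  have e1 : (∫ x in Set.Iic m, ρ x) + (∫ x in Set.Ici m, ρ x) = 1 := by
    rw [integral_Ici_eq_integral_Ioi, intervalIntegral.integral_Iic_add_Ioi hint.integrableOn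
      hint.integrableOn, hρ1]
  have e2 : (∫ x in A, ρ x) ≤ (∫ x in A ∩ Set.Iic m, ρ x) + (∫ x in A ∩ Set.Ici m, ρ x) := by
    have h1 := integral_inter_add_sdiff (μ := volume) (s := A) (measurableSet_Iic (a := m)) hint.integrableOn
    rw [← h1]
    gcongr 1
    · refine setIntegral_mono_set hint.integrableOn (ae_restrict_of_ae hnn)
        (LE.le.eventuallyLE fun x hx => ⟨hx.1, Set.mem_Ici.mpr (not_le.mp fun h => hx.2 h).le⟩)
  by_cases hcase : Real.exp (-1) * (∫ x in Set.Ici m, ρ x) ≤ ∫ x in A ∩ Set.Ici m, ρ x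
  · exact integral_le_of_mode_le hρ hρ0 hρc hmid hρ1 hA hB hAB hL hrem hm hcR hcase
  · have hcase2 : Real.exp (-1) * (∫ x in Set.Iic m, ρ x) ≤ ∫ x in A ∩ Set.Iic m, ρ x := by
      have e3 := congrArg (Real.exp (-1) * ·) e1
      simp only [mul_add, mul_one] at e3
      linarith [not_le.mp hcase]
    have hneg : ∀ S : Set ℝ, ∫ x in -S, ρ (-x) = ∫ x in S, ρ x := by
      intro S
      have := (Measure.measurePreserving_neg (volume : Measure ℝ)).setIntegral_preimage_emb
        (MeasurableEquiv.neg ℝ).measurableEmbedding ρ S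
      simpa using this
    have hvneg : ∀ S : Set ℝ, volume.real (-S) = volume.real S := by
      intro S; simp [measureReal_def]
    have := integral_le_of_mode_le (ρ := fun x => ρ (-x)) (A := -A) (B := -B) (m := -m) (L := L)
      (by fun_prop) (fun x => hρ0 _) (hρc.comp_homeomorph (Homeomorph.neg ℝ)) (fun x y => ?_) ?_
      hA.neg hB.neg ?_ hL ?_ (fun x => by simpa using hm (-x)) ?_ ?_
    · rwa [hneg] at this
    · convert hmid (-x) (-y) using 3
      simp only [midpoint_eq_smul_add, smul_eq_mul]; ring
    · rw [integral_neg_eq_self, hρ1]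
    · rw [Set.disjoint_left] at hAB ⊢
      exact fun x hx hy => hAB hx hy
    · intro x y hxy hA
      have h1 := hrem (-y) (-x) (by linarith) hA.symm
      rw [← hvneg, Set.inter_neg, Set.neg_Icc] at h1
      simp only [neg_neg] at h1
      linarith
    · rw [← Set.neg_Iic, hneg]; exact hcL
    · rw [← Set.neg_Iic, hneg, ← Set.inter_neg, hneg]; exact hcase2

/-- A measure `μ` is midpoint log-concave if it satisfies the Prékopa–Leindler inequality with
equal weights for continuous test functions with values in `[0, 1]`. -/
def MidLogConcave {E : Type*} [AddCommGroup E] [Module ℝ E] [TopologicalSpace E]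
    [MeasurableSpace E] (μ : Measure E) : Prop :=
  ∀ f g h : E → ℝ, Continuous f → Continuous g → Continuous h →
    (∀ x, f x ∈ Set.Icc 0 1) → (∀ x, g x ∈ Set.Icc 0 1) → (∀ x, h x ∈ Set.Icc 0 1) →
    (∀ x y, f x * g y ≤ h (midpoint ℝ x y) ^ 2) → (∫ x, f x ∂μ) * (∫ x, g x ∂μ) ≤ (∫ x, h x ∂μ) ^ 2

lemma tent_mul_tent_le {h : ℝ} (hh : 0 < h) (u v : ℝ) :
    max 0 (1 - |u| / h) * max 0 (1 - |v| / h) ≤ max 0 (1 - |midpoint ℝ u v| / h) ^ 2 := by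
  rcases le_total (1 - |u| / h) 0 with h1 | h1
  · rw [max_eq_left h1, zero_mul]; positivity
  rcases le_total (1 - |v| / h) 0 with h2 | h2
  · rw [max_eq_left h2, mul_zero]; positivity
  rw [max_eq_right h1, max_eq_right h2]
  have h3 : |midpoint ℝ u v| ≤ (|u| + |v|) / 2 := by
    rw [midpoint_eq_smul_add, smul_eq_mul, invOf_eq_inv, abs_mul]
    have := abs_add_le u v
    rw [abs_of_pos (by norm_num : (0:ℝ) < 2⁻¹)]
    linarith
  have h4 : ((1 - |u| / h) + (1 - |v| / h)) / 2 ≤ 1 - |midpoint ℝ u v| / h := by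
    have := div_le_div_of_nonneg_right h3 hh.le
    have e : (|u| + |v|) / 2 / h = (|u| / h + |v| / h) / 2 := by ring
    linarith
  have h5 : ((1 - |u| / h) + (1 - |v| / h)) / 2 ≤ max 0 (1 - |midpoint ℝ u v| / h) :=
    h4.trans (le_max_right _ _)
  calc _ ≤ (((1 - |u| / h) + (1 - |v| / h)) / 2) ^ 2 := by nlinarith [sq_nonneg ((1 - |u| / h) - (1 - |v| / h))]
    _ ≤ _ := by gcongr

lemma exists_smoothing {ν : Measure ℝ} [IsProbabilityMeasure ν] (hν : MidLogConcave ν) {R : ℝ}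
    (hR : ν (Set.Icc (-R) R)ᶜ = 0) {h : ℝ} (hh : 0 < h) :
    ∃ ρ : ℝ → ℝ, Continuous ρ ∧ (∀ x, 0 ≤ ρ x) ∧ HasCompactSupport ρ ∧
      (∀ x y, ρ x * ρ y ≤ ρ (midpoint ℝ x y) ^ 2) ∧ ∫ x, ρ x = 1 ∧
      ∀ T T' : Set ℝ, MeasurableSet T → MeasurableSet T' →
        (∀ y ∈ T, y ∈ Set.Icc (-R) R → ∀ x, |x - y| < h → x ∈ T') →
        ν.real T ≤ ∫ x in T', ρ x := by
  set K : ℝ → ℝ := fun u => max 0 (1 - |u| / h) with hK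
  have hKc : Continuous K := by fun_prop
  have hK0 : ∀ u, 0 ≤ K u := fun u => le_max_left _ _
  have hK1 : ∀ u, K u ≤ 1 := fun u => max_le zero_le_one (by
    have : 0 ≤ |u| / h := by positivity
    linarith)
  have hKh : ∀ u, h ≤ |u| → K u = 0 := fun u hu => max_eq_left (by
    have : 1 ≤ |u| / h := by rwa [le_div_iff₀ hh, one_mul]
    linarith)
  have hKs : HasCompactSupport K := HasCompactSupport.intro (isCompact_Icc (a := -h) (b := h))
    fun u hu => hKh u (by
      by_contra! h1
      exact hu ⟨(abs_lt.mp h1).1.le, (abs_lt.mp h1).2.le⟩)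
  have hKint : Integrable K := hKc.integrable_of_hasCompactSupport hKs
  set c := ∫ u, K u with hc
  have hcpos : 0 < c := hKc.integral_pos_of_hasCompactSupport_nonneg_nonzero hKs hK0
    (x := 0) (by simp [hK])
  have hprod : Integrable (fun z : ℝ × ℝ => K (z.1 - z.2)) (volume.prod ν) := by
    have := (integrable_const (μ := ν) (1:ℝ)).convolution_integrand (ContinuousLinearMap.mul ℝ ℝ) hKint
    simpa using this
  have hI : ∀ x, Integrable (fun y => K (x - y)) ν := fun x =>
    Integrable.of_bound (by fun_prop) 1 (.of_forall fun y => by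
      rw [Real.norm_of_nonneg (hK0 _)]; exact hK1 _)
  have hae : ∀ᵐ y ∂ν, y ∈ Set.Icc (-R) R := hR
  have hprodT : ∀ T' : Set ℝ,
      Integrable (Function.uncurry fun x y : ℝ => K (x - y)) ((volume.restrict T').prod ν) := by
    intro T'
    have := hprod.restrict (s := T' ×ˢ Set.univ)
    rwa [← Measure.prod_restrict, Measure.restrict_univ] at this
  have hfub : ∀ T' : Set ℝ, ∫ x in T', (∫ y, K (x - y) ∂ν) = ∫ y, (∫ x in T', K (x - y)) ∂ν :=
    fun T' => integral_integral_swap (hprodT T')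
  have hshift : ∀ y, ∫ x, K (x - y) = c := fun y => integral_sub_right_eq_self K y
  refine ⟨fun x => c⁻¹ * ∫ y, K (x - y) ∂ν, ?_, ?_, ?_, ?_, ?_, ?_⟩
  · refine continuous_const.mul (continuous_of_dominated (bound := fun _ => 1) ?_ ?_ ?_ ?_)
    · intro x; fun_prop
    · intro x; exact .of_forall fun y => by rw [Real.norm_of_nonneg (hK0 _)]; exact hK1 _
    · exact integrable_const _
    · exact .of_forall fun y => by fun_prop
  · intro x; exact mul_nonneg (inv_nonneg.mpr hcpos.le) (integral_nonneg fun y => hK0 _)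
  · refine HasCompactSupport.intro (isCompact_Icc (a := -R - h) (b := R + h)) fun x hx => ?_
    rw [integral_eq_zero_of_ae, mul_zero]
    filter_upwards [hae] with y hy
    refine hKh _ ?_
    by_contra! h1
    rw [abs_lt] at h1
    exact hx ⟨by linarith [hy.1], by linarith [hy.2]⟩
  · intro x x'
    have := hν (fun y => K (x - y)) (fun y => K (x' - y)) (fun y => K (midpoint ℝ x x' - y))
      (by fun_prop) (by fun_prop) (by fun_prop) (fun _ => ⟨hK0 _, hK1 _⟩) (fun _ => ⟨hK0 _, hK1 _⟩)
      (fun _ => ⟨hK0 _, hK1 _⟩) (fun y y' => ?_)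
    · calc _ = (c⁻¹) ^ 2 * ((∫ y, K (x - y) ∂ν) * ∫ y, K (x' - y) ∂ν) := by ring
        _ ≤ (c⁻¹) ^ 2 * (∫ y, K (midpoint ℝ x x' - y) ∂ν) ^ 2 := by gcongr
        _ = _ := by ring
    · have e : midpoint ℝ x x' - midpoint ℝ y y' = midpoint ℝ (x - y) (x' - y') := by
        simp only [midpoint_eq_smul_add, smul_eq_mul]; ring
      rw [e]
      exact tent_mul_tent_le hh _ _
  · rw [integral_const_mul]
    have := hfub Set.univ
    simp only [Measure.restrict_univ, hshift] at this
    rw [this]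
    simp [hcpos.ne']
  · intro T T' hT hT' hTT'
    rw [integral_const_mul, hfub, le_inv_mul_iff₀ hcpos]
    have e : c * ν.real T = ∫ y, T.indicator (fun _ => c) y ∂ν := by
      rw [integral_indicator hT, setIntegral_const, smul_eq_mul, mul_comm]
    rw [e]
    refine integral_mono_ae ((integrable_const c).indicator hT) ?_ ?_
    · exact (hprodT T').integral_prod_right
    · filter_upwards [hae] with y hy
      by_cases hyT : y ∈ T
      · rw [Set.indicator_of_mem hyT, ← hshift y]
        refine (setIntegral_eq_integral_of_forall_compl_eq_zero fun x hx => ?_).ge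
        exact hKh _ (not_lt.mp fun h1 => hx (hTT' y hyT hy x h1))
      · rw [Set.indicator_of_notMem hyT]
        exact integral_nonneg fun x => hK0 _

lemma MidLogConcave.measureReal_le {ν : Measure ℝ} [IsProbabilityMeasure ν] (hν : MidLogConcave ν)
    {R : ℝ} (hR : ν (Set.Icc (-R) R)ᶜ = 0) {d : ℕ} (hd : d ≠ 0) {p : Polynomial ℝ}
    (hp : p.natDegree ≤ d) {s M : ℝ} (hs : 0 < s) (hsM : s < M)
    (hA : Real.exp (-1) ≤ ν.real {t | M ≤ |p.eval t|}) :
    ν.real {t | |p.eval t| ≤ s} ≤ 4 * (s / M) ^ (1 / d : ℝ) := by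
  have hpc : Continuous fun t => |p.eval t| := p.continuous.abs
  have key : ∀ ε ∈ Set.Ioo 0 ((M - s) / 2),
      ν.real {t | |p.eval t| ≤ s} ≤ 4 * ((s + ε) / (M - ε)) ^ (1 / d : ℝ) := by
    rintro ε ⟨hε, hε2⟩
    have hMε : 0 < M - ε := by linarith
    have huc : UniformContinuousOn (fun t => |p.eval t|) (Set.Icc (-R - 1) (R + 1)) :=
      isCompact_Icc.uniformContinuousOn_of_continuous hpc.continuousOn
    obtain ⟨δ, hδ, hδ'⟩ := Metric.uniformContinuousOn_iff.mp huc ε hε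
    obtain ⟨ρ, h1, h2, h3, h4, h5, h6⟩ := exists_smoothing hν hR (show 0 < min δ 1 by positivity)
    have hclose : ∀ y ∈ Set.Icc (-R) R, ∀ x, |x - y| < min δ 1 → abs (|p.eval x| - |p.eval y|) < ε := by
      intro y hy x hx
      have hx1 := hx.trans_le (min_le_right _ _)
      rw [abs_lt] at hx1
      exact hδ' x ⟨by linarith [hy.1], by linarith [hy.2]⟩ y ⟨by linarith [hy.1], by linarith [hy.2]⟩
        (hx.trans_le (min_le_left _ _))
    have hAc : IsClosed {t | M - ε ≤ |p.eval t|} := isClosed_le continuous_const hpc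
    have hBc : IsClosed {t | |p.eval t| ≤ s + ε} := isClosed_le hpc continuous_const
    have hLB : ν.real {t | |p.eval t| ≤ s} ≤ ∫ x in {t | |p.eval t| ≤ s + ε}, ρ x := by
      refine h6 _ _ (isClosed_le hpc continuous_const).measurableSet hBc.measurableSet ?_
      intro y (hy : |p.eval y| ≤ s) hyR x hx
      show |p.eval x| ≤ s + ε
      linarith [(abs_lt.mp (hclose y hyR x hx)).2]
    have hLA : ν.real {t | M ≤ |p.eval t|} ≤ ∫ x in {t | M - ε ≤ |p.eval t|}, ρ x := by
      refine h6 _ _ (isClosed_le continuous_const hpc).measurableSet hAc.measurableSet ?_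
      intro y (hy : M ≤ |p.eval y|) hyR x hx
      show M - ε ≤ |p.eval x|
      linarith [(abs_lt.mp (hclose y hyR x hx)).1]
    refine hLB.trans (integral_le_of_logConcave h1 h2 h3 h4 h5 hAc hBc ?_ (by positivity) ?_
      (hA.trans hLA))
    · rw [Set.disjoint_left]
      intro x (hx : M - ε ≤ |p.eval x|) (hx' : |p.eval x| ≤ s + ε)
      linarith
    · intro x y hxy hxA
      obtain ⟨a, ha, haA⟩ : ∃ a ∈ Set.Icc x y, M - ε ≤ |p.eval a| := by
        rcases hxA with h | h
        · exact ⟨x, ⟨le_rfl, hxy⟩, h⟩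
        · exact ⟨y, ⟨hxy, le_rfl⟩, h⟩
      have hr := remez_inequality hd hp (s := s + ε) (by linarith) ha
      have e : {t | |p.eval t| ≤ s + ε} ∩ Set.Icc x y = {t ∈ Set.Icc x y | |p.eval t| ≤ s + ε} := by
        rw [Set.inter_comm]; rfl
      rw [e]
      set V := volume.real {t ∈ Set.Icc x y | |p.eval t| ≤ s + ε}
      have hV : V ^ d ≤ (4 * ((s + ε) / (M - ε)) ^ (1 / d : ℝ) * (y - x)) ^ d := by
        have e2 : (((s + ε) / (M - ε)) ^ (1 / d : ℝ)) ^ d = (s + ε) / (M - ε) := by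
          rw [one_div]; exact Real.rpow_inv_natCast_pow (by positivity) hd
        rw [show (4 * ((s + ε) / (M - ε)) ^ (1 / d : ℝ) * (y - x)) ^ d =
          (4 * (y - x)) ^ d * (((s + ε) / (M - ε)) ^ (1 / d : ℝ)) ^ d by rw [← mul_pow]; ring, e2,
          ← mul_div_assoc, le_div_iff₀ hMε, mul_comm]
        exact (mul_le_mul_of_nonneg_right haA (by positivity)).trans hr
      exact le_of_pow_le_pow_left₀ hd (mul_nonneg (by positivity) (by linarith)) hV
  have hlim : Filter.Tendsto (fun ε : ℝ => 4 * ((s + ε) / (M - ε)) ^ (1 / d : ℝ))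
      (nhdsWithin 0 (Set.Ioi 0)) (nhds (4 * (s / M) ^ (1 / d : ℝ))) := by
    have hc : ContinuousAt (fun ε : ℝ => 4 * ((s + ε) / (M - ε)) ^ (1 / d : ℝ)) 0 := by
      have : M - 0 ≠ 0 := by linarith
      refine continuousAt_const.mul (ContinuousAt.rpow_const ?_ (.inr (by positivity)))
      exact ContinuousAt.div (by fun_prop) (by fun_prop) this
    simpa using hc.tendsto.mono_left nhdsWithin_le_nhds
  refine ge_of_tendsto hlim ?_
  filter_upwards [Ioo_mem_nhdsGT (show 0 < (M - s) / 2 by linarith)] with ε hε using key ε hε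

section LogConcaveReal

open scoped Pointwise in
lemma add_volume_le_two_mul_volume {A B S : Set ℝ} (hA : IsCompact A) (hB : IsCompact B)
    (hA0 : A.Nonempty) (hB0 : B.Nonempty) (hS : ∀ x ∈ A, ∀ y ∈ B, midpoint ℝ x y ∈ S) :
    volume A + volume B ≤ 2 * volume S := by
  have ha := hA.isGreatest_sSup hA0
  have hb := hB.isLeast_sInf hB0
  set a := sSup A
  set b := sInf B
  have hhalf : ∀ x y : ℝ, midpoint ℝ x y = (1 / 2) * (x + y) := fun x y => by
    rw [midpoint_eq_smul_add, smul_eq_mul, invOf_eq_inv]; ring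
  have himg : ∀ (T : Set ℝ) (z : ℝ), volume ((fun x => (1 / 2) * (x + z)) '' T) = volume T / 2 := by
    intro T z
    have e : (fun x => (1 / 2) * (x + z)) '' T = (1 / 2 : ℝ) • ((fun x => x + z) '' T) := by
      rw [← Set.image_smul, Set.image_image]; rfl
    rw [e, Measure.addHaar_smul, Set.image_add_right, measure_preimage_add_right]
    rw [Module.finrank_self, pow_one, abs_of_pos (by norm_num), ENNReal.div_eq_inv_mul]
    congr 1
    rw [one_div, ENNReal.ofReal_inv_of_pos (by norm_num)]; simp
  have hsub : (fun x => (1 / 2) * (x + b)) '' A ∪ (fun y => (1 / 2) * (y + a)) '' B ⊆ S := by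
    rintro _ (⟨x, hx, rfl⟩ | ⟨y, hy, rfl⟩)
    · have := hS x hx b hb.1
      rwa [hhalf] at this
    · have := hS a ha.1 y hy
      rwa [hhalf, add_comm] at this
  have hdisj : AEDisjoint volume ((fun x => (1 / 2) * (x + b)) '' A)
      ((fun y => (1 / 2) * (y + a)) '' B) := by
    refine measure_mono_null ?_ (Real.volume_singleton (a := (1 / 2) * (a + b)))
    rintro _ ⟨⟨x, hx, rfl⟩, ⟨y, hy, hxy⟩⟩
    have h1 := ha.2 hx
    have h2 := hb.2 hy
    simp only at hxy
    rw [Set.mem_singleton_iff]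
    linarith
  have hm : NullMeasurableSet ((fun y => (1 / 2) * (y + a)) '' B) :=
    (hB.image (by fun_prop)).measurableSet.nullMeasurableSet
  have := measure_mono (μ := volume) hsub
  rw [measure_union₀ hm hdisj, himg, himg, ← ENNReal.add_div] at this
  rwa [ENNReal.div_le_iff (by norm_num) (by norm_num), mul_comm] at this

lemma midLogConcave_volume_restrict_Icc (a b : ℝ) :
    MidLogConcave (volume.restrict (Set.Icc a b) : Measure ℝ) := by
  intro f g h hf hg hh hf01 hg01 hh01 hfg
  rcases (Set.Icc a b).eq_empty_or_nonempty with h0 | h0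
  · simp [h0]
  obtain ⟨x₀, hx₀, hfx₀⟩ := isCompact_Icc.exists_isMaxOn h0 hf.continuousOn
  obtain ⟨y₀, hy₀, hgy₀⟩ := isCompact_Icc.exists_isMaxOn h0 hg.continuousOn
  rw [isMaxOn_iff] at hfx₀ hgy₀
  set K := Set.Icc a b
  have hzero : ∀ u : ℝ → ℝ, (∀ x, u x ∈ Set.Icc 0 1) → ∀ z, (∀ x ∈ K, u x ≤ u z) → u z = 0 →
      ∫ x in K, u x = 0 := by
    intro u hu z hz hz0
    rw [setIntegral_congr_fun (g := fun _ => (0:ℝ)) measurableSet_Icc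
      fun x hx => le_antisymm ((hz x hx).trans hz0.le) (hu x).1]
    simp
  rcases (hf01 x₀).1.eq_or_lt with hα | hα
  · rw [hzero f hf01 x₀ hfx₀ hα.symm, zero_mul]; positivity
  rcases (hg01 y₀).1.eq_or_lt with hβ | hβ
  · rw [hzero g hg01 y₀ hgy₀ hβ.symm, mul_zero]; positivity
  set α := f x₀
  set β := g y₀
  set γ := Real.sqrt (α * β)
  have hγ : 0 < γ := Real.sqrt_pos.mpr (mul_pos hα hβ)
  have hγ2 : γ ^ 2 = α * β := Real.sq_sqrt (mul_pos hα hβ).le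
  have hI : ∀ u : ℝ → ℝ, Continuous u → IntegrableOn u K := fun u hu =>
    hu.continuousOn.integrableOn_compact isCompact_Icc
  have key : (∫⁻ x in K, ENNReal.ofReal (f x / α)) + (∫⁻ x in K, ENNReal.ofReal (g x / β)) ≤
      2 * ∫⁻ x in K, ENNReal.ofReal (h x / γ) := by
    have hanti : ∀ u : ℝ → ℝ, Antitone fun t : ℝ => (volume.restrict K) {x | t ≤ u x} :=
      fun u s t hst => measure_mono fun x hx => le_trans hst hx
    rw [lintegral_eq_lintegral_meas_le _ (.of_forall fun x => div_nonneg (hf01 x).1 hα.le)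
        (by fun_prop),
      lintegral_eq_lintegral_meas_le _ (.of_forall fun x => div_nonneg (hg01 x).1 hβ.le)
        (by fun_prop),
      lintegral_eq_lintegral_meas_le _ (.of_forall fun x => div_nonneg (hh01 x).1 hγ.le)
        (by fun_prop),
      ← lintegral_const_mul' _ _ (by norm_num), ← lintegral_add_left (hanti _).measurable]
    refine setLIntegral_mono' measurableSet_Ioi fun t ht => ?_
    have ht0 : 0 < t := ht
    have hcl : ∀ u : ℝ → ℝ, Continuous u → IsClosed {x | t ≤ u x} := fun u hu =>
      isClosed_le continuous_const hu
    have hfc : Continuous fun x => f x / α := by fun_prop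
    have hgc : Continuous fun x => g x / β := by fun_prop
    have hhc : Continuous fun x => h x / γ := by fun_prop
    rw [Measure.restrict_apply (hcl _ hfc).measurableSet,
      Measure.restrict_apply (hcl _ hgc).measurableSet,
      Measure.restrict_apply (hcl _ hhc).measurableSet]
    rcases le_or_gt t 1 with ht1 | ht1
    · refine add_volume_le_two_mul_volume (isCompact_Icc.inter_left (hcl _ hfc))
        (isCompact_Icc.inter_left (hcl _ hgc)) ⟨x₀, ?_, hx₀⟩ ⟨y₀, ?_, hy₀⟩ ?_
      · show t ≤ f x₀ / α
        rwa [div_self hα.ne']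
      · show t ≤ g y₀ / β
        rwa [div_self hβ.ne']
      · rintro x ⟨hx : t ≤ f x / α, hxK⟩ y ⟨hy : t ≤ g y / β, hyK⟩
        refine ⟨?_, (convex_Icc a b).midpoint_mem hxK hyK⟩
        show t ≤ h (midpoint ℝ x y) / γ
        rw [le_div_iff₀ hα] at hx
        rw [le_div_iff₀ hβ] at hy
        rw [le_div_iff₀ hγ]
        refine le_of_sq_le_sq ?_ (hh01 _).1
        calc (t * γ) ^ 2 = (t * α) * (t * β) := by rw [mul_pow, hγ2]; ring
          _ ≤ f x * g y := mul_le_mul hx hy (by positivity) (hf01 x).1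
          _ ≤ _ := hfg x y
    · have e1 : {x | t ≤ f x / α} ∩ K = ∅ := by
        rw [Set.eq_empty_iff_forall_notMem]
        rintro x ⟨hx : t ≤ f x / α, hxK⟩
        have : f x / α ≤ 1 := (div_le_one hα).mpr (hfx₀ x hxK)
        linarith
      have e2 : {x | t ≤ g x / β} ∩ K = ∅ := by
        rw [Set.eq_empty_iff_forall_notMem]
        rintro x ⟨hx : t ≤ g x / β, hxK⟩
        have : g x / β ≤ 1 := (div_le_one hβ).mpr (hgy₀ x hxK)
        linarith
      rw [e1, e2]; simp
  have hreal : (∫ x in K, f x) / α + (∫ x in K, g x) / β ≤ 2 * ((∫ x in K, h x) / γ) := by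
    have e : ∀ (u : ℝ → ℝ) (c : ℝ), Continuous u → (∀ x, u x ∈ Set.Icc 0 1) → 0 < c →
        ∫⁻ x in K, ENNReal.ofReal (u x / c) = ENNReal.ofReal ((∫ x in K, u x) / c) := by
      intro u c hu hu01 hc
      rw [← integral_div, ofReal_integral_eq_lintegral_ofReal]
      · exact (hI u hu).div_const c
      · exact .of_forall fun x => div_nonneg (hu01 x).1 hc.le
    have hn : ∀ (u : ℝ → ℝ), (∀ x, u x ∈ Set.Icc 0 1) → 0 ≤ ∫ x in K, u x := fun u hu =>
      integral_nonneg fun x => (hu x).1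
    rw [e f α hf hf01 hα, e g β hg hg01 hβ, e h γ hh hh01 hγ,
      ← ENNReal.ofReal_add (div_nonneg (hn f hf01) hα.le) (div_nonneg (hn g hg01) hβ.le),
      show (2 : ENNReal) = ENNReal.ofReal 2 by simp, ← ENNReal.ofReal_mul (by norm_num),
      ENNReal.ofReal_le_ofReal_iff (mul_nonneg (by norm_num) (div_nonneg (hn h hh01) hγ.le))] at key
    exact key
  set If := ∫ x in K, f x
  set Ig := ∫ x in K, g x
  set Ih := ∫ x in K, h x
  have hIf : 0 ≤ If := integral_nonneg fun x => (hf01 x).1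
  have hIg : 0 ≤ Ig := integral_nonneg fun x => (hg01 x).1
  have h1 : (If / α) * (Ig / β) ≤ (Ih / γ) ^ 2 := by
    have h2 : ((If / α + Ig / β) / 2) ^ 2 ≤ (Ih / γ) ^ 2 := by
      have h3 : 0 ≤ If / α := div_nonneg hIf hα.le
      have h4 : 0 ≤ Ig / β := div_nonneg hIg hβ.le
      exact pow_le_pow_left₀ (by linarith) (by linarith) 2
    nlinarith [sq_nonneg (If / α - Ig / β)]
  rw [div_pow, hγ2, div_mul_div_comm] at h1
  exact (div_le_div_iff_of_pos_right (mul_pos hα hβ)).mp h1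

end LogConcaveReal

section MidLogConcave

lemma MidLogConcave.integral_mul_le {E : Type*} [AddCommGroup E] [Module ℝ E] [TopologicalSpace E]
    [MeasurableSpace E] {μ : Measure E} (hμ : MidLogConcave μ) {C : ℝ} {f g h : E → ℝ}
    (hf : Continuous f) (hg : Continuous g) (hh : Continuous h) (hfC : ∀ x, f x ∈ Set.Icc 0 C)
    (hgC : ∀ x, g x ∈ Set.Icc 0 C) (hhC : ∀ x, h x ∈ Set.Icc 0 C)
    (hfg : ∀ x y, f x * g y ≤ h (midpoint ℝ x y) ^ 2) :
    (∫ x, f x ∂μ) * (∫ x, g x ∂μ) ≤ (∫ x, h x ∂μ) ^ 2 := by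
  have hC1 : 0 < |C| + 1 := by positivity
  have hm : ∀ {u : E → ℝ}, (∀ x, u x ∈ Set.Icc 0 C) → ∀ x, u x / (|C| + 1) ∈ Set.Icc (0 : ℝ) 1 :=
    fun hu x => ⟨div_nonneg (hu x).1 hC1.le,
      (div_le_one hC1).mpr ((hu x).2.trans (by linarith [le_abs_self C]))⟩
  have := hμ (fun x => f x / (|C| + 1)) (fun x => g x / (|C| + 1)) (fun x => h x / (|C| + 1))
    (by fun_prop) (by fun_prop) (by fun_prop) (hm hfC) (hm hgC) (hm hhC) (fun x y => by
      rw [div_mul_div_comm, div_pow, sq (|C| + 1)]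
      gcongr
      exact hfg x y)
  rw [integral_div, integral_div, integral_div, div_mul_div_comm, div_pow, sq (|C| + 1)] at this
  exact (div_le_div_iff_of_pos_right (by positivity)).mp this

lemma MidLogConcave.prod {E F : Type*} [NormedAddCommGroup E] [NormedSpace ℝ E]
    [SecondCountableTopology E] [MeasurableSpace E] [BorelSpace E] [NormedAddCommGroup F]
    [NormedSpace ℝ F] [SecondCountableTopology F] [MeasurableSpace F] [BorelSpace F]
    {μ : Measure E} {ν : Measure F} [IsFiniteMeasure μ] [IsFiniteMeasure ν] (hμ : MidLogConcave μ)
    (hν : MidLogConcave ν) : MidLogConcave (μ.prod ν) := by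
  intro f g h hf hg hh hf1 hg1 hh1 hfg
  have hb : ∀ u : E × F → ℝ, (∀ x, u x ∈ Set.Icc (0:ℝ) 1) → ∀ x, ‖u x‖ ≤ 1 := fun u hu x => by
    rw [Real.norm_of_nonneg (hu x).1]; exact (hu x).2
  have hcont : ∀ u : E × F → ℝ, Continuous u → (∀ x, u x ∈ Set.Icc (0:ℝ) 1) →
      Continuous fun x => ∫ y, u (x, y) ∂ν := by
    intro u hu hu1
    refine continuous_of_dominated (bound := fun _ => 1) (fun x => ?_)
      (fun x => .of_forall fun y => hb u hu1 _) (integrable_const _)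
      (.of_forall fun y => by fun_prop)
    exact (hu.comp (by fun_prop)).aestronglyMeasurable
  have hint : ∀ u : E × F → ℝ, Continuous u → (∀ x, u x ∈ Set.Icc (0:ℝ) 1) →
      Integrable u (μ.prod ν) := fun u hu hu1 =>
    Integrable.of_bound hu.aestronglyMeasurable 1 (.of_forall (hb u hu1))
  have hrange : ∀ u : E × F → ℝ, (∀ x, u x ∈ Set.Icc (0:ℝ) 1) →
      ∀ x, ∫ y, u (x, y) ∂ν ∈ Set.Icc 0 (ν.real Set.univ) := by
    intro u hu x
    refine ⟨integral_nonneg fun y => (hu _).1, ?_⟩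
    have := norm_integral_le_of_norm_le_const (μ := ν) (f := fun y => u (x, y))
      (.of_forall fun y => hb u hu (x, y))
    rw [one_mul] at this
    exact (le_abs_self _).trans this
  rw [integral_prod _ (hint f hf hf1), integral_prod _ (hint g hg hg1),
    integral_prod _ (hint h hh hh1)]
  refine hμ.integral_mul_le (hcont f hf hf1) (hcont g hg hg1) (hcont h hh hh1) (hrange f hf1)
    (hrange g hg1) (hrange h hh1) fun x x' => ?_
  refine hν _ _ _ (by fun_prop) (by fun_prop) (by fun_prop) (fun y => hf1 _) (fun y => hg1 _)
    (fun y => hh1 _) fun y y' => ?_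
  have := hfg (x, y) (x', y')
  have e : midpoint ℝ (x, y) (x', y') = (midpoint ℝ x x', midpoint ℝ y y') := by
    simp only [midpoint_eq_smul_add]; rfl
  rwa [e] at this

lemma MidLogConcave.map {E F : Type*} [AddCommGroup E] [Module ℝ E] [TopologicalSpace E]
    [MeasurableSpace E] [OpensMeasurableSpace E] [AddCommGroup F] [Module ℝ F] [TopologicalSpace F]
    [TopologicalSpace.PseudoMetrizableSpace F] [MeasurableSpace F] [BorelSpace F]
    {μ : Measure E} (hμ : MidLogConcave μ) {T : E → F}
    (hT : Continuous T) (hmid : ∀ x y, T (midpoint ℝ x y) = midpoint ℝ (T x) (T y)) :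
    MidLogConcave (μ.map T) := by
  intro f g h hf hg hh hf1 hg1 hh1 hfg
  have e : ∀ u : F → ℝ, Continuous u → ∫ y, u y ∂(μ.map T) = ∫ x, u (T x) ∂μ := fun u hu =>
    integral_map hT.measurable.aemeasurable hu.stronglyMeasurable.aestronglyMeasurable
  rw [e f hf, e g hg, e h hh]
  refine hμ _ _ _ (by fun_prop) (by fun_prop) (by fun_prop) (fun x => hf1 _) (fun x => hg1 _)
    (fun x => hh1 _) fun x y => ?_
  rw [hmid]
  exact hfg _ _

lemma MidLogConcave.smul {E : Type*} [AddCommGroup E] [Module ℝ E] [TopologicalSpace E]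
    [MeasurableSpace E] {μ : Measure E} (hμ : MidLogConcave μ) (c : ENNReal) :
    MidLogConcave (c • μ) := by
  intro f g h hf hg hh hf1 hg1 hh1 hfg
  have := hμ f g h hf hg hh hf1 hg1 hh1 hfg
  simp only [integral_smul_measure, smul_eq_mul]
  calc _ = c.toReal ^ 2 * ((∫ x, f x ∂μ) * ∫ x, g x ∂μ) := by ring
    _ ≤ c.toReal ^ 2 * (∫ x, h x ∂μ) ^ 2 := by gcongr
    _ = _ := by ring

lemma infDist_midpoint_le {E : Type*} [NormedAddCommGroup E] [NormedSpace ℝ E] {C D S : Set E}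
    (hC0 : C.Nonempty) (hD0 : D.Nonempty) (hS : ∀ x ∈ C, ∀ y ∈ D, midpoint ℝ x y ∈ S) (x y : E) :
    Metric.infDist (midpoint ℝ x y) S ≤ (Metric.infDist x C + Metric.infDist y D) / 2 := by
  refine le_of_forall_pos_le_add fun ε hε => ?_
  obtain ⟨x', hx', hxx⟩ := (Metric.infDist_lt_iff hC0).mp (lt_add_of_pos_right (Metric.infDist x C) hε)
  obtain ⟨y', hy', hyy⟩ := (Metric.infDist_lt_iff hD0).mp (lt_add_of_pos_right (Metric.infDist y D) hε)
  have h1 := Metric.infDist_le_dist_of_mem (x := midpoint ℝ x y) (hS x' hx' y' hy')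
  have h2 := dist_midpoint_midpoint_le x y x' y'
  linarith

lemma exp_infDist_mul_le {E : Type*} [NormedAddCommGroup E] [NormedSpace ℝ E] {C D S : Set E}
    (hC0 : C.Nonempty) (hD0 : D.Nonempty) (hS : ∀ x ∈ C, ∀ y ∈ D, midpoint ℝ x y ∈ S) (N : ℕ)
    (x y : E) : Real.exp (-N * Metric.infDist x C) * Real.exp (-N * Metric.infDist y D) ≤
      Real.exp (-N * Metric.infDist (midpoint ℝ x y) S) ^ 2 := by
  rw [← Real.exp_add, ← Real.exp_nat_mul, Real.exp_le_exp]
  have := mul_le_mul_of_nonneg_left (infDist_midpoint_le hC0 hD0 hS x y) (Nat.cast_nonneg (α := ℝ) N)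
  push_cast
  linarith

lemma exp_infDist_mem {E : Type*} [PseudoMetricSpace E] (C : Set E) (N : ℕ) (x : E) :
    Real.exp (-N * Metric.infDist x C) ∈ Set.Icc (0 : ℝ) 1 :=
  ⟨(Real.exp_pos _).le, Real.exp_le_one_iff.mpr (by
    have := mul_nonneg (Nat.cast_nonneg (α := ℝ) N) (Metric.infDist_nonneg (x := x) (s := C))
    linarith)⟩

lemma tendsto_integral_mul_exp_infDist {E : Type*} [NormedAddCommGroup E]
    [SecondCountableTopology E] [MeasurableSpace E] [BorelSpace E] {μ : Measure E}
    [IsFiniteMeasure μ] {C : Set E} (hC : IsClosed C) (hC0 : C.Nonempty) {f : E → ℝ}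
    (hf : Continuous f) (hf1 : ∀ x, f x ∈ Set.Icc 0 1) :
    Filter.Tendsto (fun N : ℕ => ∫ x, f x * Real.exp (-N * Metric.infDist x C) ∂μ) Filter.atTop
      (nhds (∫ x in C, f x ∂μ)) := by
  rw [← integral_indicator hC.measurableSet]
  refine tendsto_integral_of_dominated_convergence (fun _ => 1) (fun N => ?_) (integrable_const _)
    (fun N => .of_forall fun x => ?_) (.of_forall fun x => ?_)
  · have : Continuous fun x => f x * Real.exp (-N * Metric.infDist x C) := by fun_prop
    exact this.aestronglyMeasurable
  · have h1 := exp_infDist_mem C N x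
    rw [Real.norm_of_nonneg (mul_nonneg (hf1 x).1 h1.1)]
    exact mul_le_one₀ (hf1 x).2 h1.1 h1.2
  · by_cases hx : x ∈ C
    · simp [hx, Metric.infDist_zero_of_mem hx]
    · rw [Set.indicator_of_notMem hx, ← mul_zero (f x)]
      refine Filter.Tendsto.const_mul _ ?_
      have hpos : 0 < Metric.infDist x C := (hC.notMem_iff_infDist_pos hC0).mp hx
      refine Real.tendsto_exp_atBot.comp ?_
      simp only [neg_mul]
      exact Filter.tendsto_neg_atTop_atBot.comp
        (tendsto_natCast_atTop_atTop.atTop_mul_const hpos)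

lemma MidLogConcave.restrict {E : Type*} [NormedAddCommGroup E] [NormedSpace ℝ E]
    [SecondCountableTopology E] [MeasurableSpace E] [BorelSpace E] {μ : Measure E}
    [IsFiniteMeasure μ] (hμ : MidLogConcave μ) {C : Set E} (hC : IsClosed C) (hCc : Convex ℝ C) :
    MidLogConcave (μ.restrict C) := by
  rcases C.eq_empty_or_nonempty with h0 | h0
  · intro f g h
    simp [h0]
  intro f g h hf hg hh hf1 hg1 hh1 hfg
  have hlim := fun (u : E → ℝ) hu hu1 => tendsto_integral_mul_exp_infDist (μ := μ) hC h0 (f := u) hu hu1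
  refine le_of_tendsto_of_tendsto' ((hlim f hf hf1).mul (hlim g hg hg1)) ((hlim h hh hh1).pow 2)
    fun N => ?_
  have hm : ∀ u : E → ℝ, (∀ x, u x ∈ Set.Icc 0 1) →
      ∀ x, u x * Real.exp (-N * Metric.infDist x C) ∈ Set.Icc (0 : ℝ) 1 := fun u hu x =>
    have h1 := exp_infDist_mem C N x
    ⟨mul_nonneg (hu x).1 h1.1, mul_le_one₀ (hu x).2 h1.1 h1.2⟩
  refine hμ _ _ _ (by fun_prop) (by fun_prop) (by fun_prop) (hm f hf1) (hm g hg1) (hm h hh1)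
    fun x y => ?_
  have h1 := exp_infDist_mul_le h0 h0 (fun x hx y hy => hCc.midpoint_mem hx hy) N x y
  calc _ = (f x * g y) * (Real.exp (-N * Metric.infDist x C) * Real.exp (-N * Metric.infDist y C)) := by
        ring
    _ ≤ h (midpoint ℝ x y) ^ 2 * Real.exp (-N * Metric.infDist (midpoint ℝ x y) C) ^ 2 :=
        mul_le_mul (hfg x y) h1 (by positivity) (sq_nonneg _)
    _ = _ := by ring

lemma MidLogConcave.measureReal_mul_le {E : Type*} [NormedAddCommGroup E] [NormedSpace ℝ E]
    [SecondCountableTopology E] [MeasurableSpace E] [BorelSpace E] {μ : Measure E}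
    [IsFiniteMeasure μ] (hμ : MidLogConcave μ) {C D S : Set E} (hC : IsClosed C) (hD : IsClosed D)
    (hS : IsClosed S) (hCDS : ∀ x ∈ C, ∀ y ∈ D, midpoint ℝ x y ∈ S) :
    μ.real C * μ.real D ≤ μ.real S ^ 2 := by
  rcases C.eq_empty_or_nonempty with hC0 | hC0
  · simp only [hC0, measureReal_empty, zero_mul]; positivity
  rcases D.eq_empty_or_nonempty with hD0 | hD0
  · simp only [hD0, measureReal_empty, mul_zero]; positivity
  obtain ⟨x₀, hx₀⟩ := hC0
  obtain ⟨y₀, hy₀⟩ := hD0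
  have hlim : ∀ T : Set E, IsClosed T → T.Nonempty → Filter.Tendsto
      (fun N : ℕ => ∫ x, Real.exp (-N * Metric.infDist x T) ∂μ) Filter.atTop (nhds (μ.real T)) := by
    intro T hT hT0
    have := tendsto_integral_mul_exp_infDist (μ := μ) hT hT0 (f := fun _ => 1) continuous_const
      (fun _ => ⟨zero_le_one, le_rfl⟩)
    simpa using this
  refine le_of_tendsto_of_tendsto' ((hlim C hC ⟨_, hx₀⟩).mul (hlim D hD ⟨_, hy₀⟩))
    ((hlim S hS ⟨_, hCDS _ hx₀ _ hy₀⟩).pow 2) fun N => ?_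
  exact hμ _ _ _ (by fun_prop) (by fun_prop) (by fun_prop) (exp_infDist_mem C N)
    (exp_infDist_mem D N) (exp_infDist_mem S N) (exp_infDist_mul_le ⟨_, hx₀⟩ ⟨_, hy₀⟩ hCDS N)

lemma midLogConcave_volume_restrict_pi (n : ℕ) (R : ℝ) :
    MidLogConcave (Measure.pi fun _ : Fin n => (volume.restrict (Set.Icc (-R) R) : Measure ℝ)) := by
  induction n with
  | zero =>
    intro f g h _ _ _ _ _ _ hfg
    rw [Measure.pi_of_empty (x := 0)]
    simp only [integral_dirac]
    have := hfg 0 0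
    rwa [midpoint_self] at this
  | succ n ih =>
    have h1 := (measurePreserving_piFinSuccAbove
      (fun _ : Fin (n + 1) => (volume.restrict (Set.Icc (-R) R) : Measure ℝ)) 0).symm
    rw [← h1.map_eq]
    refine ((midLogConcave_volume_restrict_Icc (-R) R).prod ih).map ?_ ?_
    · refine continuous_pi fun i => ?_
      refine Fin.cases ?_ (fun j => ?_) i
      · simpa [MeasurableEquiv.piFinSuccAbove] using continuous_fst
      · simp [MeasurableEquiv.piFinSuccAbove]; fun_prop
    · intro x y
      ext i
      refine Fin.cases ?_ (fun j => ?_) i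
      · simp [MeasurableEquiv.piFinSuccAbove, midpoint_eq_smul_add]; ring
      · simp [MeasurableEquiv.piFinSuccAbove, midpoint_eq_smul_add]; ring

lemma midLogConcave_volume_restrict {n : ℕ} {F : Set (EuclideanSpace ℝ (Fin n))}
    (hF : IsCompact F) (hFc : Convex ℝ F) : MidLogConcave (volume.restrict F) := by
  obtain ⟨R, hR⟩ := hF.isBounded.subset_closedBall 0
  have h1 := midLogConcave_volume_restrict_pi n R
  rw [← Measure.restrict_pi_pi] at h1
  have h2 := h1.map (T := WithLp.toLp 2) (by fun_prop) (fun x y => by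
    simp only [midpoint_eq_smul_add]; rfl)
  set Q : Set (Fin n → ℝ) := Set.univ.pi fun _ => Set.Icc (-R) R
  have h3 : (Measure.map (WithLp.toLp 2) ((Measure.pi fun _ : Fin n => (volume : Measure ℝ)).restrict Q)).restrict F
      = volume.restrict F := by
    have hmp := PiLp.volume_preserving_toLp (Fin n)
    have hQ : MeasurableSet Q := MeasurableSet.univ_pi fun _ => measurableSet_Icc
    ext S hS
    rw [Measure.restrict_apply hS, Measure.restrict_apply hS,
      Measure.map_apply hmp.measurable (hS.inter hF.measurableSet),
      Measure.restrict_apply (hmp.measurable (hS.inter hF.measurableSet)),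
      ← hmp.measure_preimage (hS.inter hF.measurableSet).nullMeasurableSet]
    congr 1
    refine Set.inter_eq_left.mpr fun x hx i _ => ?_
    have h4 := hR hx.2
    rw [mem_closedBall_zero_iff] at h4
    have h5 := (PiLp.norm_apply_le (WithLp.toLp 2 x) i).trans h4
    exact abs_le.mp h5
  rw [← h3]
  have : IsFiniteMeasure ((Measure.pi fun _ : Fin n => (volume : Measure ℝ)).restrict Q) := by
    rw [Measure.restrict_pi_pi]; infer_instance
  exact h2.restrict hF.isClosed hFc

end MidLogConcave

section Hyperplane

lemma MidLogConcave.measure_Icc_eq_zero {ν : Measure ℝ} [IsFiniteMeasure ν] (hν : MidLogConcave ν)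
    (h0 : 0 < ν.real {0}) {a b : ℝ} (ha : 0 < a) (hab : a ≤ b) : ν (Set.Icc a b) = 0 := by
  by_contra hne
  have hpos : 0 < ν.real (Set.Icc a b) := by
    rw [measureReal_def]; exact ENNReal.toReal_pos hne (measure_ne_top _ _)
  set δ := min (ν.real {0}) (ν.real (Set.Icc a b))
  have hδ : 0 < δ := lt_min h0 hpos
  have hlow : ∀ k : ℕ, δ ≤ ν.real (Set.Icc (a / 2 ^ k) (b / 2 ^ k)) := by
    intro k
    induction k with
    | zero =>
      have e : Set.Icc (a / 2 ^ 0) (b / 2 ^ 0) = Set.Icc a b := by simp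
      rw [e]
      exact min_le_right _ _
    | succ k ih =>
      refine le_of_sq_le_sq ?_ measureReal_nonneg
      refine le_trans ?_ (hν.measureReal_mul_le (C := {0})
        (D := Set.Icc (a / 2 ^ k) (b / 2 ^ k)) isClosed_singleton isClosed_Icc isClosed_Icc ?_)
      · rw [sq]
        exact mul_le_mul (min_le_left _ _) ih hδ.le measureReal_nonneg
      · rintro x rfl y hy
        have e : midpoint ℝ 0 y = y / 2 := by
          rw [midpoint_eq_smul_add, smul_eq_mul, invOf_eq_inv]; ring
        rw [e, pow_succ, ← div_div, ← div_div]
        exact ⟨by linarith [hy.1], by linarith [hy.2]⟩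
  have hlim : Filter.Tendsto (fun k : ℕ => ν (Set.Ioc 0 (b / 2 ^ k))) Filter.atTop (nhds 0) := by
    have hanti : Antitone fun k : ℕ => Set.Ioc (0:ℝ) (b / 2 ^ k) := by
      intro i j hij
      refine Set.Ioc_subset_Ioc_right ?_
      gcongr
      · linarith
      · norm_num
    have h := tendsto_measure_iInter_atTop (μ := ν) (fun i => measurableSet_Ioc.nullMeasurableSet)
      hanti ⟨0, measure_ne_top _ _⟩
    have e : ⋂ k : ℕ, Set.Ioc (0:ℝ) (b / 2 ^ k) = ∅ := by
      rw [Set.eq_empty_iff_forall_notMem]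
      intro x hx
      rw [Set.mem_iInter] at hx
      have h1 : Filter.Tendsto (fun k : ℕ => b * (1 / 2) ^ k) Filter.atTop (nhds (b * 0)) :=
        (tendsto_pow_atTop_nhds_zero_of_lt_one (by norm_num) (by norm_num)).const_mul b
      rw [mul_zero] at h1
      have h2 : x ≤ 0 := ge_of_tendsto' h1 fun k => by
        have := (hx k).2
        rwa [div_eq_mul_one_div, ← one_div_pow] at this
      exact absurd (hx 0).1 (not_lt.mpr h2)
    rwa [e, measure_empty] at h
  have hlim2 := (ENNReal.tendsto_toReal ENNReal.zero_ne_top).comp hlim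
  have := ge_of_tendsto' hlim2 fun k => (hlow k).trans (measureReal_mono (fun x hx =>
    ⟨lt_of_lt_of_le (by positivity) hx.1, hx.2⟩) (measure_ne_top _ _))
  simp only [ENNReal.toReal_zero] at this
  linarith

lemma MidLogConcave.measure_Ioi_eq_zero {ν : Measure ℝ} [IsFiniteMeasure ν] (hν : MidLogConcave ν)
    (h0 : 0 < ν.real {0}) : ν (Set.Ioi 0) = 0 := by
  refine measure_mono_null (t := ⋃ k : ℕ, Set.Icc (1 / ((k:ℝ) + 1)) ((k:ℝ) + 1)) ?_
    (measure_iUnion_null fun k => hν.measure_Icc_eq_zero h0 (by positivity) ?_)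
  · intro x hx
    have hx0 : 0 < x := hx
    obtain ⟨k, hk⟩ := exists_nat_one_div_lt hx0
    obtain ⟨l, hl⟩ := exists_nat_ge x
    refine Set.mem_iUnion.mpr ⟨max k l, le_trans ?_ hk.le, ?_⟩
    · gcongr; exact le_max_left _ _
    · have : (l : ℝ) ≤ (max k l : ℕ) := by gcongr; exact le_max_right _ _
      linarith
  · have : (0:ℝ) ≤ k := Nat.cast_nonneg k
    exact (div_le_one (by positivity)).mpr (by linarith) |>.trans (by linarith)

/-- A midpoint log-concave measure charging a hyperplane is concentrated on it. -/
lemma MidLogConcave.measure_ne_zero_eq_zero {E : Type*} [NormedAddCommGroup E] [NormedSpace ℝ E]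
    [SecondCountableTopology E] [MeasurableSpace E] [BorelSpace E] {μ : Measure E}
    [IsFiniteMeasure μ] (hμ : MidLogConcave μ) {l : E → ℝ} (hl : Continuous l)
    (hmid : ∀ x y, l (midpoint ℝ x y) = midpoint ℝ (l x) (l y)) (h0 : μ {x | l x = 0} ≠ 0) :
    μ {x | l x ≠ 0} = 0 := by
  have key : ∀ l : E → ℝ, Continuous l → (∀ x y, l (midpoint ℝ x y) = midpoint ℝ (l x) (l y)) →
      μ {x | l x = 0} ≠ 0 → μ {x | 0 < l x} = 0 := by
    intro l hl hmid h0
    have h1 := (hμ.map hl hmid).measure_Ioi_eq_zero (by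
      rw [measureReal_def, Measure.map_apply hl.measurable (measurableSet_singleton 0)]
      exact ENNReal.toReal_pos h0 (measure_ne_top _ _))
    rwa [Measure.map_apply hl.measurable measurableSet_Ioi] at h1
  have h1 := key l hl hmid h0
  have h2 := key (fun x => -l x) hl.neg (fun x y => by
    rw [hmid]; simp only [midpoint_eq_smul_add, smul_eq_mul]; ring) (by simpa using h0)
  refine measure_mono_null (fun x hx => ?_) (measure_union_null h1 h2)
  rcases lt_or_gt_of_ne (show l x ≠ 0 from hx) with h | h
  · exact Or.inr (show 0 < -l x by linarith)
  · exact Or.inl h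

lemma isClosed_midLogConcave {E : Type*} [NormedAddCommGroup E] [NormedSpace ℝ E]
    [MeasurableSpace E] [BorelSpace E] :
    IsClosed {μ : ProbabilityMeasure E | MidLogConcave (μ : Measure E)} := by
  have hc : ∀ u : E → ℝ, Continuous u → (∀ x, u x ∈ Set.Icc (0:ℝ) 1) →
      Continuous fun μ : ProbabilityMeasure E => ∫ x, u x ∂(μ : Measure E) := by
    intro u hu hu1
    exact ProbabilityMeasure.continuous_integral_boundedContinuousFunction
      (BoundedContinuousFunction.ofNormedAddCommGroup u hu 1 fun x => by
        rw [Real.norm_of_nonneg (hu1 x).1]; exact (hu1 x).2)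
  simp only [MidLogConcave, Set.ofPred_forall]
  refine isClosed_iInter fun f => isClosed_iInter fun g => isClosed_iInter fun h =>
    isClosed_iInter fun hf => isClosed_iInter fun hg => isClosed_iInter fun hh =>
    isClosed_iInter fun hf1 => isClosed_iInter fun hg1 => isClosed_iInter fun hh1 =>
    isClosed_iInter fun _ => ?_
  exact isClosed_le ((hc f hf hf1).mul (hc g hg hg1)) ((hc h hh hh1).pow 2)

end Hyperplane

section Localization

variable {E : Type*} [NormedAddCommGroup E] [MeasurableSpace E] [BorelSpace E]

lemma isClosed_setOf_le_measureReal {T : Set E} (hT : IsClosed T) (a : ℝ) :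
    IsClosed {μ : ProbabilityMeasure E | a ≤ (μ : Measure E).real T} := by
  rw [isClosed_iff_forall_filter]
  intro μ L hL hLs hLμ
  have h := ProbabilityMeasure.limsup_measure_closed_le_of_tendsto (L := L) (μs := id)
    (μ := μ) hLμ hT
  have h2 : ENNReal.ofReal a ≤ (μ : Measure E) T := by
    refine le_trans ?_ h
    refine Filter.le_limsup_of_frequently_le (Filter.Eventually.frequently ?_)
    filter_upwards [Filter.le_principal_iff.mp hLs] with ν hν
    exact ENNReal.ofReal_le_of_le_toReal hν
  exact (ENNReal.ofReal_le_iff_le_toReal (measure_ne_top _ _)).mp h2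

lemma measure_compl_eq_zero_iff_one_le_measureReal {μ : Measure E} [IsProbabilityMeasure μ]
    {C : Set E} (hC : IsClosed C) : μ Cᶜ = 0 ↔ 1 ≤ μ.real C := by
  rw [prob_compl_eq_zero_iff hC.measurableSet]
  refine ⟨fun h => by simp [measureReal_def, h], fun h => ?_⟩
  refine le_antisymm prob_le_one ?_
  rw [← ENNReal.ofReal_one]
  exact ENNReal.ofReal_le_of_le_toReal h

variable [NormedSpace ℝ E]

/-- `C` carries a midpoint log-concave probability measure giving mass at least `a` to `A` and
at least `b` to `B`. -/
def CarriesMass (A B : Set E) (a b : ℝ) (C : Set E) : Prop :=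
  ∃ ν : ProbabilityMeasure E, MidLogConcave (ν : Measure E) ∧ (ν : Measure E) Cᶜ = 0 ∧
    a ≤ (ν : Measure E).real A ∧ b ≤ (ν : Measure E).real B

lemma exists_minimal_carriesMass [SecondCountableTopology E] {F A B : Set E} {a b : ℝ}
    (hF : IsCompact F) (hFc : Convex ℝ F) (hA : IsClosed A) (hB : IsClosed B)
    (h : CarriesMass A B a b F) :
    ∃ C, Minimal (fun C => IsCompact C ∧ Convex ℝ C ∧ CarriesMass A B a b C) C := by
  suffices H : _ by
    obtain ⟨C, -, hC⟩ := zorn_superset_nonempty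
      {C : Set E | IsCompact C ∧ Convex ℝ C ∧ CarriesMass A B a b C} H F ⟨hF, hFc, h⟩
    exact ⟨C, hC⟩
  intro c hcS hc hne
  refine ⟨⋂₀ c, ⟨?_, ?_, ?_⟩, fun s hs => Set.sInter_subset_of_mem hs⟩
  · obtain ⟨C₀, hC₀⟩ := hne
    exact (hcS hC₀).1.of_isClosed_subset (isClosed_sInter fun s hs => (hcS hs).1.isClosed)
      (Set.sInter_subset_of_mem hC₀)
  · exact convex_sInter fun s hs => (hcS hs).2.1
  let T : Set E → Set (ProbabilityMeasure E) := fun C =>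
    {ν | MidLogConcave (ν : Measure E)} ∩ {ν | 1 ≤ (ν : Measure E).real C} ∩
    {ν | a ≤ (ν : Measure E).real A} ∩ {ν | b ≤ (ν : Measure E).real B}
  have hTcl : ∀ C, IsClosed C → IsClosed (T C) := fun C hC =>
    ((isClosed_midLogConcave.inter (isClosed_setOf_le_measureReal hC 1)).inter
      (isClosed_setOf_le_measureReal hA a)).inter (isClosed_setOf_le_measureReal hB b)
  have hTc : ∀ C, IsCompact C → IsCompact (T C) := by
    intro C hC
    refine (isCompact_setOfPred_probabilityMeasure_mass_eq_compl_isCompact_le (u := fun _ => 0)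
      (K := fun _ => C) tendsto_const_nhds (fun _ => hC)
      (Or.inl inferInstance)).of_isClosed_subset (hTcl C hC.isClosed) ?_
    rintro ν ⟨⟨⟨-, h1⟩, -⟩, -⟩ n
    have h2 := (measure_compl_eq_zero_iff_one_le_measureReal hC.isClosed).mpr h1
    rw [← ProbabilityMeasure.ennreal_coeFn_eq_coeFn_toMeasure] at h2
    exact le_of_eq (by exact_mod_cast h2)
  have : Nonempty c := hne.to_subtype
  have hdir : Directed (· ⊇ ·) fun C : c => T C := by
    intro C D
    have hmono : ∀ C D : Set E, C ⊆ D → T C ⊆ T D := by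
      rintro C D hCD ν ⟨⟨⟨h1, h2⟩, h3⟩, h4⟩
      exact ⟨⟨⟨h1, le_trans h2 (measureReal_mono hCD)⟩, h3⟩, h4⟩
    rcases hc.total C.2 D.2 with h | h
    · exact ⟨C, subset_rfl, hmono _ _ h⟩
    · exact ⟨D, hmono _ _ h, subset_rfl⟩
  have hnon : ∀ C : c, (T C).Nonempty := by
    intro C
    obtain ⟨ν, h1, h2, h3, h4⟩ := (hcS C.2).2.2
    exact ⟨ν, ⟨⟨h1, (measure_compl_eq_zero_iff_one_le_measureReal
      (hcS C.2).1.isClosed).mp h2⟩, h3⟩, h4⟩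
  obtain ⟨ν, hν⟩ := IsCompact.nonempty_iInter_of_directed_nonempty_isCompact_isClosed
    (fun C : c => T C) hdir hnon (fun C => hTc C (hcS C.2).1)
    (fun C => hTcl C (hcS C.2).1.isClosed)
  rw [Set.mem_iInter] at hν
  obtain ⟨C₀, hC₀⟩ := hne
  obtain ⟨⟨⟨h1, -⟩, h2⟩, h3⟩ := hν ⟨C₀, hC₀⟩
  refine ⟨ν, h1, ?_, h2, h3⟩
  obtain ⟨t, htc, hts, htU⟩ := TopologicalSpace.isOpen_sUnion_countable (compl '' c) (by
    rintro _ ⟨s, hs, rfl⟩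
    exact (hcS hs).1.isClosed.isOpen_compl)
  rw [Set.compl_sInter, ← htU]
  refine (measure_sUnion_null_iff htc).mpr fun s hs => ?_
  obtain ⟨D, hD, rfl⟩ := hts hs
  exact (measure_compl_eq_zero_iff_one_le_measureReal (hcS hD).1.isClosed).mpr
    (hν ⟨D, hD⟩).1.1.2

lemma CarriesMass.inter [SecondCountableTopology E] {A B C H : Set E} {a b : ℝ}
    {ν : ProbabilityMeasure E} (hν : MidLogConcave (ν : Measure E)) (hC : (ν : Measure E) Cᶜ = 0)
    (hA : IsClosed A) (hB : IsClosed B)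
    (hH : IsClosed H) (hHc : Convex ℝ H) (h0 : (ν : Measure E) H ≠ 0)
    (ha : a * (ν : Measure E).real H ≤ (ν : Measure E).real (A ∩ H))
    (hb : b * (ν : Measure E).real H ≤ (ν : Measure E).real (B ∩ H)) :
    CarriesMass A B a b (C ∩ H) := by
  set μ : Measure E := (ν : Measure E)
  have hpos : 0 < μ.real H := by
    rw [measureReal_def]; exact ENNReal.toReal_pos h0 (measure_ne_top _ _)
  have hprob : IsProbabilityMeasure ((μ H)⁻¹ • μ.restrict H) := ⟨by
    simp only [Measure.smul_apply, Measure.restrict_apply_univ, smul_eq_mul]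
    exact ENNReal.inv_mul_cancel h0 (measure_ne_top _ _)⟩
  have hval : ∀ S : Set E, IsClosed S →
      ((μ H)⁻¹ • μ.restrict H).real S = μ.real (S ∩ H) / μ.real H := by
    intro S hS
    rw [measureReal_ennreal_smul_apply, measureReal_restrict_apply hS.measurableSet,
      ENNReal.toReal_inv, ← measureReal_def]
    ring
  refine ⟨⟨(μ H)⁻¹ • μ.restrict H, hprob⟩, (hν.restrict hH hHc).smul _, ?_, ?_, ?_⟩
  · show ((μ H)⁻¹ • μ.restrict H) (C ∩ H)ᶜ = 0
    rw [Measure.smul_apply, smul_eq_mul, Set.compl_inter]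
    refine mul_eq_zero_of_right _ (measure_union_null ?_ ?_)
    · exact Measure.restrict_apply_eq_zero' hH.measurableSet |>.mpr
        (measure_mono_null Set.inter_subset_left hC)
    · exact Measure.restrict_apply_eq_zero' hH.measurableSet |>.mpr (by simp)
  · show a ≤ ((μ H)⁻¹ • μ.restrict H).real A
    rw [hval A hA, le_div_iff₀ hpos]; exact ha
  · show b ≤ ((μ H)⁻¹ • μ.restrict H).real B
    rw [hval B hB, le_div_iff₀ hpos]; exact hb

end Localization

section Bisection

variable {E : Type*} [NormedAddCommGroup E] [MeasurableSpace E] [BorelSpace E]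

open scoped RealInnerProductSpace

lemma continuous_measureReal_inter_halfspace {μ : Measure E} [IsFiniteMeasure μ] {S : Set E}
    (hS : MeasurableSet S) {l : ℝ → E → ℝ} (hl : ∀ θ, Continuous (l θ))
    (hl' : ∀ x, Continuous fun θ => l θ x) (h0 : ∀ θ, μ {x | l θ x = 0} = 0) :
    Continuous fun θ => μ.real (S ∩ {x | 0 ≤ l θ x}) := by
  have hm : ∀ θ, MeasurableSet (S ∩ {x | 0 ≤ l θ x}) := fun θ =>
    hS.inter (isClosed_le continuous_const (hl θ)).measurableSet
  have e : ∀ θ, μ.real (S ∩ {x | 0 ≤ l θ x}) =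
      ∫ x, (S ∩ {x | 0 ≤ l θ x}).indicator (fun _ => (1:ℝ)) x ∂μ := fun θ => by
    rw [integral_indicator_const _ (hm θ), smul_eq_mul, mul_one]
  simp only [e]
  rw [continuous_iff_continuousAt]
  intro θ₀
  refine continuousAt_of_dominated (bound := fun _ => 1) (Filter.Eventually.of_forall fun θ =>
    (measurable_const.indicator (hm θ)).aestronglyMeasurable)
    (Filter.Eventually.of_forall fun θ => Filter.Eventually.of_forall fun x => ?_)
    (integrable_const _) ?_
  · classical
    rw [Set.indicator_apply]; split_ifs <;> simp
  · have : ∀ᵐ x ∂μ, l θ₀ x ≠ 0 := by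
      rw [ae_iff]; simpa using h0 θ₀
    filter_upwards [this] with x hx
    have hev : ∀ᶠ θ in nhds θ₀, (0 ≤ l θ x ↔ 0 ≤ l θ₀ x) := by
      rcases lt_or_gt_of_ne hx with h | h
      · filter_upwards [(hl' x).continuousAt.eventually_lt continuousAt_const h] with θ hθ
        exact ⟨fun h' => absurd h' (not_le.mpr hθ), fun h' => absurd h' (not_le.mpr h)⟩
      · filter_upwards [continuousAt_const.eventually_lt (hl' x).continuousAt h] with θ hθ
        exact ⟨fun _ => h.le, fun _ => hθ.le⟩
    refine continuousAt_const.congr (f := fun _ =>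
      (S ∩ {x | 0 ≤ l θ₀ x}).indicator (fun _ => (1:ℝ)) x) ?_
    filter_upwards [hev] with θ hθ
    have : (x ∈ S ∩ {x | 0 ≤ l θ₀ x}) ↔ x ∈ S ∩ {x | 0 ≤ l θ x} :=
      and_congr_right fun _ => hθ.symm
    by_cases h : x ∈ S ∩ {x | 0 ≤ l θ₀ x}
    · rw [Set.indicator_of_mem h, Set.indicator_of_mem (this.mp h)]
    · rw [Set.indicator_of_notMem h, Set.indicator_of_notMem (fun h' => h (this.mpr h'))]

variable [InnerProductSpace ℝ E] [SecondCountableTopology E]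

lemma collinear_of_minimal_carriesMass {A B C : Set E} {a b : ℝ} (hA : IsClosed A)
    (hB : IsClosed B)
    (hC : Minimal (fun C => IsCompact C ∧ Convex ℝ C ∧ CarriesMass A B a b C) C) :
    Collinear ℝ C := by
  obtain ⟨⟨hCc, hCconv, ν, hν, hνC, ha, hb⟩, hmin⟩ := hC
  have hsub : ∀ H : Set E, IsClosed H → Convex ℝ H → CarriesMass A B a b (C ∩ H) → C ⊆ H :=
    fun H hH hHc h x hx => (hmin ⟨hCc.inter_right hH, hCconv.inter hHc, h⟩
      Set.inter_subset_left hx).2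
  set μ : Measure E := (ν : Measure E)
  obtain ⟨p, hp⟩ : C.Nonempty := by
    rw [Set.nonempty_iff_ne_empty]
    rintro rfl
    simp at hνC
  rw [collinear_iff_of_mem hp]
  by_contra hcol
  push Not at hcol
  obtain ⟨q, hq, hqp⟩ := hcol 0
  obtain ⟨r, hr, hrp⟩ := hcol (q - p)
  have hu : q - p ≠ 0 := fun h => by
    refine hqp 0 ?_
    rw [sub_eq_zero.mp h]; simp
  set u := q - p
  set w := r - p with hw
  have hz : ∀ θ : ℝ, Real.cos θ • u + Real.sin θ • w ≠ 0 := by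
    intro θ h
    by_cases hs : Real.sin θ = 0
    · rw [hs, zero_smul, add_zero] at h
      rcases smul_eq_zero.mp h with hc | hc
      · have := Real.sin_sq_add_cos_sq θ
        rw [hs, hc] at this; norm_num at this
      · exact hu hc
    · refine hrp (-(Real.cos θ) / Real.sin θ) ?_
      have : w = (-(Real.cos θ) / Real.sin θ) • u := by
        rw [div_eq_inv_mul, mul_smul, neg_smul, ← eq_neg_of_add_eq_zero_right h,
          inv_smul_smul₀ hs]
      rw [vadd_eq_add, ← this, hw]; abel
  let x₀ : E := p + (1 / 3 : ℝ) • (u + w)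
  let l : ℝ → E → ℝ := fun θ x => ⟪Real.cos θ • u + Real.sin θ • w, x - x₀⟫
  have hlc : ∀ θ, Continuous (l θ) := fun θ => by fun_prop
  have hlc' : ∀ x, Continuous fun θ => l θ x := fun x => by fun_prop
  have hmid : ∀ θ x y, l θ (midpoint ℝ x y) = midpoint ℝ (l θ x) (l θ y) := by
    intro θ x y
    simp only [l, midpoint_eq_smul_add, smul_eq_mul, ← inner_add_right, ← inner_smul_right]
    congr 1
    rw [invOf_eq_inv]
    module
  have hconv : ∀ θ, Convex ℝ {x | 0 ≤ l θ x} := by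
    intro θ x hx y hy s t hs ht hst
    have e : l θ (s • x + t • y) = s * l θ x + t * l θ y := by
      simp only [l, ← inner_smul_right, ← inner_add_right]
      congr 1
      obtain rfl : t = 1 - s := by linarith
      module
    show 0 ≤ l θ (s • x + t • y)
    rw [e]
    exact add_nonneg (mul_nonneg hs hx) (mul_nonneg ht hy)
  have hclosed : ∀ θ, IsClosed {x | 0 ≤ l θ x} := fun θ => isClosed_le continuous_const (hlc θ)
  have hpi : ∀ θ x, l (θ + Real.pi) x = -l θ x := by
    intro θ x
    simp only [l, Real.cos_add_pi, Real.sin_add_pi, ← inner_neg_left]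
    congr 1
    module
  have hnotsub : ∀ θ, ¬ C ⊆ {x | 0 ≤ l θ x} := by
    intro θ h
    have h1 : 0 ≤ l θ p := h hp
    have h2 : 0 ≤ l θ q := h hq
    have h3 : 0 ≤ l θ r := h hr
    set z := Real.cos θ • u + Real.sin θ • w with hzdef
    have e1 : l θ q - l θ p = ⟪z, u⟫ := by
      simp only [l, ← hzdef, ← inner_sub_right]; congr 1; simp only [u]; abel
    have e2 : l θ r - l θ p = ⟪z, w⟫ := by
      simp only [l, ← hzdef, ← inner_sub_right]; congr 1; simp only [w]; abel
    have e3 : l θ p = -(1 / 3) * (⟪z, u⟫ + ⟪z, w⟫) := by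
      simp only [l, ← hzdef, ← inner_add_right, ← inner_smul_right]; congr 1
      simp only [x₀]; module
    have hu0 : ⟪z, u⟫ = 0 := by linarith
    have hw0 : ⟪z, w⟫ = 0 := by linarith
    have : ⟪z, z⟫ = 0 := by
      nth_rewrite 2 [hzdef]
      rw [inner_add_right, inner_smul_right, inner_smul_right, hu0, hw0]; simp
    exact hz θ (inner_self_eq_zero.mp this)
  have hnull : ∀ θ, μ {x | l θ x = 0} = 0 := by
    intro θ
    by_contra h
    have h1 := hν.measure_ne_zero_eq_zero (hlc θ) (hmid θ) h
    refine hnotsub θ (hsub _ (hclosed θ) (hconv θ) ⟨ν, hν, ?_, ha, hb⟩)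
    rw [Set.compl_inter]
    refine measure_union_null hνC (measure_mono_null (fun x hx => ?_) h1)
    exact fun h0 => hx (show 0 ≤ l θ x from h0.ge)
  have hpos : ∀ θ, μ {x | 0 ≤ l θ x} ≠ 0 := by
    intro θ h
    refine hnotsub (θ + Real.pi) (hsub _ (hclosed _) (hconv _) ⟨ν, hν, ?_, ha, hb⟩)
    rw [Set.compl_inter]
    refine measure_union_null hνC (measure_mono_null (fun x hx => ?_) h)
    have hx' : ¬ 0 ≤ l (θ + Real.pi) x := hx
    rw [hpi] at hx'
    show 0 ≤ l θ x
    linarith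
  have hsplit : ∀ θ, ∀ S : Set E, MeasurableSet S →
      μ.real (S ∩ {x | 0 ≤ l θ x}) + μ.real (S ∩ {x | 0 ≤ l (θ + Real.pi) x}) = μ.real S := by
    intro θ S hS
    rw [← measureReal_inter_add_sdiff (s := S) (hclosed θ).measurableSet]
    congr 1
    refine measureReal_congr ?_
    have : ∀ᵐ x ∂μ, l θ x ≠ 0 := by
      rw [ae_iff]; simpa using hnull θ
    filter_upwards [this] with x hx
    refine propext (and_congr_right fun _ => ?_)
    show 0 ≤ l (θ + Real.pi) x ↔ ¬ 0 ≤ l θ x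
    rw [hpi, not_le]
    exact ⟨fun h => lt_of_le_of_ne (by linarith) hx, fun h => by linarith⟩
  let ψ : ℝ → ℝ := fun θ =>
    μ.real (A ∩ {x | 0 ≤ l θ x}) - μ.real A * μ.real (Set.univ ∩ {x | 0 ≤ l θ x})
  have hψ : Continuous ψ :=
    (continuous_measureReal_inter_halfspace hA.measurableSet hlc hlc' hnull).sub
      (continuous_const.mul
        (continuous_measureReal_inter_halfspace MeasurableSet.univ hlc hlc' hnull))
  have hψπ : ψ 0 + ψ (0 + Real.pi) = 0 := by
    have h1 := hsplit 0 A hA.measurableSet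
    have h2 := hsplit 0 Set.univ MeasurableSet.univ
    rw [probReal_univ] at h2
    simp only [ψ]
    linear_combination h1 - μ.real A * h2
  obtain ⟨θ, hθ⟩ : ∃ θ, ψ θ = 0 := by
    rcases le_total (ψ 0) 0 with h | h
    · exact mem_range_of_exists_le_of_exists_ge hψ ⟨0, h⟩ ⟨0 + Real.pi, by linarith⟩
    · exact mem_range_of_exists_le_of_exists_ge hψ ⟨0 + Real.pi, by linarith⟩ ⟨0, h⟩
  have h1 := hsplit θ A hA.measurableSet
  have h2 := hsplit θ Set.univ MeasurableSet.univ
  have h3 := hsplit θ B hB.measurableSet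
  rw [probReal_univ] at h2
  simp only [ψ, Set.univ_inter] at hθ h2
  have hcases : ∀ θ, a * μ.real {x | 0 ≤ l θ x} ≤ μ.real (A ∩ {x | 0 ≤ l θ x}) →
      ¬ b * μ.real {x | 0 ≤ l θ x} ≤ μ.real (B ∩ {x | 0 ≤ l θ x}) := fun θ h h' =>
    hnotsub θ (hsub _ (hclosed θ) (hconv θ)
      (CarriesMass.inter hν hνC hA hB (hclosed θ) (hconv θ) (hpos θ) h h'))
  have hn1 : 0 ≤ μ.real {x | 0 ≤ l θ x} := measureReal_nonneg
  have hn2 : 0 ≤ μ.real {x | 0 ≤ l (θ + Real.pi) x} := measureReal_nonneg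
  have h4 : μ.real (A ∩ {x | 0 ≤ l (θ + Real.pi) x}) =
      μ.real A * μ.real {x | 0 ≤ l (θ + Real.pi) x} := by
    linear_combination h1 - hθ - μ.real A * h2
  have hb1 := hcases θ ((mul_le_mul_of_nonneg_right ha hn1).trans (by linarith))
  have hb2 := hcases (θ + Real.pi) ((mul_le_mul_of_nonneg_right ha hn2).trans h4.ge)
  rw [not_le] at hb1 hb2
  have h5 : b * μ.real {x | 0 ≤ l θ x} + b * μ.real {x | 0 ≤ l (θ + Real.pi) x} = b := by
    rw [← mul_add, h2, mul_one]
  linarith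

end Bisection

section Sublevel

/-- The restriction of a polynomial to the line `t ↦ x + t • v`. -/
noncomputable def MvPolynomial.restrictLine {n : ℕ} (P : MvPolynomial (Fin n) ℝ)
    (x v : EuclideanSpace ℝ (Fin n)) : Polynomial ℝ :=
  MvPolynomial.aeval (fun i => Polynomial.C (x i) + Polynomial.X * Polynomial.C (v i)) P

lemma MvPolynomial.natDegree_restrictLine_le {n d : ℕ} {P : MvPolynomial (Fin n) ℝ}
    (hP : P.totalDegree ≤ d) (x v : EuclideanSpace ℝ (Fin n)) :
    (P.restrictLine x v).natDegree ≤ d := by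
  have h := MvPolynomial.aeval_natDegree_le P hP
    (fun i => Polynomial.C (x i) + Polynomial.X * Polynomial.C (v i)) (n := 1) fun i => by
      compute_degree
  rwa [mul_one] at h

lemma MvPolynomial.eval_restrictLine {n : ℕ} (P : MvPolynomial (Fin n) ℝ)
    (x v : EuclideanSpace ℝ (Fin n)) (t : ℝ) :
    (P.restrictLine x v).eval t = MvPolynomial.eval (fun i => (t • v + x) i) P := by
  rw [MvPolynomial.restrictLine, MvPolynomial.aeval_def, MvPolynomial.polynomial_eval_eval₂,
    MvPolynomial.eval, MvPolynomial.coe_eval₂Hom]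
  congr 1
  · ext; simp
  · ext i; simp; ring

lemma measureReal_sublevel_le_of_collinear {n d : ℕ} (hd : d ≠ 0) {P : MvPolynomial (Fin n) ℝ}
    (hP : P.totalDegree ≤ d) {C : Set (EuclideanSpace ℝ (Fin n))} (hC : IsCompact C)
    (hCl : Collinear ℝ C) {ν : Measure (EuclideanSpace ℝ (Fin n))} [IsProbabilityMeasure ν]
    (hν : MidLogConcave ν) (hνC : ν Cᶜ = 0) {s M : ℝ} (hs : 0 < s) (hsM : s < M)
    (hA : Real.exp (-1) ≤ ν.real {x | M ≤ |MvPolynomial.eval (fun i => x i) P|}) :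
    ν.real {x | |MvPolynomial.eval (fun i => x i) P| ≤ s} ≤ 4 * (s / M) ^ (1 / d : ℝ) := by
  obtain ⟨x₀, v, hv⟩ := (collinear_iff_exists_forall_eq_smul_vadd C).mp hCl
  let T : EuclideanSpace ℝ (Fin n) → ℝ := fun x => inner ℝ v (x - x₀) / inner ℝ v v
  have hT : Continuous T := by fun_prop
  have hTmid : ∀ x y, T (midpoint ℝ x y) = midpoint ℝ (T x) (T y) := by
    intro x y
    have e : midpoint ℝ x y - x₀ = (1 / 2 : ℝ) • (x - x₀) + (1 / 2 : ℝ) • (y - x₀) := by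
      rw [midpoint_eq_smul_add, invOf_eq_inv]; module
    simp only [T]
    rw [e, inner_add_right, inner_smul_right, inner_smul_right, midpoint_eq_smul_add,
      invOf_eq_inv, smul_eq_mul]
    ring
  have hCT : ∀ x ∈ C, T x • v + x₀ = x := by
    intro x hx
    obtain ⟨r, hr⟩ := hv x hx
    rw [vadd_eq_add] at hr
    by_cases h0 : v = 0
    · rw [hr, h0]; simp
    · have : T x = r := by
        simp only [T]
        rw [hr, add_sub_cancel_right, inner_smul_right]
        exact mul_div_cancel_right₀ _ (inner_self_ne_zero.mpr h0)
      rw [this, ← hr]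
  have hae : ∀ᵐ x ∂ν, x ∈ C := by rw [ae_iff]; exact hνC
  set p := P.restrictLine x₀ v
  have hp : ∀ x ∈ C, p.eval (T x) = MvPolynomial.eval (fun i => x i) P := by
    intro x hx
    rw [MvPolynomial.eval_restrictLine, hCT x hx]
  have hprob : IsProbabilityMeasure (ν.map T) :=
    Measure.isProbabilityMeasure_map hT.measurable.aemeasurable
  have hmap : ∀ S : Set ℝ, MeasurableSet S → (ν.map T).real S = ν.real (T ⁻¹' S) := fun S hS =>
    map_measureReal_apply hT.measurable hS
  have hpc : Continuous fun t => |p.eval t| := p.continuous.abs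
  obtain ⟨R, hR⟩ := (hC.image hT).isBounded.subset_closedBall 0
  rw [Real.closedBall_eq_Icc, zero_sub, zero_add] at hR
  have h := (hν.map hT hTmid).measureReal_le (R := R) ?_ hd
    (P.natDegree_restrictLine_le hP x₀ v) hs hsM ?_
  · refine le_trans (le_of_eq ?_) h
    rw [hmap _ (isClosed_le hpc continuous_const).measurableSet]
    refine measureReal_congr ?_
    filter_upwards [hae] with x hx
    refine propext ?_
    show _ ≤ s ↔ |p.eval (T x)| ≤ s
    rw [hp x hx]
  · rw [Measure.map_apply hT.measurable measurableSet_Icc.compl]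
    exact measure_mono_null (fun x hx hxC => hx (hR ⟨x, hxC, rfl⟩)) hνC
  · refine hA.trans (le_of_eq ?_)
    rw [hmap _ (isClosed_le continuous_const hpc).measurableSet]
    refine measureReal_congr ?_
    filter_upwards [hae] with x hx
    refine propext ?_
    show M ≤ _ ↔ M ≤ |p.eval (T x)|
    rw [hp x hx]

/-- A polynomial of degree at most `d` that is at least `M` in absolute value on a `1/e` portion
of a convex body is small only on a small portion of it. -/
lemma measureReal_sublevel_le {n d : ℕ} (hd : d ≠ 0) {P : MvPolynomial (Fin n) ℝ}
    (hP : P.totalDegree ≤ d) {F : Set (EuclideanSpace ℝ (Fin n))} (hF : IsCompact F)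
    (hFc : Convex ℝ F) (hF1 : volume F = 1) {s M : ℝ} (hs : 0 < s) (hM : 0 < M)
    (hA : Real.exp (-1) ≤
      (volume.restrict F).real {x | M ≤ |MvPolynomial.eval (fun i => x i) P|}) :
    (volume.restrict F).real {x | |MvPolynomial.eval (fun i => x i) P| ≤ s} ≤
      4 * (s / M) ^ (1 / d : ℝ) := by
  have hprob : IsProbabilityMeasure (volume.restrict F) := ⟨by
    rw [Measure.restrict_apply_univ, hF1]⟩
  rcases le_or_gt M s with hsM | hsM
  · have : 1 ≤ (s / M) ^ (1 / d : ℝ) :=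
      Real.one_le_rpow ((one_le_div hM).mpr hsM) (by positivity)
    exact measureReal_le_one.trans (by linarith)
  have hPc : Continuous fun x : EuclideanSpace ℝ (Fin n) =>
      |MvPolynomial.eval (fun i => x i) P| :=
    (MvPolynomial.continuous_eval P |>.comp (by fun_prop)).abs
  obtain ⟨C, hC⟩ := exists_minimal_carriesMass hF hFc
    (isClosed_le continuous_const hPc) (isClosed_le hPc continuous_const)
    ⟨⟨volume.restrict F, hprob⟩, midLogConcave_volume_restrict hF hFc,
      show volume.restrict F Fᶜ = 0 by
        rw [Measure.restrict_apply hF.measurableSet.compl, Set.compl_inter_self, measure_empty],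
      hA, le_rfl⟩
  have hcol := collinear_of_minimal_carriesMass
    (isClosed_le continuous_const hPc) (isClosed_le hPc continuous_const) hC
  obtain ⟨⟨hCc, -, ν, hν, hνC, ha, hb⟩, -⟩ := hC
  exact hb.trans (measureReal_sublevel_le_of_collinear hd hP hCc hcol hν hνC hs hsM ha)

end Sublevel

section NegativeMoment

lemma lintegral_rpow_tail_le {T β : ℝ} (hT : 0 < T) (hβ : 1 < β) {m : ℝ → ENNReal}
    (hm1 : ∀ t, m t ≤ 1) (hm : ∀ t, 0 < t → m t ≤ ENNReal.ofReal ((T / t) ^ β)) :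
    ∫⁻ t in Set.Ioi 0, m t ≤ ENNReal.ofReal (T * (1 / (1 - 1 / β))) := by
  have hb : 0 < β - 1 := by linarith
  rw [← Set.Ioc_union_Ioi_eq_Ioi hT.le]
  refine (lintegral_union_le _ _ _).trans ?_
  have h1 : ∫⁻ t in Set.Ioc 0 T, m t ≤ ENNReal.ofReal T := by
    refine (lintegral_mono hm1).trans ?_
    simp
  have h2 : ∫⁻ t in Set.Ioi T, m t ≤ ENNReal.ofReal (T / (β - 1)) := by
    have hint : IntegrableOn (fun t : ℝ => T ^ β * t ^ (-β)) (Set.Ioi T) :=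
      (integrableOn_Ioi_rpow_of_lt (by linarith) hT).const_mul _
    have hval : ∫ t in Set.Ioi T, T ^ β * t ^ (-β) = T / (β - 1) := by
      rw [integral_const_mul, integral_Ioi_rpow_of_lt (by linarith) hT]
      have : T ^ β * T ^ (-β + 1) = T := by
        rw [← Real.rpow_add hT]; simp
      rw [mul_div_assoc', mul_neg, this, ← neg_div_neg_eq]
      congr 1
      · ring
      · ring
    rw [← hval, ofReal_integral_eq_lintegral_ofReal hint]
    · refine setLIntegral_mono' measurableSet_Ioi fun t ht => ?_
      have ht0 : 0 < t := hT.trans ht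
      rw [Real.rpow_neg ht0.le, ← div_eq_mul_inv, ← Real.div_rpow hT.le ht0.le]
      exact hm t ht0
    · refine (ae_restrict_iff' measurableSet_Ioi).mpr (Filter.Eventually.of_forall fun t ht => ?_)
      have ht0 : 0 < t := hT.trans ht
      show 0 ≤ T ^ β * t ^ (-β)
      positivity
  refine (add_le_add h1 h2).trans (le_of_eq ?_)
  rw [← ENNReal.ofReal_add hT.le (by positivity)]
  congr 1
  field_simp
  ring

/-- Sublevel set estimates of order `α` give negative moments of order `q < α`. -/
lemma integral_rpow_neg_le {X : Type*} [MeasurableSpace X] {μ : Measure X}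
    [IsProbabilityMeasure μ] {f : X → ℝ} (hf : Measurable f) (hf0 : ∀ x, 0 ≤ f x) {K α q : ℝ}
    (hK : 0 < K) (hq : 0 < q) (hqα : q < α)
    (hs : ∀ s, 0 < s → μ.real {x | f x ≤ s} ≤ (s / K) ^ α) :
    0 < ∫ x, f x ^ (-q) ∂μ ∧ ∫ x, f x ^ (-q) ∂μ ≤ K ^ (-q) * (1 / (1 - q / α)) := by
  have hα : 0 < α := hq.trans hqα
  have hT : 0 < K ^ (-q) := Real.rpow_pos_of_pos hK _
  have hmeas : Measurable fun x => f x ^ (-q) := hf.pow_const _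
  have hnn : ∀ x, 0 ≤ f x ^ (-q) := fun x => Real.rpow_nonneg (hf0 x) _
  have hbound : ∫⁻ x, ENNReal.ofReal (f x ^ (-q)) ∂μ ≤
      ENNReal.ofReal (K ^ (-q) * (1 / (1 - q / α))) := by
    rw [lintegral_eq_lintegral_meas_le μ (Filter.Eventually.of_forall hnn) hmeas.aemeasurable]
    have e : q / α = 1 / (α / q) := by rw [one_div_div]
    rw [e]
    refine lintegral_rpow_tail_le hT ((one_lt_div hq).mpr hqα) (fun t => prob_le_one) ?_
    intro t ht
    have hsub : {x | t ≤ f x ^ (-q)} ⊆ {x | f x ≤ t ^ (-(1 / q))} := by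
      intro x hx
      have hx' : t ≤ f x ^ (-q) := hx
      rcases (hf0 x).eq_or_lt with h0 | h0
      · show f x ≤ _
        rw [← h0]; positivity
      · show f x ≤ _
        have h1 := Real.rpow_le_rpow_of_nonpos ht hx' (z := -(1 / q))
          (by have : 0 < 1 / q := by positivity
              linarith)
        rwa [← Real.rpow_mul h0.le, show -q * -(1 / q) = 1 by field_simp, Real.rpow_one] at h1
    have hts : 0 < t ^ (-(1 / q)) := Real.rpow_pos_of_pos ht _
    refine (measure_mono hsub).trans ?_
    rw [← ENNReal.ofReal_toReal (measure_ne_top μ {x | f x ≤ t ^ (-(1 / q))})]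
    refine ENNReal.ofReal_le_ofReal ((hs _ hts).trans (le_of_eq ?_))
    rw [Real.div_rpow hts.le hK.le, Real.div_rpow hT.le ht.le, ← Real.rpow_mul ht.le,
      ← Real.rpow_mul hK.le, show -q * (α / q) = -α by field_simp,
      show -(1 / q) * α = -(α / q) by ring, Real.rpow_neg ht.le, Real.rpow_neg hK.le]
    ring
  have hc : 0 ≤ K ^ (-q) * (1 / (1 - q / α)) := by
    have : q / α < 1 := (div_lt_one hα).mpr hqα
    have : 0 < 1 - q / α := by linarith
    positivity
  have hint : Integrable (fun x => f x ^ (-q)) μ := by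
    refine ⟨hmeas.aestronglyMeasurable, ?_⟩
    rw [hasFiniteIntegral_iff_ofReal (Filter.Eventually.of_forall hnn)]
    exact hbound.trans_lt ENNReal.ofReal_lt_top
  refine ⟨?_, ?_⟩
  · rw [integral_pos_iff_support_of_nonneg hnn hint, pos_iff_ne_zero]
    intro h0
    have h1 := hs (K / 2) (by positivity)
    rw [div_right_comm, div_self hK.ne'] at h1
    have h2 : ((1:ℝ) / 2) ^ α < 1 := Real.rpow_lt_one (by norm_num) (by norm_num) hα
    have h3 : μ {x | f x ≤ K / 2}ᶜ = 0 := by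
      refine measure_mono_null (fun x hx => ?_) h0
      have hx' : K / 2 < f x := not_le.mp hx
      have : 0 < f x := lt_trans (by positivity) hx'
      exact (Real.rpow_pos_of_pos this _).ne'
    rw [prob_compl_eq_zero_iff (measurableSet_le hf measurable_const)] at h3
    rw [measureReal_def, h3, ENNReal.toReal_one] at h1
    linarith
  · rw [integral_eq_lintegral_of_nonneg_ae (Filter.Eventually.of_forall hnn)
      hmeas.aestronglyMeasurable]
    exact ENNReal.toReal_le_of_le_ofReal hc hbound

end NegativeMoment

/-- `L^{-q}` estimate: for `0 < q < 1/d`,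
`∫_F |P|^{-q} ≤ (4^d/M(P))^q /(1-qd)`, equivalently
`‖P‖_{L^{-q}(F)} ≥ 4^{-d}(1-qd)^{1/q} M(P)`. -/
theorem negative_moment_estimate {n : ℕ} (d : ℕ) (P : MvPolynomial (Fin n) ℝ)
    (hPd : P.totalDegree ≤ d) (hPnc : ∀ c : ℝ, P ≠ MvPolynomial.C c)
    (F : Set (EuclideanSpace ℝ (Fin n))) (hFcomp : IsCompact F) (hFconv : Convex ℝ F)
    (hFvol : volume F = 1)
    (M : ℝ) (hM : 0 < M)
    (hMdef : volume {x ∈ F | M ≤ |MvPolynomial.eval (fun i => x i) P|} =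
      ENNReal.ofReal (Real.exp (-1)))
    (q : ℝ) (hq0 : 0 < q) (hq : q < 1 / (d : ℝ)) :
    (∫ x in F, |MvPolynomial.eval (fun i => x i) P| ^ (-q)) ≤
      ((4 : ℝ) ^ d / M) ^ q * (1 / (1 - q * d)) ∧
    (∫ x in F, |MvPolynomial.eval (fun i => x i) P| ^ (-q)) ^ (-(1 / q)) ≥
      ((4 : ℝ) ^ d)⁻¹ * (1 - q * d) ^ (1 / q) * M := by
  have hd : d ≠ 0 := by
    rintro rfl
    simp at hq
    linarith
  have hd0 : (0:ℝ) < d := by positivity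
  have hqd : 0 < 1 - q * d := by
    rw [lt_div_iff₀ hd0] at hq
    linarith
  have hprob : IsProbabilityMeasure (volume.restrict F) := ⟨by
    rw [Measure.restrict_apply_univ, hFvol]⟩
  have hPc : Continuous fun x : EuclideanSpace ℝ (Fin n) =>
      |MvPolynomial.eval (fun i => x i) P| :=
    (MvPolynomial.continuous_eval P |>.comp (by fun_prop)).abs
  have hA : Real.exp (-1) ≤
      (volume.restrict F).real {x | M ≤ |MvPolynomial.eval (fun i => x i) P|} := by
    rw [measureReal_def, Measure.restrict_apply (isClosed_le continuous_const hPc).measurableSet,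
      Set.inter_comm]
    have e : F ∩ {x | M ≤ |MvPolynomial.eval (fun i => x i) P|} =
        {x ∈ F | M ≤ |MvPolynomial.eval (fun i => x i) P|} := rfl
    rw [e, hMdef, ENNReal.toReal_ofReal (Real.exp_pos _).le]
  obtain ⟨hpos, hle⟩ := integral_rpow_neg_le (μ := volume.restrict F) (K := M / 4 ^ d)
    (α := 1 / d) (q := q) hPc.measurable (fun x => abs_nonneg _) (by positivity) hq0 hq
    fun s hs => by
      refine (measureReal_sublevel_le hd hPd hFcomp hFconv hFvol hs hM hA).trans (le_of_eq ?_)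
      rw [show s / (M / 4 ^ d) = 4 ^ d * (s / M) by field_simp,
        Real.mul_rpow (by positivity) (by positivity), one_div,
        Real.pow_rpow_inv_natCast (by norm_num) hd]
  have hK : (M / 4 ^ d) ^ (-q) = ((4:ℝ) ^ d / M) ^ q := by
    rw [Real.rpow_neg (by positivity), ← Real.inv_rpow (by positivity), inv_div]
  rw [hK, show q / (1 / d) = q * d by field_simp] at hle
  refine ⟨hle, ?_⟩
  have hneg : -(1 / q) ≤ 0 := by
    have : 0 < 1 / q := by positivity
    linarith
  refine le_trans (le_of_eq ?_) (Real.rpow_le_rpow_of_nonpos hpos hle hneg)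
  rw [Real.mul_rpow (by positivity) (by positivity), ← Real.rpow_mul (by positivity),
    show q * -(1 / q) = -1 by field_simp, Real.rpow_neg_one, inv_div, one_div (1 - q * d),
    Real.rpow_neg (by positivity), ← Real.inv_rpow (by positivity), inv_inv]
  ring
end
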